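/- Let (ΛV,d) be an F₀-model, i.e. an elliptic minimal Sullivan model with homotopy characteristic χ_π(ΛV)=0. Then for every integer r ≥ 2 one has TC_r(ΛV) = r·cat(ΛV), or equivalently zcl_r(ΛV) = r·cl_Q(ΛV). -/

import Mathlib

noncomputable section

namespace RHT

/-- A graded-commutative differential graded algebra over `ℚ`, graded by `ℕ`,
with a degree `+1` differential satisfying the graded Leibniz rule. -/
class GCDGA (A : Type) extends Ring A, Algebra ℚ A where
  grading : ℕ → Submodule ℚ A
  gradedAlgebra : GradedAlgebra grading
  grading_comm : ∀ (i j : ℕ) (a b : A), a ∈ grading i → b ∈ grading j →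
    a * b = ((-1 : ℚ) ^ (i * j)) • (b * a)
  d : A →ₗ[ℚ] A
  d_sq : ∀ a : A, d (d a) = 0
  d_grading : ∀ (i : ℕ) (a : A), a ∈ grading i → d a ∈ grading (i + 1)
  d_leibniz : ∀ (i : ℕ) (a b : A), a ∈ grading i →
    d (a * b) = d a * b + ((-1 : ℚ) ^ i) • (a * d b)

/-- The grading of a gcdga, with the algebra explicit. -/
def Gr (A : Type) [GCDGA A] : ℕ → Submodule ℚ A := GCDGA.grading

/-- The differential of a gcdga, with the algebra explicit. -/
def Dd (A : Type) [GCDGA A] : A →ₗ[ℚ] A := GCDGA.d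

/-- Morphisms of cdga's: `ℚ`-algebra morphisms preserving the grading and
commuting with the differentials. -/
def IsDGAHom {A B : Type} [GCDGA A] [GCDGA B] (f : A →ₐ[ℚ] B) : Prop :=
  (∀ a : A, f (Dd A a) = Dd B (f a)) ∧
    ∀ (i : ℕ) (a : A), a ∈ Gr A i → f a ∈ Gr B i

theorem isDGAHom_id (A : Type) [GCDGA A] : IsDGAHom (AlgHom.id ℚ A) :=
  ⟨fun _ => rfl, fun _ _ h => h⟩

/-- A quasi-isomorphism: a morphism inducing an isomorphism in cohomology
(stated elementwise: surjectivity and injectivity on cohomology classes). -/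
def QuasiIso {A B : Type} [GCDGA A] [GCDGA B] (f : A →ₐ[ℚ] B) : Prop :=
  (∀ b : B, Dd B b = 0 → ∃ a : A, Dd A a = 0 ∧ ∃ c : B, f a - b = Dd B c) ∧
    ∀ a : A, Dd A a = 0 → (∃ c : B, f a = Dd B c) → ∃ e : A, a = Dd A e

/-- Injectivity in cohomology, stated elementwise. -/
def CohomologyInjective {A B : Type} [GCDGA A] [GCDGA B] (f : A →ₐ[ℚ] B) : Prop :=
  ∀ a : A, Dd A a = 0 → (∃ c : B, f a = Dd B c) → ∃ e : A, a = Dd A e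

/-- A homotopy retraction for a morphism `ρ` of cdga's: a factorization of `ρ`
through a surjective quasi-isomorphism `q : C → Q` (playing the role of the
relative Sullivan model of `ρ`) together with a cdga retraction `τ`. -/
structure HtpyRetraction {T Q : Type} [GCDGA T] [GCDGA Q] (ρ : T →ₐ[ℚ] Q) where
  C : Type
  [instC : GCDGA C]
  j : T →ₐ[ℚ] C
  q : C →ₐ[ℚ] Q
  τ : C →ₐ[ℚ] T
  j_dga : IsDGAHom j
  q_dga : IsDGAHom q
  τ_dga : IsDGAHom τ
  q_surj : Function.Surjective q
  q_quasi : QuasiIso q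
  hqj : q.comp j = ρ
  hτj : τ.comp j = AlgHom.id ℚ T

attribute [instance] HtpyRetraction.instC

/-- A homotopy retraction of `T`-modules for a morphism `ρ : T → Q` of cdga's:
as above, but the retraction `τ` is only required to be a morphism of
differential `T`-modules. -/
structure ModHtpyRetraction {T Q : Type} [GCDGA T] [GCDGA Q] (ρ : T →ₐ[ℚ] Q) where
  C : Type
  [instC : GCDGA C]
  j : T →ₐ[ℚ] C
  q : C →ₐ[ℚ] Q
  τ : C →ₗ[ℚ] T
  j_dga : IsDGAHom j
  q_dga : IsDGAHom q
  q_surj : Function.Surjective q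
  q_quasi : QuasiIso q
  hqj : q.comp j = ρ
  τ_chain : ∀ c : C, τ (Dd C c) = Dd T (τ c)
  τ_mod : ∀ (t : T) (c : C), τ (j t * c) = t * τ c
  hτj : ∀ t : T, τ (j t) = t

attribute [instance] ModHtpyRetraction.instC

/-- `T`, together with the morphisms `ι j : A → T`, is the `r`-fold (graded)
tensor power of `A`, characterized as the `r`-fold coproduct of copies of `A`
in the category of cdga's. -/
structure TensorPower (A : Type) [GCDGA A] (r : ℕ) (T : Type) [GCDGA T] where
  ι : Fin r → (A →ₐ[ℚ] T)
  ι_dga : ∀ j, IsDGAHom (ι j)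
  coprod : ∀ (B : Type) [GCDGA B] (f : Fin r → (A →ₐ[ℚ] B)), (∀ j, IsDGAHom (f j)) →
    ∃! g : T →ₐ[ℚ] B, IsDGAHom g ∧ ∀ j, g.comp (ι j) = f j

/-- The `r`-fold multiplication morphism `μ : A^{⊗ r} → A`, i.e. the fold map
of the coproduct. -/
noncomputable def TensorPower.mu {A : Type} [GCDGA A] {r : ℕ} {T : Type} [GCDGA T]
    (TP : TensorPower A r T) : T →ₐ[ℚ] A :=
  (TP.coprod A (fun _ => AlgHom.id ℚ A) (fun _ => isDGAHom_id A)).choose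

/-- The kernel of the `r`-fold multiplication, as a `ℚ`-submodule (ideal). -/
noncomputable def TensorPower.kerMu {A : Type} [GCDGA A] {r : ℕ} {T : Type} [GCDGA T]
    (TP : TensorPower A r T) : Submodule ℚ T :=
  LinearMap.ker TP.mu.toLinearMap

/-- A witness that `TC_r(ΛV) ≤ n`: the projection
`ρ^r_n : (ΛV)^{⊗ r} → (ΛV)^{⊗ r}/(ker μ^r)^{n+1}` admits a homotopy retraction
of cdga's.  The quotient is encoded as a surjective cdga morphism with kernel
`(ker μ^r)^{n+1}`. -/
structure TCWitness (A : Type) [GCDGA A] (r n : ℕ) where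
  T : Type
  [instT : GCDGA T]
  TP : TensorPower A r T
  Q : Type
  [instQ : GCDGA Q]
  ρ : T →ₐ[ℚ] Q
  ρ_dga : IsDGAHom ρ
  ρ_surj : Function.Surjective ρ
  ρ_ker : LinearMap.ker ρ.toLinearMap = TP.kerMu ^ (n + 1)
  retr : Nonempty (HtpyRetraction ρ)

/-- The higher rational topological complexity `TC_r`. -/
noncomputable def TC (A : Type) [GCDGA A] (r : ℕ) : ℕ :=
  sInf {n | Nonempty (TCWitness A r n)}

/-- A witness that `MTC_r(ΛV) ≤ n`: `ρ^r_n` admits a homotopy retraction of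
`(ΛV)^{⊗ r}`-modules. -/
structure MTCWitness (A : Type) [GCDGA A] (r n : ℕ) where
  T : Type
  [instT : GCDGA T]
  TP : TensorPower A r T
  Q : Type
  [instQ : GCDGA Q]
  ρ : T →ₐ[ℚ] Q
  ρ_dga : IsDGAHom ρ
  ρ_surj : Function.Surjective ρ
  ρ_ker : LinearMap.ker ρ.toLinearMap = TP.kerMu ^ (n + 1)
  retr : Nonempty (ModHtpyRetraction ρ)

/-- The higher module rational topological complexity `MTC_r`. -/
noncomputable def MTC (A : Type) [GCDGA A] (r : ℕ) : ℕ :=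
  sInf {n | Nonempty (MTCWitness A r n)}

/-- A witness that `HTC_r(ΛV) ≤ n`: `ρ^r_n` is injective in cohomology. -/
structure HTCWitness (A : Type) [GCDGA A] (r n : ℕ) where
  T : Type
  [instT : GCDGA T]
  TP : TensorPower A r T
  Q : Type
  [instQ : GCDGA Q]
  ρ : T →ₐ[ℚ] Q
  ρ_dga : IsDGAHom ρ
  ρ_surj : Function.Surjective ρ
  ρ_ker : LinearMap.ker ρ.toLinearMap = TP.kerMu ^ (n + 1)
  inj : CohomologyInjective ρ

/-- The invariant `HTC_r`. -/
noncomputable def HTC (A : Type) [GCDGA A] (r : ℕ) : ℕ :=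
  sInf {n | Nonempty (HTCWitness A r n)}

/-- A minimal Sullivan model structure on a gcdga `A`: a simply-connected
graded space of generators `V` of finite type, the word-length grading `lam`
(`lam k` is `Λ^k V`), freeness of `A` over `V` as a graded-commutative
algebra (expressed by the universal property), and minimality `d V ⊆ Λ^{≥2}V`. -/
structure MinimalSullivan (A : Type) [GCDGA A] where
  V : ℕ → Submodule ℚ A
  lam : ℕ → Submodule ℚ A
  V_le : ∀ n, V n ≤ Gr A n
  V0 : V 0 = ⊥
  V1 : V 1 = ⊥
  V_fin : ∀ n, FiniteDimensional ℚ (V n)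
  lam_zero : lam 0 = 1
  lam_one : lam 1 = ⨆ n, V n
  lam_mul : ∀ p q, lam p * lam q ≤ lam (p + q)
  lam_internal : DirectSum.IsInternal lam
  minimal : ∀ (n : ℕ), ∀ v ∈ V n, Dd A v ∈ ⨆ k, ⨆ (_ : 2 ≤ k), lam k
  free : ∀ (B : Type) [GCDGA B] (f : ∀ n, V n →ₗ[ℚ] B),
    (∀ (n : ℕ) (v : V n), f n v ∈ Gr B n) →
    ∃! g : A →ₐ[ℚ] B, (∀ (i : ℕ) (a : A), a ∈ Gr A i → g a ∈ Gr B i) ∧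
      ∀ (n : ℕ) (v : V n), g (v : A) = f n v

namespace MinimalSullivan

variable {A : Type} [GCDGA A] (S : MinimalSullivan A)

/-- The even part of the space of generators. -/
def Veven : Submodule ℚ A := ⨆ n, S.V (2 * n)

/-- The odd part of the space of generators. -/
def Vodd : Submodule ℚ A := ⨆ n, S.V (2 * n + 1)

/-- The homotopy characteristic `χ_π = dim V^even - dim V^odd`. -/
noncomputable def chiPi : ℤ :=
  (Module.finrank ℚ S.Veven : ℤ) - (Module.finrank ℚ S.Vodd : ℤ)

/-- Purity: `d V^even = 0` and `d V^odd ⊆ Λ V^even`. -/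
def Pure : Prop :=
  (∀ a ∈ S.Veven, Dd A a = 0) ∧
    ∀ a ∈ S.Vodd, Dd A a ∈ Algebra.adjoin ℚ (S.Veven : Set A)

/-- Coformality: the differential is quadratic, `d V ⊆ Λ² V`. -/
def Coformal : Prop := ∀ (n : ℕ), ∀ v ∈ S.V n, Dd A v ∈ S.lam 2

/-- Constant length `l` of the differential: `d V ⊆ Λ^l V`. -/
def ConstantLength (l : ℕ) : Prop := ∀ (n : ℕ), ∀ v ∈ S.V n, Dd A v ∈ S.lam l

end MinimalSullivan

/-- The cohomology of a gcdga, as a `ℚ`-module. -/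
def CohClasses (A : Type) [GCDGA A] :=
  LinearMap.ker (Dd A) ⧸ ((LinearMap.range (Dd A)).comap (LinearMap.ker (Dd A)).subtype)

instance (A : Type) [GCDGA A] : AddCommGroup (CohClasses A) := by
  unfold CohClasses; infer_instance

instance (A : Type) [GCDGA A] : Module ℚ (CohClasses A) := by
  unfold CohClasses; infer_instance

/-- Ellipticity: both the generating space `V` and the cohomology are
finite-dimensional. -/
def Elliptic (A : Type) [GCDGA A] (S : MinimalSullivan A) : Prop :=
  FiniteDimensional ℚ (⨆ n, S.V n : Submodule ℚ A) ∧ FiniteDimensional ℚ (CohClasses A)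

/-- A witness of formality: a quasi-isomorphism to a gcdga with zero
differential. -/
structure FormalityWitness (A : Type) [GCDGA A] where
  B : Type
  [instB : GCDGA B]
  hd : Dd B = 0
  ψ : A →ₐ[ℚ] B
  ψ_dga : IsDGAHom ψ
  ψ_quasi : QuasiIso ψ

/-- Formality of a (Sullivan) cdga. -/
def Formal (A : Type) [GCDGA A] : Prop := Nonempty (FormalityWitness A)

/-- A witness that `cat(ΛV) ≤ n`: the projection `ΛV → ΛV/Λ^{>n}V` admits a
homotopy retraction.  The quotient is encoded as a surjective cdga morphism
whose kernel is `Λ^{>n}V`. -/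
structure CatWitness (A : Type) [GCDGA A] (S : MinimalSullivan A) (n : ℕ) where
  Q : Type
  [instQ : GCDGA Q]
  π : A →ₐ[ℚ] Q
  π_dga : IsDGAHom π
  π_surj : Function.Surjective π
  π_ker : LinearMap.ker π.toLinearMap = ⨆ k, ⨆ (_ : n < k), S.lam k
  retr : Nonempty (HtpyRetraction π)

/-- The rational LS-category. -/
noncomputable def cat (A : Type) [GCDGA A] (S : MinimalSullivan A) : ℕ :=
  sInf {n | Nonempty (CatWitness A S n)}

/-- A witness that `zcl_r(ΛV) ≥ p`: `p` cocycles in `(ΛV)^{⊗ r}` whose classes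
are zero-divisors (killed by `H(μ^r)`) and whose product is not exact. -/
structure ZclWitness (A : Type) [GCDGA A] (r p : ℕ) where
  T : Type
  [instT : GCDGA T]
  TP : TensorPower A r T
  a : Fin p → T
  closed : ∀ i, Dd T (a i) = 0
  zero_div : ∀ i, ∃ b : A, TP.mu (a i) = Dd A b
  prod_ne : ∀ b : T, (List.ofFn a).prod ≠ Dd T b

/-- The `r`-zero-divisor-cuplength `zcl_r`. -/
noncomputable def zcl (A : Type) [GCDGA A] (r : ℕ) : ℕ :=
  sSup {p | Nonempty (ZclWitness A r p)}

/-- A witness that `cl_ℚ(ΛV) ≥ p`: `p` cocycles of positive degree with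
non-exact product. -/
structure ClWitness (A : Type) [GCDGA A] (p : ℕ) where
  a : Fin p → A
  pos : ∀ i, a i ∈ ⨆ k, ⨆ (_ : 0 < k), Gr A k
  closed : ∀ i, Dd A (a i) = 0
  prod_ne : ∀ b : A, (List.ofFn a).prod ≠ Dd A b

/-- The rational cuplength `cl_ℚ`. -/
noncomputable def clQ (A : Type) [GCDGA A] : ℕ :=
  sSup {p | Nonempty (ClWitness A p)}

/-! ### Graded algebra basics -/

instance instGradedAlgebraGr (A : Type) [GCDGA A] : GradedAlgebra (Gr A) := GCDGA.gradedAlgebra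

section Basics

variable {A : Type} [GCDGA A]

/-- The projection onto the homogeneous component of degree `n`. -/
def pr (A : Type) [GCDGA A] (n : ℕ) : A →ₗ[ℚ] A := GradedAlgebra.proj (Gr A) n

theorem pr_mem (n : ℕ) (a : A) : pr A n a ∈ Gr A n :=
  SetLike.coe_mem (DirectSum.decompose (Gr A) a n)

theorem pr_of_mem {n : ℕ} {a : A} (h : a ∈ Gr A n) : pr A n a = a :=
  DirectSum.decompose_of_mem_same (Gr A) h

theorem pr_of_ne {n m : ℕ} {a : A} (h : a ∈ Gr A n) (hnm : n ≠ m) : pr A m a = 0 :=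
  DirectSum.decompose_of_mem_ne (Gr A) h hnm

theorem sum_pr (a : A) : ∃ s : Finset ℕ, a = ∑ n ∈ s, pr A n a := by
  classical
  exact ⟨_, (DirectSum.sum_support_decompose (Gr A) a).symm⟩

/-- To prove a property of all elements, it suffices to treat homogeneous ones. -/
theorem homog_induction {p : A → Prop} (h0 : p 0) (hadd : ∀ a b, p a → p b → p (a + b))
    (hom : ∀ n, ∀ a ∈ Gr A n, p a) (a : A) : p a := by
  obtain ⟨s, hs⟩ := sum_pr a
  rw [hs]
  exact Finset.sum_induction _ p hadd h0 fun n _ => hom n _ (pr_mem n a)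

theorem one_mem_Gr : (1 : A) ∈ Gr A 0 := SetLike.GradedOne.one_mem

theorem mul_mem_Gr {i j : ℕ} {a b : A} (ha : a ∈ Gr A i) (hb : b ∈ Gr A j) :
    a * b ∈ Gr A (i + j) := SetLike.GradedMul.mul_mem ha hb

theorem Dd_mem {i : ℕ} {a : A} (ha : a ∈ Gr A i) : Dd A a ∈ Gr A (i + 1) :=
  GCDGA.d_grading i a ha

theorem Dd_Dd (a : A) : Dd A (Dd A a) = 0 := GCDGA.d_sq a

theorem gr_comm {i j : ℕ} {a b : A} (ha : a ∈ Gr A i) (hb : b ∈ Gr A j) :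
    a * b = ((-1 : ℚ) ^ (i * j)) • (b * a) := GCDGA.grading_comm i j a b ha hb

theorem Dd_one : Dd A (1 : A) = 0 := by
  have h := GCDGA.d_leibniz 0 (1 : A) 1 one_mem_Gr
  simp only [mul_one, one_mul, pow_zero, one_smul] at h
  exact left_eq_add.mp h

theorem Dd_pr (n : ℕ) (a : A) : Dd A (pr A n a) = pr A (n + 1) (Dd A a) := by
  refine homog_induction (p := fun a => Dd A (pr A n a) = pr A (n + 1) (Dd A a)) (by simp)
    (fun a b ha hb => by simp only [map_add, ha, hb]) (fun m a ha => ?_) a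
  by_cases h : m = n
  · subst h
    rw [pr_of_mem ha, pr_of_mem (Dd_mem ha)]
  · rw [pr_of_ne ha h, pr_of_ne (Dd_mem ha) (by omega), map_zero]

theorem pr_zero_Dd (a : A) : pr A 0 (Dd A a) = 0 :=
  homog_induction (p := fun a => pr A 0 (Dd A a) = 0) (by simp)
    (fun a b ha hb => by simp only [map_add, ha, hb, add_zero])
    (fun _ _ ha => pr_of_ne (Dd_mem ha) (by omega)) a

/-- The twist `a ↦ (-1)^{s|a|} a`. -/
def sgn (A : Type) [GCDGA A] (s : ℕ) : A →ₗ[ℚ] A :=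
  (DirectSum.toModule ℚ ℕ A fun n => ((-1 : ℚ) ^ (s * n)) • (Gr A n).subtype) ∘ₗ
    (DirectSum.decomposeLinearEquiv (Gr A)).toLinearMap

theorem sgn_of_mem (s : ℕ) {n : ℕ} {a : A} (ha : a ∈ Gr A n) :
    sgn A s a = ((-1 : ℚ) ^ (s * n)) • a := by
  lift a to Gr A n using ha
  simp only [sgn, LinearMap.comp_apply, LinearEquiv.coe_coe,
    DirectSum.decomposeLinearEquiv_apply, DirectSum.decompose_coe]
  erw [DirectSum.toModule_lof]
  rfl

theorem sgn_mem (s : ℕ) {n : ℕ} {a : A} (ha : a ∈ Gr A n) : sgn A s a ∈ Gr A n := by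
  rw [sgn_of_mem s ha]
  exact Submodule.smul_mem _ _ ha

theorem neg_one_pow_mul_self (k : ℕ) : ((-1 : ℚ) ^ k) * (-1) ^ k = 1 := by
  rw [← mul_pow]; simp

theorem sgn_sgn (s : ℕ) (a : A) : sgn A s (sgn A s a) = a := by
  refine homog_induction (p := fun a => sgn A s (sgn A s a) = a) (by simp)
    (fun a b ha hb => by simp only [map_add, ha, hb]) (fun n a ha => ?_) a
  rw [sgn_of_mem s ha, map_smul, sgn_of_mem s ha, smul_smul, neg_one_pow_mul_self, one_smul]

theorem sgn_mul (s : ℕ) (a b : A) : sgn A s (a * b) = sgn A s a * sgn A s b := by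
  refine homog_induction (p := fun a => sgn A s (a * b) = sgn A s a * sgn A s b) (by simp)
    (fun a b ha hb => by simp only [map_add, add_mul, ha, hb]) (fun n a ha => ?_) a
  refine homog_induction (p := fun b => sgn A s (a * b) = sgn A s a * sgn A s b) (by simp)
    (fun a b ha hb => by simp only [map_add, mul_add, ha, hb]) (fun m b hb => ?_) b
  rw [sgn_of_mem s ha, sgn_of_mem s hb, sgn_of_mem s (mul_mem_Gr ha hb), smul_mul_smul_comm,
    ← pow_add, mul_add]

theorem sgn_one (s : ℕ) : sgn A s 1 = 1 := by
  rw [sgn_of_mem s one_mem_Gr]; simp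

theorem Dd_mul (a b : A) : Dd A (a * b) = Dd A a * b + sgn A 1 a * Dd A b := by
  refine homog_induction (p := fun a => Dd A (a * b) = Dd A a * b + sgn A 1 a * Dd A b) (by simp)
    (fun a b ha hb => ?_) (fun n a ha => ?_) a
  · simp only [map_add, add_mul, ha, hb]; abel
  · rw [sgn_of_mem 1 ha, one_mul, smul_mul_assoc]
    exact GCDGA.d_leibniz n a b ha

theorem Dd_sgn (a : A) : Dd A (sgn A 1 a) = - sgn A 1 (Dd A a) := by
  refine homog_induction (p := fun a => Dd A (sgn A 1 a) = - sgn A 1 (Dd A a)) (by simp)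
    (fun a b ha hb => by simp only [map_add, ha, hb]; abel) (fun n a ha => ?_) a
  rw [sgn_of_mem 1 ha, sgn_of_mem 1 (Dd_mem ha), map_smul, one_mul, one_mul, pow_succ]
  simp

theorem Dd_mul_of_closed {a b : A} (ha : Dd A a = 0) (hb : Dd A b = 0) : Dd A (a * b) = 0 := by
  rw [Dd_mul, ha, hb]; simp

theorem Dd_pow_of_closed {a : A} (ha : Dd A a = 0) (n : ℕ) : Dd A (a ^ n) = 0 := by
  induction n with
  | zero => rw [pow_zero, Dd_one]
  | succ n ih => rw [pow_succ]; exact Dd_mul_of_closed ih ha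

theorem Dd_list_prod {l : List A} (h : ∀ a ∈ l, Dd A a = 0) : Dd A l.prod = 0 := by
  induction l with
  | nil => rw [List.prod_nil, Dd_one]
  | cons a l ih =>
    rw [List.prod_cons]
    exact Dd_mul_of_closed (h a (by simp)) (ih fun b hb => h b (by simp [hb]))

theorem even_commute {n : ℕ} {a : A} (ha : a ∈ Gr A n) (hn : Even n) (b : A) :
    a * b = b * a := by
  refine homog_induction (p := fun b => a * b = b * a) (by simp)
    (fun b c hb hc => by rw [mul_add, add_mul, hb, hc]) (fun m b hb => ?_) b
  rw [gr_comm ha hb, (hn.mul_right m).neg_one_pow, one_smul]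

theorem odd_mul_self {n : ℕ} {a : A} (ha : a ∈ Gr A n) (hn : Odd n) : a * a = 0 := by
  have h := gr_comm ha ha
  rw [(hn.mul hn).neg_one_pow, neg_one_smul] at h
  have h2 : (2 : ℚ) • (a * a) = 0 := by rw [two_smul]; nth_rw 1 [h]; simp
  exact (smul_eq_zero.mp h2).resolve_left (by norm_num)

end Basics

section Hom

variable {A B : Type} [GCDGA A] [GCDGA B] {f : A →ₐ[ℚ] B}

theorem IsDGAHom.pr (hf : ∀ (i : ℕ) (a : A), a ∈ Gr A i → f a ∈ Gr B i) (n : ℕ) (a : A) :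
    pr B n (f a) = f (pr A n a) := by
  refine homog_induction (p := fun a => RHT.pr B n (f a) = f (RHT.pr A n a)) (by simp)
    (fun a b ha hb => by simp only [map_add, ha, hb]) (fun m a ha => ?_) a
  by_cases h : m = n
  · subst h; rw [pr_of_mem ha, pr_of_mem (hf _ _ ha)]
  · rw [pr_of_ne ha h, pr_of_ne (hf _ _ ha) h, map_zero]

theorem IsDGAHom.sgn (hf : IsDGAHom f) (s : ℕ) (a : A) : sgn B s (f a) = f (sgn A s a) := by
  refine homog_induction (p := fun a => RHT.sgn B s (f a) = f (RHT.sgn A s a)) (by simp)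
    (fun a b ha hb => by simp only [map_add, ha, hb]) (fun m a ha => ?_) a
  rw [sgn_of_mem s ha, sgn_of_mem s (hf.2 _ _ ha), map_smul]

theorem IsDGAHom.comp {C : Type} [GCDGA C] {g : B →ₐ[ℚ] C} (hg : IsDGAHom g) (hf : IsDGAHom f) :
    IsDGAHom (g.comp f) :=
  ⟨fun a => by simp only [AlgHom.comp_apply, hf.1, hg.1], fun i a ha => hg.2 i _ (hf.2 i a ha)⟩

end Hom

/-- A family of submodules with a compatible system of projections which spans is internal. -/
theorem isInternal_of_proj {X : Type} [AddCommGroup X] [Module ℚ X] (ℳ : ℕ → Submodule ℚ X)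
    (p : ℕ → X →ₗ[ℚ] X) (hp : ∀ n, ∀ x ∈ ℳ n, p n x = x)
    (hp' : ∀ n m, n ≠ m → ∀ x ∈ ℳ n, p m x = 0) (htop : ∀ x, x ∈ ⨆ n, ℳ n) :
    DirectSum.IsInternal ℳ := by
  rw [DirectSum.isInternal_submodule_iff_iSupIndep_and_iSup_eq_top]
  refine ⟨fun n => ?_, eq_top_iff.mpr fun x _ => htop x⟩
  rw [Submodule.disjoint_def]
  intro x hx hx'
  have h : ⨆ m, ⨆ (_ : m ≠ n), ℳ m ≤ LinearMap.ker (p n) :=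
    iSup₂_le fun m hm y hy => hp' m n hm y hy
  rw [← hp n x hx]
  exact h hx'

/-- Constructor for the grading of an algebra out of a system of projections. -/
@[reducible]
def gradedAlgebraOfProj {X : Type} [Ring X] [Algebra ℚ X] (ℳ : ℕ → Submodule ℚ X)
    (hone : (1 : X) ∈ ℳ 0) (hmul : ∀ i j, ∀ a ∈ ℳ i, ∀ b ∈ ℳ j, a * b ∈ ℳ (i + j))
    (p : ℕ → X →ₗ[ℚ] X) (hp : ∀ n, ∀ x ∈ ℳ n, p n x = x)
    (hp' : ∀ n m, n ≠ m → ∀ x ∈ ℳ n, p m x = 0) (htop : ∀ x, x ∈ ⨆ n, ℳ n) :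
    GradedAlgebra ℳ :=
  { (isInternal_of_proj ℳ p hp hp' htop).chooseDecomposition with
    one_mem := hone
    mul_mem := fun {i j} {a b} ha hb => hmul i j a ha b hb }

/-! ### Homogeneous subspaces and the ideals they generate -/

section Homogeneous

variable {A : Type} [GCDGA A]

/-- A subspace is homogeneous if it is stable under taking homogeneous components. -/
def Homog (M : Submodule ℚ A) : Prop := ∀ x ∈ M, ∀ n, pr A n x ∈ M

theorem Homog.top : Homog (⊤ : Submodule ℚ A) := fun _ _ _ => trivial

theorem Homog.of_le {s : Set A} (hs : ∀ a ∈ s, ∃ n, a ∈ Gr A n) : Homog (Submodule.span ℚ s) := by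
  intro x hx n
  induction hx using Submodule.span_induction with
  | mem a ha =>
    obtain ⟨m, hm⟩ := hs a ha
    by_cases h : m = n
    · subst h; rw [pr_of_mem hm]; exact Submodule.subset_span ha
    · rw [pr_of_ne hm h]; exact Submodule.zero_mem _
  | zero => rw [map_zero]; exact Submodule.zero_mem _
  | add a b _ _ ha hb => rw [map_add]; exact Submodule.add_mem _ ha hb
  | smul c a _ ha => rw [map_smul]; exact Submodule.smul_mem _ _ ha

theorem Homog.Gr (n : ℕ) : Homog (Gr A n) := fun x hx m => by
  by_cases h : n = m
  · subst h; rwa [pr_of_mem hx]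
  · rw [pr_of_ne hx h]; exact Submodule.zero_mem _

theorem Homog.of_le_Gr {M : Submodule ℚ A} {n : ℕ} (h : M ≤ RHT.Gr A n) : Homog M := fun x hx m => by
  by_cases h' : n = m
  · subst h'; rwa [pr_of_mem (h hx)]
  · rw [pr_of_ne (h hx) h']; exact Submodule.zero_mem _

theorem Homog.iSup {ι : Sort*} {M : ι → Submodule ℚ A} (h : ∀ i, Homog (M i)) :
    Homog (⨆ i, M i) := by
  intro x hx n
  have : (⨆ i, M i) ≤ (⨆ i, M i).comap (pr A n) :=
    iSup_le fun i y hy => (le_iSup M i) (h i y hy n)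
  exact this hx

theorem Homog.sup {M N : Submodule ℚ A} (hM : Homog M) (hN : Homog N) : Homog (M ⊔ N) := by
  intro x hx n
  have : M ⊔ N ≤ (M ⊔ N).comap (pr A n) :=
    sup_le (fun y hy => Submodule.mem_sup_left (hM y hy n))
      (fun y hy => Submodule.mem_sup_right (hN y hy n))
  exact this hx

theorem Homog.mul {M N : Submodule ℚ A} (hM : Homog M) (hN : Homog N) : Homog (M * N) := by
  intro x hx n
  induction hx using Submodule.mul_induction_on' with
  | mem_mul_mem a ha b hb =>
    obtain ⟨s, hs⟩ := sum_pr a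
    obtain ⟨t, ht⟩ := sum_pr b
    have : a * b = ∑ i ∈ s, ∑ j ∈ t, pr A i a * pr A j b := by
      rw [← Finset.sum_mul_sum, ← hs, ← ht]
    rw [this, map_sum]
    refine Submodule.sum_mem _ fun i _ => ?_
    rw [map_sum]
    refine Submodule.sum_mem _ fun j _ => ?_
    have hm := mul_mem_Gr (pr_mem i a) (pr_mem j b)
    by_cases h : i + j = n
    · rw [← h, pr_of_mem hm]; exact Submodule.mul_mem_mul (hM a ha i) (hN b hb j)
    · rw [pr_of_ne hm h]; exact Submodule.zero_mem _
  | add a _ b _ ha hb => rw [map_add]; exact Submodule.add_mem _ ha hb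

theorem Homog.one : Homog (1 : Submodule ℚ A) := by
  rw [Submodule.one_eq_span]
  exact Homog.of_le fun a ha => ⟨0, by rw [Set.mem_singleton_iff.mp ha]; exact one_mem_Gr⟩

theorem Homog.pow {M : Submodule ℚ A} (hM : Homog M) (n : ℕ) : Homog (M ^ n) := by
  induction n with
  | zero => rw [pow_zero]; exact Homog.one
  | succ n ih => rw [pow_succ]; exact ih.mul hM

theorem Homog.mapDd {M : Submodule ℚ A} (hM : Homog M) : Homog (M.map (Dd A)) := by
  rintro _ ⟨x, hx, rfl⟩ n
  cases n with
  | zero => rw [pr_zero_Dd]; exact Submodule.zero_mem _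
  | succ n => rw [← Dd_pr]; exact ⟨_, hM x hx n, rfl⟩

theorem Homog.induction {M : Submodule ℚ A} (hM : Homog M) {p : A → Prop} (h0 : p 0)
    (hadd : ∀ a b, p a → p b → p (a + b)) (hom : ∀ n, ∀ a ∈ M, a ∈ RHT.Gr A n → p a)
    {a : A} (ha : a ∈ M) : p a := by
  obtain ⟨s, hs⟩ := sum_pr a
  rw [hs]
  exact Finset.sum_induction _ p hadd h0 fun n _ => hom n _ (hM a ha n) (pr_mem n a)

theorem Homog.sgn_mem {M : Submodule ℚ A} (hM : Homog M) (s : ℕ) {a : A} (ha : a ∈ M) :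
    sgn A s a ∈ M := by
  refine hM.induction (p := fun a => sgn A s a ∈ M) (by simp)
    (fun a b ha hb => by rw [map_add]; exact M.add_mem ha hb) (fun n a ha hn => ?_) ha
  rw [sgn_of_mem s hn]
  exact M.smul_mem _ ha

/-- Homogeneous subspaces commute with the whole algebra. -/
theorem Homog.mul_top_le {M : Submodule ℚ A} (hM : Homog M) : M * ⊤ ≤ ⊤ * M := by
  rw [Submodule.mul_le]
  intro m hm a _
  refine hM.induction (p := fun m => m * a ∈ ⊤ * M) (by simp)
    (fun x y hx hy => by rw [add_mul]; exact Submodule.add_mem _ hx hy) (fun i m hm hi => ?_) hm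
  refine homog_induction (p := fun a => m * a ∈ ⊤ * M) (by simp)
    (fun x y hx hy => by rw [mul_add]; exact Submodule.add_mem _ hx hy) (fun j a hj => ?_) a
  rw [gr_comm hi hj]
  exact Submodule.smul_mem _ _ (Submodule.mul_mem_mul trivial hm)

/-- The ideal generated by a subspace. -/
def idl (M : Submodule ℚ A) : Submodule ℚ A := ⊤ * M

theorem le_idl (M : Submodule ℚ A) : M ≤ idl M := fun m hm => by
  rw [← one_mul m]
  exact Submodule.mul_mem_mul trivial hm

theorem idl_mono {M N : Submodule ℚ A} (h : M ≤ N) : idl M ≤ idl N := mul_le_mul' le_rfl h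

theorem Homog.idl {M : Submodule ℚ A} (hM : Homog M) : Homog (idl M) := Homog.top.mul hM

theorem top_mul_top : (⊤ : Submodule ℚ A) * ⊤ = ⊤ :=
  eq_top_iff.mpr fun a _ => by rw [← mul_one a]; exact Submodule.mul_mem_mul trivial trivial

theorem idl_mul_left {M : Submodule ℚ A} (a : A) {x : A} (hx : x ∈ idl M) : a * x ∈ idl M := by
  have : (⊤ : Submodule ℚ A) * idl M ≤ idl M := by rw [idl, ← mul_assoc, top_mul_top]
  exact this (Submodule.mul_mem_mul trivial hx)

theorem Homog.idl_mul_top {M : Submodule ℚ A} (hM : Homog M) :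
    RHT.idl M * ⊤ ≤ RHT.idl M := by
  rw [RHT.idl, mul_assoc]
  refine (mul_le_mul' le_rfl hM.mul_top_le).trans ?_
  rw [← mul_assoc, top_mul_top]

theorem Homog.idl_mul_right {M : Submodule ℚ A} (hM : Homog M) {x : A} (hx : x ∈ RHT.idl M)
    (a : A) : x * a ∈ RHT.idl M :=
  hM.idl_mul_top (Submodule.mul_mem_mul hx trivial)

theorem idl_le {M P : Submodule ℚ A} (hP : ∀ a, ∀ x ∈ P, a * x ∈ P) (h : M ≤ P) : idl M ≤ P :=
  Submodule.mul_le.mpr fun a _ m hm => hP a m (h hm)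

theorem idl_one : idl (1 : Submodule ℚ A) = ⊤ := by rw [idl, mul_one]

/-- The multiplicative filtration by the powers of the ideal generated by `M`. -/
def fil (M : Submodule ℚ A) (k : ℕ) : Submodule ℚ A := idl (M ^ k)

theorem fil_zero (M : Submodule ℚ A) : fil M 0 = ⊤ := by rw [fil, pow_zero, idl_one]

theorem fil_one (M : Submodule ℚ A) : fil M 1 = idl M := by rw [fil, pow_one]

theorem Homog.fil {M : Submodule ℚ A} (hM : Homog M) (k : ℕ) : Homog (fil M k) := (hM.pow k).idl

theorem fil_mul_left {M : Submodule ℚ A} {k : ℕ} (a : A) {x : A} (hx : x ∈ fil M k) :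
    a * x ∈ fil M k := idl_mul_left a hx

theorem Homog.fil_mul_right {M : Submodule ℚ A} (hM : Homog M) {k : ℕ} {x : A}
    (hx : x ∈ RHT.fil M k) (a : A) : x * a ∈ RHT.fil M k := (hM.pow k).idl_mul_right hx a

theorem Homog.fil_mul_le {M : Submodule ℚ A} (hM : Homog M) (i j : ℕ) :
    RHT.fil M i * RHT.fil M j ≤ RHT.fil M (i + j) := by
  have h := (hM.pow i).idl_mul_top
  simp only [RHT.fil, RHT.idl] at h ⊢
  rw [← mul_assoc, pow_add, ← mul_assoc]
  exact mul_le_mul' h le_rfl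

theorem Homog.fil_mul_mem {M : Submodule ℚ A} (hM : Homog M) {i j : ℕ} {x y : A}
    (hx : x ∈ RHT.fil M i) (hy : y ∈ RHT.fil M j) : x * y ∈ RHT.fil M (i + j) :=
  hM.fil_mul_le i j (Submodule.mul_mem_mul hx hy)

theorem Homog.fil_succ {M : Submodule ℚ A} (hM : Homog M) (k : ℕ) :
    RHT.fil M (k + 1) = RHT.fil M 1 * RHT.fil M k := by
  refine le_antisymm ?_ (by rw [add_comm]; exact hM.fil_mul_le 1 k)
  rw [RHT.fil, RHT.idl, pow_succ', ← mul_assoc, fil_one]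
  exact mul_le_mul' le_rfl (le_idl _)

theorem fil_anti (M : Submodule ℚ A) {i j : ℕ} (h : i ≤ j) : fil M j ≤ fil M i := by
  obtain ⟨k, rfl⟩ := Nat.exists_eq_add_of_le' h
  rw [fil, fil, idl, idl, pow_add, ← mul_assoc]
  exact mul_le_mul' le_top le_rfl

theorem le_fil_one (M : Submodule ℚ A) : M ≤ fil M 1 := by rw [fil_one]; exact le_idl M

/-- A twisted derivation. -/
def IsTwistedDer (s : ℕ) (D : A →ₗ[ℚ] A) : Prop :=
  ∀ a b, D (a * b) = D a * b + sgn A s a * D b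

theorem isTwistedDer_Dd : IsTwistedDer 1 (Dd A) := Dd_mul

theorem IsTwistedDer.fil_pred {s : ℕ} {D : A →ₗ[ℚ] A} (hD : IsTwistedDer s D)
    {M : Submodule ℚ A} (hM : Homog M) (k : ℕ) : ∀ x ∈ fil M (k + 1), D x ∈ fil M k := by
  induction k with
  | zero => intro x _; rw [fil_zero]; trivial
  | succ k ih =>
    intro x hx
    rw [hM.fil_succ] at hx
    induction hx using Submodule.mul_induction_on' with
    | mem_mul_mem a ha b hb =>
      rw [hD]
      refine Submodule.add_mem _ (fil_mul_left _ hb) ?_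
      rw [add_comm]
      exact hM.fil_mul_mem ((hM.fil 1).sgn_mem s ha) (ih b hb)
    | add a _ b _ ha hb => rw [map_add]; exact Submodule.add_mem _ ha hb

theorem IsTwistedDer.fil_shift {s : ℕ} {D : A →ₗ[ℚ] A} (hD : IsTwistedDer s D)
    {M : Submodule ℚ A} (hM : Homog M) (t : ℕ) (h0 : ∀ x, D x ∈ fil M t)
    (h1 : ∀ x ∈ M, D x ∈ fil M (1 + t)) (k : ℕ) : ∀ x ∈ fil M k, D x ∈ fil M (k + t) := by
  have h1' : ∀ x ∈ fil M 1, D x ∈ fil M (1 + t) := by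
    intro x hx
    rw [fil_one] at hx
    induction hx using Submodule.mul_induction_on' with
    | mem_mul_mem a _ b hb =>
      rw [hD]
      refine Submodule.add_mem _ ?_ (fil_mul_left _ (h1 b hb))
      rw [add_comm]
      exact hM.fil_mul_mem (h0 a) (le_fil_one M hb)
    | add a _ b _ ha hb => rw [map_add]; exact Submodule.add_mem _ ha hb
  induction k with
  | zero => intro x _; rw [zero_add]; exact h0 x
  | succ k ih =>
    intro x hx
    rw [hM.fil_succ] at hx
    induction hx using Submodule.mul_induction_on' with
    | mem_mul_mem a ha b hb =>
      rw [hD]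
      refine Submodule.add_mem _ ?_ ?_
      · have := hM.fil_mul_mem (h1' a ha) hb
        rwa [show 1 + t + k = k + 1 + t by omega] at this
      · have := hM.fil_mul_mem ((hM.fil 1).sgn_mem s ha) (ih b hb)
        rwa [show 1 + (k + t) = k + 1 + t by omega] at this
    | add a _ b _ ha hb => rw [map_add]; exact Submodule.add_mem _ ha hb

end Homogeneous

/-! ### Constructions of gcdga's -/

section Constructions

variable {A B : Type} [GCDGA A] [GCDGA B]

theorem mem_iSup_of_sum_pr {X : Type} [AddCommGroup X] [Module ℚ X] (f : X →ₗ[ℚ] A)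
    (hf : Function.Injective f) (ℳ : ℕ → Submodule ℚ X)
    (h : ∀ x n, ∃ y ∈ ℳ n, f y = pr A n (f x)) (x : X) : x ∈ ⨆ n, ℳ n := by
  choose y hy hxy using h
  obtain ⟨s, hs⟩ := sum_pr (f x)
  have : x = ∑ n ∈ s, y x n := hf (by rw [hs, map_sum]; exact Finset.sum_congr rfl fun n _ => (hxy x n).symm)
  rw [this]
  exact Submodule.sum_mem _ fun n _ => (le_iSup ℳ n) (hy x n)

/-- The product of two gcdga's. -/
instance prodGCDGA : GCDGA (A × B) where
  grading n := (Gr A n).prod (Gr B n)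
  gradedAlgebra := gradedAlgebraOfProj _ ⟨one_mem_Gr, one_mem_Gr⟩
    (fun _ _ _ ha _ hb => ⟨mul_mem_Gr ha.1 hb.1, mul_mem_Gr ha.2 hb.2⟩)
    (fun n => (pr A n).prodMap (pr B n))
    (fun _ _ hx => Prod.ext (pr_of_mem hx.1) (pr_of_mem hx.2))
    (fun _ _ h _ hx => Prod.ext (pr_of_ne hx.1 h) (pr_of_ne hx.2 h))
    (fun x => by
      have h1 : ∀ a : A, (a, (0 : B)) ∈ ⨆ n, (Gr A n).prod (Gr B n) :=
        homog_induction (Submodule.zero_mem _)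
          (fun a b ha hb => by
            have := Submodule.add_mem _ ha hb
            rwa [Prod.mk_add_mk, add_zero] at this)
          (fun n a ha => Submodule.mem_iSup_of_mem n ⟨ha, Submodule.zero_mem _⟩)
      have h2 : ∀ b : B, ((0 : A), b) ∈ ⨆ n, (Gr A n).prod (Gr B n) :=
        homog_induction (Submodule.zero_mem _)
          (fun a b ha hb => by
            have := Submodule.add_mem _ ha hb
            rwa [Prod.mk_add_mk, add_zero] at this)
          (fun n a ha => Submodule.mem_iSup_of_mem n ⟨Submodule.zero_mem _, ha⟩)
      have := Submodule.add_mem _ (h1 x.1) (h2 x.2)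
      rwa [Prod.mk_add_mk, add_zero, zero_add] at this)
  grading_comm _ _ _ _ ha hb := Prod.ext (gr_comm ha.1 hb.1) (gr_comm ha.2 hb.2)
  d := (Dd A).prodMap (Dd B)
  d_sq a := Prod.ext (Dd_Dd a.1) (Dd_Dd a.2)
  d_grading _ _ ha := ⟨Dd_mem ha.1, Dd_mem ha.2⟩
  d_leibniz i _ _ ha :=
    Prod.ext (GCDGA.d_leibniz i _ _ ha.1) (GCDGA.d_leibniz i _ _ ha.2)

/-- A homogeneous subalgebra, endowed with a differential. -/
@[reducible]
def subGCDGA (R : Subalgebra ℚ A) (hR : Homog (Subalgebra.toSubmodule R)) (D : A →ₗ[ℚ] A)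
    (hDR : ∀ a ∈ R, D a ∈ R) (hD : ∀ a, D (D a) = 0) (hDg : ∀ i, ∀ a ∈ Gr A i, D a ∈ Gr A (i + 1))
    (hDl : IsTwistedDer 1 D) : GCDGA R where
  grading n := (Gr A n).comap R.val.toLinearMap
  gradedAlgebra := gradedAlgebraOfProj _ one_mem_Gr
    (fun _ _ _ ha _ hb => mul_mem_Gr (A := A) ha hb)
    (fun n => (pr A n).restrict (p := Subalgebra.toSubmodule R)
      (q := Subalgebra.toSubmodule R) fun x hx => hR x hx n)
    (fun _ _ hx => Subtype.ext (pr_of_mem hx))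
    (fun _ _ h _ hx => Subtype.ext (pr_of_ne hx h))
    (mem_iSup_of_sum_pr R.val.toLinearMap Subtype.val_injective _ fun x n =>
      ⟨⟨pr A n x, hR x x.2 n⟩, pr_mem n _, rfl⟩)
  grading_comm _ _ _ _ ha hb := Subtype.ext (gr_comm (A := A) ha hb)
  d := D.restrict (p := Subalgebra.toSubmodule R) (q := Subalgebra.toSubmodule R) hDR
  d_sq a := Subtype.ext (hD a)
  d_grading i a ha := hDg i a ha
  d_leibniz i a b ha := Subtype.ext <| by
    have h := hDl a b
    rw [sgn_of_mem (n := i) (a := (a : A)) 1 ha, one_mul, smul_mul_assoc] at h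
    exact h

/-- A homogeneous subspace which is a differential two-sided ideal. -/
structure IsDGIdeal (P : Submodule ℚ A) : Prop where
  homog : Homog P
  mul_left : ∀ a, ∀ x ∈ P, a * x ∈ P
  mul_right : ∀ a, ∀ x ∈ P, x * a ∈ P
  d_mem : ∀ x ∈ P, Dd A x ∈ P

/-- The underlying ideal of the ring. -/
def IsDGIdeal.toIdeal {P : Submodule ℚ A} (hP : IsDGIdeal P) : Ideal A where
  carrier := P
  add_mem' := P.add_mem
  zero_mem' := P.zero_mem
  smul_mem' := hP.mul_left

instance {P : Submodule ℚ A} (hP : IsDGIdeal P) : hP.toIdeal.IsTwoSided :=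
  ⟨fun b h => hP.mul_right b _ h⟩

/-- The quotient by a differential ideal. -/
def IsDGIdeal.Quo {P : Submodule ℚ A} (hP : IsDGIdeal P) : Type := A ⧸ hP.toIdeal

instance {P : Submodule ℚ A} (hP : IsDGIdeal P) : Ring hP.Quo :=
  inferInstanceAs (Ring (A ⧸ hP.toIdeal))

instance {P : Submodule ℚ A} (hP : IsDGIdeal P) : Algebra ℚ hP.Quo :=
  inferInstanceAs (Algebra ℚ (A ⧸ hP.toIdeal))

/-- The projection onto the quotient. -/
def IsDGIdeal.proj {P : Submodule ℚ A} (hP : IsDGIdeal P) : A →ₐ[ℚ] hP.Quo :=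
  Ideal.Quotient.mkₐ ℚ hP.toIdeal

theorem IsDGIdeal.proj_surjective {P : Submodule ℚ A} (hP : IsDGIdeal P) :
    Function.Surjective hP.proj := Ideal.Quotient.mkₐ_surjective ℚ hP.toIdeal

theorem IsDGIdeal.proj_eq_zero {P : Submodule ℚ A} (hP : IsDGIdeal P) {a : A} :
    hP.proj a = 0 ↔ a ∈ P := Ideal.Quotient.eq_zero_iff_mem

/-- Descent of a linear endomorphism to the quotient. -/
def IsDGIdeal.desc {P : Submodule ℚ A} (hP : IsDGIdeal P) (f : A →ₗ[ℚ] A)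
    (hf : ∀ x ∈ P, f x ∈ P) : hP.Quo →ₗ[ℚ] hP.Quo where
  toFun := Quotient.lift (fun a => hP.proj (f a)) fun a b hab => by
    have hab' : a - b ∈ P := (Submodule.quotientRel_def hP.toIdeal).mp hab
    rw [← sub_eq_zero, ← map_sub, ← map_sub, hP.proj_eq_zero]
    exact hf _ hab'
  map_add' x y := by
    obtain ⟨a, rfl⟩ := hP.proj_surjective x
    obtain ⟨b, rfl⟩ := hP.proj_surjective y
    exact (congrArg hP.proj (map_add f a b)).trans (map_add _ _ _)
  map_smul' c x := by
    obtain ⟨a, rfl⟩ := hP.proj_surjective x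
    exact (congrArg hP.proj (map_smul f c a)).trans (map_smul _ _ _)

instance {P : Submodule ℚ A} (hP : IsDGIdeal P) : GCDGA hP.Quo where
  grading n := (Gr A n).map hP.proj.toLinearMap
  gradedAlgebra := gradedAlgebraOfProj _ ⟨1, one_mem_Gr, map_one hP.proj⟩
    (by
      rintro i j _ ⟨a, ha, rfl⟩ _ ⟨b, hb, rfl⟩
      exact ⟨a * b, mul_mem_Gr ha hb, map_mul hP.proj a b⟩)
    (fun n => hP.desc (pr A n) fun x hx => hP.homog x hx n)
    (by
      rintro n _ ⟨a, ha, rfl⟩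
      exact congrArg hP.proj (pr_of_mem ha))
    (by
      rintro n m h _ ⟨a, ha, rfl⟩
      exact (congrArg hP.proj (pr_of_ne ha h)).trans (map_zero _))
    (fun x => by
      obtain ⟨a, rfl⟩ := hP.proj_surjective x
      refine homog_induction (p := fun a => hP.proj a ∈ ⨆ n, (Gr A n).map hP.proj.toLinearMap)
        (by rw [map_zero]; exact Submodule.zero_mem _)
        (fun a b ha hb => by rw [map_add]; exact Submodule.add_mem _ ha hb)
        (fun n a ha => Submodule.mem_iSup_of_mem n ⟨a, ha, rfl⟩) a)
  grading_comm := by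
    rintro i j _ _ ⟨a, ha, rfl⟩ ⟨b, hb, rfl⟩
    have := congrArg hP.proj (gr_comm ha hb)
    rw [map_smul, map_mul, map_mul] at this
    exact this
  d := hP.desc (Dd A) hP.d_mem
  d_sq x := by
    obtain ⟨a, rfl⟩ := hP.proj_surjective x
    exact (congrArg hP.proj (Dd_Dd a)).trans (map_zero _)
  d_grading := by
    rintro i _ ⟨a, ha, rfl⟩
    exact ⟨_, Dd_mem ha, rfl⟩
  d_leibniz := by
    rintro i _ y ⟨a, ha, rfl⟩
    obtain ⟨b, rfl⟩ := hP.proj_surjective y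
    refine (congrArg hP.proj (GCDGA.d_leibniz i a b ha)).trans ?_
    rw [map_add, map_smul, map_mul, map_mul]
    rfl

theorem IsDGIdeal.proj_dga {P : Submodule ℚ A} (hP : IsDGIdeal P) : IsDGAHom hP.proj :=
  ⟨fun _ => rfl, fun _ a ha => ⟨a, ha, rfl⟩⟩

/-- The space underlying the twisted dual numbers over `A`. -/
def TwDual (A : Type) (_ : ℕ) : Type := A × A

instance (s : ℕ) : AddCommGroup (TwDual A s) := inferInstanceAs (AddCommGroup (A × A))

instance (s : ℕ) : Module ℚ (TwDual A s) := inferInstanceAs (Module ℚ (A × A))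

instance (s : ℕ) : Ring (TwDual A s) :=
  { (inferInstance : AddCommGroup (TwDual A s)) with
    mul := fun x y => (x.1 * y.1, x.2 * y.1 + sgn A s x.1 * y.2)
    one := ((1 : A), (0 : A))
    left_distrib := fun x y z => Prod.ext (mul_add _ _ _) <| by
      change x.2 * (y.1 + z.1) + sgn A s x.1 * (y.2 + z.2) =
        (x.2 * y.1 + sgn A s x.1 * y.2) + (x.2 * z.1 + sgn A s x.1 * z.2)
      rw [mul_add, mul_add]; abel
    right_distrib := fun x y z => Prod.ext (add_mul _ _ _) <| by
      change (x.2 + y.2) * z.1 + sgn A s (x.1 + y.1) * z.2 =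
        (x.2 * z.1 + sgn A s x.1 * z.2) + (y.2 * z.1 + sgn A s y.1 * z.2)
      rw [map_add, add_mul, add_mul]; abel
    zero_mul := fun x => Prod.ext (zero_mul _) <| by
      change 0 * x.1 + sgn A s 0 * x.2 = 0
      simp
    mul_zero := fun x => Prod.ext (mul_zero _) <| by
      change x.2 * 0 + sgn A s x.1 * 0 = 0
      simp
    mul_assoc := fun x y z => Prod.ext (mul_assoc _ _ _) <| by
      change (x.2 * y.1 + sgn A s x.1 * y.2) * z.1 + sgn A s (x.1 * y.1) * z.2 =
        x.2 * (y.1 * z.1) + sgn A s x.1 * (y.2 * z.1 + sgn A s y.1 * z.2)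
      rw [sgn_mul]; noncomm_ring
    one_mul := fun x => Prod.ext (one_mul _) <| by
      change 0 * x.1 + sgn A s 1 * x.2 = x.2
      rw [sgn_one]; simp
    mul_one := fun x => Prod.ext (mul_one _) <| by
      change x.2 * 1 + sgn A s x.1 * 0 = x.2
      simp }

instance (s : ℕ) : Algebra ℚ (TwDual A s) :=
  Algebra.ofModule
    (fun c x y => Prod.ext (smul_mul_assoc c x.1 y.1) <| by
      change (c • x.2) * y.1 + sgn A s (c • x.1) * y.2 = c • (x.2 * y.1 + sgn A s x.1 * y.2)
      rw [map_smul, smul_add, smul_mul_assoc, smul_mul_assoc])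
    (fun c x y => Prod.ext (mul_smul_comm c x.1 y.1) <| by
      change x.2 * (c • y.1) + sgn A s x.1 * (c • y.2) = c • (x.2 * y.1 + sgn A s x.1 * y.2)
      rw [smul_add, mul_smul_comm, mul_smul_comm])

/-- The element of the twisted dual numbers with given components. -/
def TwDual.mk (s : ℕ) (a b : A) : TwDual A s := (a, b)

theorem TwDual.mk_add (s : ℕ) (a b a' b' : A) :
    TwDual.mk s a b + TwDual.mk s a' b' = TwDual.mk s (a + a') (b + b') := rfl

/-- The grading of the twisted dual numbers. -/
def TwDual.gr (A : Type) [GCDGA A] (s n : ℕ) : Submodule ℚ (TwDual A s) :=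
  (Gr A n).prod (if s ≤ n then Gr A (n - s) else ⊥)

theorem TwDual.mem_gr {s n : ℕ} {x : TwDual A s} :
    x ∈ TwDual.gr A s n ↔ x.1 ∈ Gr A n ∧ (x.2 ≠ 0 → s ≤ n) ∧ x.2 ∈ Gr A (n - s) := by
  change x.1 ∈ Gr A n ∧ x.2 ∈ (if s ≤ n then Gr A (n - s) else ⊥) ↔ _
  split_ifs with h
  · simp [h]
  · rw [Submodule.mem_bot]
    by_cases h0 : x.2 = 0
    · simp [h0]
    · simp [h0, h]

theorem TwDual.mul_fst {s : ℕ} (x y : TwDual A s) : (x * y).1 = x.1 * y.1 := rfl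

theorem TwDual.mul_snd {s : ℕ} (x y : TwDual A s) :
    (x * y).2 = x.2 * y.1 + sgn A s x.1 * y.2 := rfl

instance (s : ℕ) : GCDGA (TwDual A s) where
  grading := TwDual.gr A s
  gradedAlgebra := gradedAlgebraOfProj _
    (TwDual.mem_gr.mpr ⟨one_mem_Gr, fun h => absurd rfl h, Submodule.zero_mem _⟩)
    (fun i j x hx y hy => by
      rw [TwDual.mem_gr] at hx hy ⊢
      obtain ⟨hx1, hx2, hx3⟩ := hx
      obtain ⟨hy1, hy2, hy3⟩ := hy
      rw [TwDual.mul_fst, TwDual.mul_snd]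
      have h1 : x.2 * y.1 ≠ 0 → s ≤ i := fun h => hx2 (left_ne_zero_of_mul h)
      have h2 : sgn A s x.1 * y.2 ≠ 0 → s ≤ j := fun h => hy2 (right_ne_zero_of_mul h)
      refine ⟨mul_mem_Gr hx1 hy1, fun h => ?_, Submodule.add_mem _ ?_ ?_⟩
      · by_contra hs
        have h1' := not_not.mp fun h => hs ((h1 h).trans (Nat.le_add_right i j))
        have h2' := not_not.mp fun h => hs ((h2 h).trans (Nat.le_add_left j i))
        rw [h1', h2', add_zero] at h
        exact h rfl
      · by_cases h : x.2 * y.1 = 0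
        · rw [h]; exact Submodule.zero_mem _
        · have := mul_mem_Gr hx3 hy1
          rwa [show i - s + j = i + j - s by have := h1 h; omega] at this
      · by_cases h : sgn A s x.1 * y.2 = 0
        · rw [h]; exact Submodule.zero_mem _
        · have := mul_mem_Gr (sgn_mem s hx1) hy3
          rwa [show i + (j - s) = i + j - s by have := h2 h; omega] at this)
    (fun n => (pr A n).prodMap (if s ≤ n then pr A (n - s) else 0))
    (fun n x hx => by
      rw [TwDual.mem_gr] at hx
      refine Prod.ext (pr_of_mem hx.1) ?_
      change (if s ≤ n then pr A (n - s) else 0) x.2 = x.2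
      split_ifs with h
      · exact pr_of_mem hx.2.2
      · exact (not_not.mp fun h' => h (hx.2.1 h')).symm)
    (fun n m hnm x hx => by
      rw [TwDual.mem_gr] at hx
      refine Prod.ext (pr_of_ne hx.1 hnm) ?_
      change (if s ≤ m then pr A (m - s) else 0) x.2 = 0
      split_ifs with h
      · by_cases h0 : x.2 = 0
        · rw [h0, map_zero]
        · have := hx.2.1 h0
          exact pr_of_ne hx.2.2 (by omega)
      · rfl)
    (fun x => by
      have h1 : ∀ a : A, TwDual.mk s a 0 ∈ ⨆ n, TwDual.gr A s n :=
        homog_induction (Submodule.zero_mem _)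
          (fun a b ha hb => by
            have := Submodule.add_mem _ ha hb
            rwa [TwDual.mk_add, add_zero] at this)
          (fun n a ha => Submodule.mem_iSup_of_mem n
            (TwDual.mem_gr.mpr ⟨ha, fun h => absurd rfl h, Submodule.zero_mem _⟩))
      have h2 : ∀ a : A, TwDual.mk s 0 a ∈ ⨆ n, TwDual.gr A s n :=
        homog_induction (Submodule.zero_mem _)
          (fun a b ha hb => by
            have := Submodule.add_mem _ ha hb
            rwa [TwDual.mk_add, add_zero] at this)
          (fun n a ha => Submodule.mem_iSup_of_mem (n + s)
            (TwDual.mem_gr.mpr ⟨Submodule.zero_mem _, fun _ => Nat.le_add_left s n, by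
              rwa [Nat.add_sub_cancel]⟩))
      have := Submodule.add_mem _ (h1 x.1) (h2 x.2)
      rwa [TwDual.mk_add, add_zero, zero_add] at this)
  grading_comm i j x y hx hy := by
    have hx := TwDual.mem_gr.mp hx
    have hy := TwDual.mem_gr.mp hy
    refine Prod.ext (gr_comm hx.1 hy.1) ?_
    change x.2 * y.1 + sgn A s x.1 * y.2 =
      ((-1 : ℚ) ^ (i * j)) • (y.2 * x.1 + sgn A s y.1 * x.2)
    rw [sgn_of_mem s hx.1, sgn_of_mem s hy.1, smul_add, add_comm, smul_mul_assoc, smul_mul_assoc,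
      smul_smul]
    congr 1
    · by_cases h : y.2 = 0
      · simp [h]
      · have hs := hy.2.1 h
        rw [gr_comm hx.1 hy.2.2, smul_smul, ← pow_add]
        congr 2
        obtain ⟨k, rfl⟩ := Nat.exists_eq_add_of_le hs
        rw [Nat.add_sub_cancel_left]; ring
    · by_cases h : x.2 = 0
      · simp [h]
      · have hs := hx.2.1 h
        rw [gr_comm hx.2.2 hy.1, ← pow_add]
        obtain ⟨k, rfl⟩ := Nat.exists_eq_add_of_le hs
        rw [Nat.add_sub_cancel_left, show (s + k) * j + s * j = k * j + (s * j + s * j) by ring,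
          pow_add _ (k * j), pow_add, neg_one_pow_mul_self, mul_one]
  d := 0
  d_sq _ := rfl
  d_grading _ _ _ := Submodule.zero_mem _
  d_leibniz _ _ _ _ := by simp

end Constructions

/-! ### Tensor products of gcdga's -/

section Tensor

open scoped TensorProduct

variable {X Y : Type} [GCDGA X] [GCDGA Y]

/-- The graded tensor product of two gcdga's. -/
def Tens (X Y : Type) [GCDGA X] [GCDGA Y] : Type := GradedTensorProduct ℚ (Gr X) (Gr Y)

instance : Ring (Tens X Y) := inferInstanceAs (Ring (GradedTensorProduct ℚ (Gr X) (Gr Y)))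

instance : Algebra ℚ (Tens X Y) :=
  inferInstanceAs (Algebra ℚ (GradedTensorProduct ℚ (Gr X) (Gr Y)))

/-- The identification of the underlying spaces. -/
def Tens.of (X Y : Type) [GCDGA X] [GCDGA Y] : X ⊗[ℚ] Y ≃ₗ[ℚ] Tens X Y :=
  GradedTensorProduct.of ℚ (Gr X) (Gr Y)

/-- Pure tensors. -/
def tm (a : X) (b : Y) : Tens X Y := Tens.of X Y (a ⊗ₜ b)

theorem tm_add_left (a a' : X) (b : Y) : tm (a + a') b = tm a b + tm a' b := by
  rw [tm, TensorProduct.add_tmul, map_add]; rfl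

theorem tm_add_right (a : X) (b b' : Y) : tm a (b + b') = tm a b + tm a b' := by
  rw [tm, TensorProduct.tmul_add, map_add]; rfl

theorem tm_smul_left (c : ℚ) (a : X) (b : Y) : tm (c • a) b = c • tm a b := by
  rw [tm, ← TensorProduct.smul_tmul', map_smul]; rfl

theorem tm_smul_right (c : ℚ) (a : X) (b : Y) : tm a (c • b) = c • tm a b := by
  rw [tm, TensorProduct.tmul_smul, map_smul]; rfl

theorem tm_zero_left (b : Y) : tm (0 : X) b = 0 := by
  rw [tm, TensorProduct.zero_tmul, map_zero]

theorem tm_zero_right (a : X) : tm a (0 : Y) = 0 := by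
  rw [tm, TensorProduct.tmul_zero, map_zero]

theorem tm_one_one : tm (1 : X) (1 : Y) = 1 := rfl

theorem tm_mul {i j : ℕ} (a : X) {b : Y} {a' : X} (b' : Y) (hb : b ∈ Gr Y j) (ha' : a' ∈ Gr X i) :
    tm a b * tm a' b' = ((-1 : ℚ) ^ (j * i)) • tm (a * a') (b * b') := by
  have h := GradedTensorProduct.tmul_coe_mul_coe_tmul (R := ℚ) (Gr X) (Gr Y) a ⟨b, hb⟩ ⟨a', ha'⟩ b'
  refine Eq.trans h ?_
  rw [Units.smul_def, ← Int.cast_smul_eq_zsmul ℚ]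
  have : ∀ n : ℕ, (((-1 : ℤˣ) ^ n : ℤˣ) : ℤ) = (-1 : ℤ) ^ n := fun n => by
    rcases Nat.even_or_odd n with hn | hn
    · rw [hn.neg_one_pow, hn.neg_one_pow]; rfl
    · rw [hn.neg_one_pow, hn.neg_one_pow]; rfl
  rw [this]
  push_cast
  rfl

theorem Tens.induction {p : Tens X Y → Prop} (h0 : p 0) (hadd : ∀ x y, p x → p y → p (x + y))
    (hom : ∀ i j, ∀ a ∈ Gr X i, ∀ b ∈ Gr Y j, p (tm a b)) (x : Tens X Y) : p x := by
  have h : ∀ y : X ⊗[ℚ] Y, p (Tens.of X Y y) := by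
    intro y
    induction y using TensorProduct.induction_on with
    | zero => rw [map_zero]; exact h0
    | add y z hy hz => rw [map_add]; exact hadd _ _ hy hz
    | tmul a b =>
      refine homog_induction (p := fun a => p (tm a b)) (by rwa [tm_zero_left])
        (fun a a' ha ha' => by rw [tm_add_left]; exact hadd _ _ ha ha') (fun i a ha => ?_) a
      exact homog_induction (p := fun b => p (tm a b)) (by rwa [tm_zero_right])
        (fun b b' hb hb' => by rw [tm_add_right]; exact hadd _ _ hb hb')
        (fun j b hb => hom i j a ha b hb) b
  exact h ((Tens.of X Y).symm x)

/-- The tensor product of two linear maps. -/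
def Tens.map {X' Y' : Type} [GCDGA X'] [GCDGA Y'] (f : X →ₗ[ℚ] X') (g : Y →ₗ[ℚ] Y') :
    Tens X Y →ₗ[ℚ] Tens X' Y' :=
  (Tens.of X' Y').toLinearMap ∘ₗ TensorProduct.map f g ∘ₗ (Tens.of X Y).symm.toLinearMap

theorem Tens.map_tm {X' Y' : Type} [GCDGA X'] [GCDGA Y'] (f : X →ₗ[ℚ] X') (g : Y →ₗ[ℚ] Y')
    (a : X) (b : Y) : Tens.map f g (tm a b) = tm (f a) (g b) := rfl

/-- The grading of the tensor product. -/
def Tens.gr (X Y : Type) [GCDGA X] [GCDGA Y] (n : ℕ) : Submodule ℚ (Tens X Y) :=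
  Submodule.span ℚ {t | ∃ i j, i + j = n ∧ ∃ a ∈ Gr X i, ∃ b ∈ Gr Y j, t = tm a b}

theorem Tens.tm_mem {i j : ℕ} {a : X} {b : Y} (ha : a ∈ Gr X i) (hb : b ∈ Gr Y j) :
    tm a b ∈ Tens.gr X Y (i + j) :=
  Submodule.subset_span ⟨i, j, rfl, a, ha, b, hb, rfl⟩

theorem Tens.gr_induction {n : ℕ} {p : Tens X Y → Prop} (h0 : p 0)
    (hadd : ∀ x y, p x → p y → p (x + y)) (hsmul : ∀ (c : ℚ) x, p x → p (c • x))
    (hom : ∀ i j, i + j = n → ∀ a ∈ Gr X i, ∀ b ∈ Gr Y j, p (tm a b)) {x : Tens X Y}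
    (hx : x ∈ Tens.gr X Y n) : p x := by
  induction hx using Submodule.span_induction with
  | mem t ht =>
    obtain ⟨i, j, h, a, ha, b, hb, rfl⟩ := ht
    exact hom i j h a ha b hb
  | zero => exact h0
  | add x y _ _ hx hy => exact hadd x y hx hy
  | smul c x _ hx => exact hsmul c x hx

/-- The differential of the tensor product. -/
def Tens.d (X Y : Type) [GCDGA X] [GCDGA Y] : Tens X Y →ₗ[ℚ] Tens X Y :=
  Tens.map (Dd X) LinearMap.id + Tens.map (sgn X 1) (Dd Y)

theorem Tens.d_tm (a : X) (b : Y) :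
    Tens.d X Y (tm a b) = tm (Dd X a) b + tm (sgn X 1 a) (Dd Y b) := rfl

theorem Tens.d_tm_of_mem {i : ℕ} {a : X} (ha : a ∈ Gr X i) (b : Y) :
    Tens.d X Y (tm a b) = tm (Dd X a) b + ((-1 : ℚ) ^ i) • tm a (Dd Y b) := by
  rw [Tens.d_tm, sgn_of_mem 1 ha, one_mul, tm_smul_left]

theorem Tens.d_mul {n : ℕ} {x : Tens X Y} (hx : x ∈ Tens.gr X Y n) (y : Tens X Y) :
    Tens.d X Y (x * y) = Tens.d X Y x * y + ((-1 : ℚ) ^ n) • (x * Tens.d X Y y) := by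
  refine Tens.gr_induction (p := fun x => Tens.d X Y (x * y) =
    Tens.d X Y x * y + ((-1 : ℚ) ^ n) • (x * Tens.d X Y y)) (by simp)
    (fun x x' hx hx' => by
      simp only [map_add, add_mul, smul_add, hx, hx']; abel)
    (fun c x hx => by
      simp only [map_smul, smul_mul_assoc, hx, smul_add, smul_comm c]) ?_ hx
  rintro i j rfl a ha b hb
  refine Tens.induction (p := fun y => Tens.d X Y (tm a b * y) =
    Tens.d X Y (tm a b) * y + ((-1 : ℚ) ^ (i + j)) • (tm a b * Tens.d X Y y)) (by simp)
    (fun y y' hy hy' => by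
      simp only [map_add, mul_add, smul_add, hy, hy']; abel) ?_ y
  intro k l a' ha' b' hb'
  rw [tm_mul a b' hb ha', map_smul, Tens.d_tm_of_mem (mul_mem_Gr ha ha'), Tens.d_tm_of_mem ha,
    Tens.d_tm_of_mem ha', add_mul, mul_add, smul_mul_assoc, mul_smul_comm,
    tm_mul _ _ hb ha', tm_mul _ _ (Dd_mem hb) ha', tm_mul _ _ hb (Dd_mem ha'), tm_mul _ _ hb ha',
    Dd_mul, Dd_mul, sgn_of_mem 1 ha, sgn_of_mem 1 hb, tm_add_left, tm_add_right]
  simp only [smul_mul_assoc, tm_smul_left, tm_smul_right, smul_add, smul_smul, pow_add, mul_add,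
    add_mul, one_mul, mul_one, pow_mul]
  rcases neg_one_pow_eq_or ℚ i with hi | hi <;> rcases neg_one_pow_eq_or ℚ j with hj | hj <;>
    rcases neg_one_pow_eq_or ℚ k with hk | hk <;> simp [hi, hj, hk] <;> abel

theorem Tens.mul_mem {i j : ℕ} {x y : Tens X Y} (hx : x ∈ Tens.gr X Y i) (hy : y ∈ Tens.gr X Y j) :
    x * y ∈ Tens.gr X Y (i + j) := by
  refine Tens.gr_induction (p := fun x => x * y ∈ Tens.gr X Y (i + j))
    (by rw [zero_mul]; exact Submodule.zero_mem _)
    (fun x x' hx hx' => by rw [add_mul]; exact Submodule.add_mem _ hx hx')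
    (fun c x hx => by rw [smul_mul_assoc]; exact Submodule.smul_mem _ _ hx) ?_ hx
  rintro i1 i2 rfl a ha b hb
  refine Tens.gr_induction (p := fun y => tm a b * y ∈ Tens.gr X Y (i1 + i2 + j))
    (by rw [mul_zero]; exact Submodule.zero_mem _)
    (fun x x' hx hx' => by rw [mul_add]; exact Submodule.add_mem _ hx hx')
    (fun c x hx => by rw [mul_smul_comm]; exact Submodule.smul_mem _ _ hx) ?_ hy
  rintro j1 j2 rfl a' ha' b' hb'
  rw [tm_mul _ _ hb ha', show i1 + i2 + (j1 + j2) = (i1 + j1) + (i2 + j2) by omega]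
  exact Submodule.smul_mem _ _ (Tens.tm_mem (mul_mem_Gr ha ha') (mul_mem_Gr hb hb'))

theorem Tens.mul_comm {i j : ℕ} {x y : Tens X Y} (hx : x ∈ Tens.gr X Y i)
    (hy : y ∈ Tens.gr X Y j) : x * y = ((-1 : ℚ) ^ (i * j)) • (y * x) := by
  refine Tens.gr_induction (p := fun x => x * y = ((-1 : ℚ) ^ (i * j)) • (y * x)) (by simp)
    (fun x x' hx hx' => by rw [add_mul, mul_add, smul_add, hx, hx'])
    (fun c x hx => by rw [smul_mul_assoc, mul_smul_comm, hx, smul_comm]) ?_ hx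
  rintro i1 i2 rfl a ha b hb
  refine Tens.gr_induction
    (p := fun y => tm a b * y = ((-1 : ℚ) ^ ((i1 + i2) * j)) • (y * tm a b)) (by simp)
    (fun x x' hx hx' => by rw [mul_add, add_mul x, smul_add, hx, hx'])
    (fun c x hx => by rw [smul_mul_assoc, mul_smul_comm, hx, smul_comm]) ?_ hy
  rintro j1 j2 rfl a' ha' b' hb'
  rw [tm_mul _ _ hb ha', tm_mul _ _ hb' ha, gr_comm ha ha', gr_comm hb hb']
  simp only [tm_smul_left, tm_smul_right, smul_smul, pow_add, mul_add, add_mul, pow_mul]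
  congr 1
  rcases neg_one_pow_eq_or ℚ i1 with h1 | h1 <;> rcases neg_one_pow_eq_or ℚ i2 with h2 | h2 <;>
    rcases neg_one_pow_eq_or ℚ j1 with h3 | h3 <;> rcases neg_one_pow_eq_or ℚ j2 with h4 | h4 <;>
    simp [h1, h2, h3, h4]

theorem Tens.d_mem {n : ℕ} {x : Tens X Y} (hx : x ∈ Tens.gr X Y n) :
    Tens.d X Y x ∈ Tens.gr X Y (n + 1) := by
  refine Tens.gr_induction (p := fun x => Tens.d X Y x ∈ Tens.gr X Y (n + 1))
    (by rw [map_zero]; exact Submodule.zero_mem _)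
    (fun x x' hx hx' => by rw [map_add]; exact Submodule.add_mem _ hx hx')
    (fun c x hx => by rw [map_smul]; exact Submodule.smul_mem _ _ hx) ?_ hx
  rintro i j rfl a ha b hb
  rw [Tens.d_tm_of_mem ha]
  refine Submodule.add_mem _ ?_ (Submodule.smul_mem _ _ ?_)
  · rw [show i + j + 1 = i + 1 + j by omega]
    exact Tens.tm_mem (Dd_mem ha) hb
  · exact (Tens.tm_mem ha (Dd_mem hb) :)

theorem Tens.d_d (x : Tens X Y) : Tens.d X Y (Tens.d X Y x) = 0 := by
  refine Tens.induction (p := fun x => Tens.d X Y (Tens.d X Y x) = 0) (by simp)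
    (fun x y hx hy => by rw [map_add, map_add, hx, hy, add_zero]) ?_ x
  intro i j a ha b hb
  rw [Tens.d_tm_of_mem ha, map_add, map_smul, Tens.d_tm_of_mem (Dd_mem ha), Tens.d_tm_of_mem ha,
    Dd_Dd, Dd_Dd, tm_zero_left, tm_zero_right, pow_succ]
  simp

/-- The projections onto the homogeneous components of the tensor product. -/
def Tens.pr (X Y : Type) [GCDGA X] [GCDGA Y] (n : ℕ) : Tens X Y →ₗ[ℚ] Tens X Y :=
  ∑ p ∈ Finset.HasAntidiagonal.antidiagonal n, Tens.map (RHT.pr X p.1) (RHT.pr Y p.2)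

theorem Tens.pr_tm {i j : ℕ} {a : X} {b : Y} (ha : a ∈ Gr X i) (hb : b ∈ Gr Y j) (n : ℕ) :
    Tens.pr X Y n (tm a b) = if i + j = n then tm a b else 0 := by
  rw [Tens.pr, LinearMap.sum_apply]
  have h : ∀ p ∈ Finset.HasAntidiagonal.antidiagonal n, p ≠ (i, j) →
      Tens.map (RHT.pr X p.1) (RHT.pr Y p.2) (tm a b) = 0 := by
    intro p _ hp
    rw [Tens.map_tm]
    by_cases h1 : i = p.1
    · have h2 : j ≠ p.2 := fun h2 => hp (Prod.ext h1.symm h2.symm)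
      rw [pr_of_ne hb h2, tm_zero_right]
    · rw [pr_of_ne ha h1, tm_zero_left]
  split_ifs with hn
  · rw [Finset.sum_eq_single_of_mem (i, j) (Finset.HasAntidiagonal.mem_antidiagonal.mpr hn) h, Tens.map_tm,
      pr_of_mem ha, pr_of_mem hb]
  · refine Finset.sum_eq_zero fun p hp => h p hp ?_
    rintro rfl
    exact hn (Finset.HasAntidiagonal.mem_antidiagonal.mp hp)

theorem Tens.one_mem : (1 : Tens X Y) ∈ Tens.gr X Y 0 := by
  rw [← tm_one_one]
  exact Tens.tm_mem (i := 0) (j := 0) one_mem_Gr one_mem_Gr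

theorem Tens.mem_iSup_gr (x : Tens X Y) : x ∈ ⨆ n, Tens.gr X Y n :=
  Tens.induction (p := fun x => x ∈ ⨆ n, Tens.gr X Y n) (Submodule.zero_mem _)
    (fun _ _ hx hy => Submodule.add_mem _ hx hy)
    (fun i j _ ha _ hb => Submodule.mem_iSup_of_mem (i + j) (Tens.tm_mem ha hb)) x

theorem Tens.pr_of_mem {n : ℕ} {x : Tens X Y} (hx : x ∈ Tens.gr X Y n) : Tens.pr X Y n x = x :=
  Tens.gr_induction (p := fun x => Tens.pr X Y n x = x) (by simp)
    (fun x y hx hy => by rw [map_add, hx, hy]) (fun c x hx => by rw [map_smul, hx])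
    (fun i j h a ha b hb => by rw [Tens.pr_tm ha hb, if_pos h]) hx

theorem Tens.pr_of_ne {n m : ℕ} (hnm : n ≠ m) {x : Tens X Y} (hx : x ∈ Tens.gr X Y n) :
    Tens.pr X Y m x = 0 :=
  Tens.gr_induction (p := fun x => Tens.pr X Y m x = 0) (by simp)
    (fun x y hx hy => by rw [map_add, hx, hy, add_zero])
    (fun c x hx => by rw [map_smul, hx, smul_zero])
    (fun i j h a ha b hb => by rw [Tens.pr_tm ha hb, if_neg (by omega)]) hx

instance : GCDGA (Tens X Y) where
  grading := Tens.gr X Y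
  gradedAlgebra := gradedAlgebraOfProj _ Tens.one_mem
    (fun _ _ _ ha _ hb => Tens.mul_mem ha hb) (Tens.pr X Y)
    (fun _ _ hx => Tens.pr_of_mem hx) (fun _ _ hnm _ hx => Tens.pr_of_ne hnm hx)
    Tens.mem_iSup_gr
  grading_comm _ _ _ _ ha hb := Tens.mul_comm ha hb
  d := Tens.d X Y
  d_sq := Tens.d_d
  d_grading _ _ ha := Tens.d_mem ha
  d_leibniz _ _ y ha := Tens.d_mul ha y

theorem Tens.Dd_tm (a : X) (b : Y) :
    Dd (Tens X Y) (tm a b) = tm (Dd X a) b + tm (sgn X 1 a) (Dd Y b) := rfl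

theorem Tens.tm_mem_Gr {i j : ℕ} {a : X} {b : Y} (ha : a ∈ Gr X i) (hb : b ∈ Gr Y j) :
    tm a b ∈ Gr (Tens X Y) (i + j) := Tens.tm_mem ha hb

theorem tm_mul_one_right (a a' : X) (b' : Y) : tm a 1 * tm a' b' = tm (a * a') b' := by
  refine homog_induction (p := fun a' => tm a 1 * tm a' b' = tm (a * a') b')
    (by simp [tm_zero_left])
    (fun x y hx hy => by rw [tm_add_left, mul_add, mul_add, tm_add_left, hx, hy])
    (fun j a' ha' => ?_) a'
  rw [tm_mul a b' one_mem_Gr ha', zero_mul, pow_zero, one_smul, one_mul]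

/-- The left inclusion. -/
def Tens.inl (X Y : Type) [GCDGA X] [GCDGA Y] : X →ₐ[ℚ] Tens X Y :=
  GradedTensorProduct.includeLeft (Gr X) (Gr Y)

/-- The right inclusion. -/
def Tens.inr (X Y : Type) [GCDGA X] [GCDGA Y] : Y →ₐ[ℚ] Tens X Y :=
  GradedTensorProduct.includeRight (Gr X) (Gr Y)

theorem Tens.inl_apply (a : X) : Tens.inl X Y a = tm a 1 := rfl

theorem Tens.inr_apply (b : Y) : Tens.inr X Y b = tm 1 b := rfl

theorem Tens.inl_dga : IsDGAHom (Tens.inl X Y) :=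
  ⟨fun a => by rw [Tens.inl_apply, Tens.inl_apply, Tens.Dd_tm, Dd_one, tm_zero_right, add_zero],
    fun i _ ha => Tens.tm_mem_Gr (j := 0) ha one_mem_Gr⟩

theorem Tens.inr_dga : IsDGAHom (Tens.inr X Y) :=
  ⟨fun b => by
    rw [Tens.inr_apply, Tens.inr_apply, Tens.Dd_tm, Dd_one, tm_zero_left, zero_add, sgn_one],
    fun i b hb => by
      have := Tens.tm_mem_Gr (one_mem_Gr (A := X)) hb
      rwa [zero_add] at this⟩

theorem Tens.inl_mul_inr (a : X) (b : Y) : Tens.inl X Y a * Tens.inr X Y b = tm a b := by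
  rw [Tens.inl_apply, Tens.inr_apply, tm_mul_one_right, mul_one]

theorem Tens.algHom_ext {Z : Type} [GCDGA Z] {F G : Tens X Y →ₐ[ℚ] Z}
    (hl : F.comp (Tens.inl X Y) = G.comp (Tens.inl X Y))
    (hr : F.comp (Tens.inr X Y) = G.comp (Tens.inr X Y)) : F = G :=
  GradedTensorProduct.algHom_ext (Gr X) (Gr Y) hl hr

/-- The universal property of the tensor product. -/
theorem Tens.exists_lift {Z : Type} [GCDGA Z] {f : X →ₐ[ℚ] Z} {g : Y →ₐ[ℚ] Z} (hf : IsDGAHom f)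
    (hg : IsDGAHom g) : ∃ F : Tens X Y →ₐ[ℚ] Z, IsDGAHom F ∧ F.comp (Tens.inl X Y) = f ∧
      F.comp (Tens.inr X Y) = g ∧ ∀ a b, F (tm a b) = f a * g b := by
  have hcomm : ∀ ⦃i j : ℕ⦄ (a : Gr X i) (b : Gr Y j),
      f a * g b = (-1 : ℤˣ) ^ (j * i) • (g b * f a) := by
    intro i j a b
    rw [gr_comm (hf.2 i a a.2) (hg.2 j b b.2), Units.smul_def, ← Int.cast_smul_eq_zsmul ℚ,
      _root_.mul_comm]
    congr 1
    push_cast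
    rfl
  obtain ⟨F, hF⟩ : ∃ F : Tens X Y →ₐ[ℚ] Z, ∀ a b, F (tm a b) = f a * g b :=
    ⟨GradedTensorProduct.lift (Gr X) (Gr Y) f g hcomm, fun _ _ => rfl⟩
  refine ⟨F, ⟨fun x => ?_, fun n x hx => ?_⟩, ?_, ?_, hF⟩
  · refine Tens.induction (p := fun x => F (Dd _ x) = Dd Z (F x)) (by simp)
      (fun x y hx hy => by simp only [map_add, hx, hy]) (fun i j a ha b hb => ?_) x
    rw [Tens.Dd_tm, map_add, hF, hF, hF, Dd_mul, hf.sgn, hf.1, hg.1]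
  · refine Tens.gr_induction (p := fun x => F x ∈ Gr Z n)
      (by rw [map_zero]; exact Submodule.zero_mem _)
      (fun x y hx hy => by rw [map_add]; exact Submodule.add_mem _ hx hy)
      (fun c x hx => by rw [map_smul]; exact Submodule.smul_mem _ _ hx) ?_ hx
    rintro i j rfl a ha b hb
    rw [hF]
    exact mul_mem_Gr (hf.2 _ _ ha) (hg.2 _ _ hb)
  · ext a
    rw [AlgHom.comp_apply, Tens.inl_apply, hF, map_one, mul_one]
  · ext a
    rw [AlgHom.comp_apply, Tens.inr_apply, hF, map_one, one_mul]

end Tensor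

/-- The algebra itself is its first tensor power. -/
def TensorPower.one (A : Type) [GCDGA A] : TensorPower A 1 A where
  ι _ := AlgHom.id ℚ A
  ι_dga _ := isDGAHom_id A
  coprod B _ f hf := ⟨f 0, ⟨hf 0, fun j => by rw [Subsingleton.elim j 0]; rfl⟩,
    fun _ hg => hg.2 0⟩

/-- Adding one tensor factor. -/
def TensorPower.succ {A : Type} [GCDGA A] {r : ℕ} {T : Type} [GCDGA T] (TP : TensorPower A r T) :
    TensorPower A (r + 1) (Tens A T) where
  ι := Fin.cons (Tens.inl A T) fun j => (Tens.inr A T).comp (TP.ι j)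
  ι_dga := Fin.cases Tens.inl_dga fun j => Tens.inr_dga.comp (TP.ι_dga j)
  coprod B _ f hf := by
    obtain ⟨g, ⟨hg, hgf⟩, hu⟩ := TP.coprod B (fun j => f j.succ) fun j => hf j.succ
    obtain ⟨F, hF, hl, hr, -⟩ := Tens.exists_lift (hf 0) hg
    refine ⟨F, ⟨hF, fun j => ?_⟩, fun G hG => ?_⟩
    · refine Fin.cases hl (fun j => ?_) j
      rw [Fin.cons_succ, ← AlgHom.comp_assoc, hr, hgf]
    · refine Tens.algHom_ext ((hG.2 0).trans hl.symm) (Eq.trans ?_ hr.symm)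
      refine hu _ ⟨hG.1.comp Tens.inr_dga, fun j => ?_⟩
      rw [AlgHom.comp_assoc]
      exact hG.2 j.succ

section Generation

variable {A : Type} [GCDGA A]

theorem MinimalSullivan.algHom_eq_id (S : MinimalSullivan A) {f : A →ₐ[ℚ] A}
    (hf : ∀ (i : ℕ) (a : A), a ∈ Gr A i → f a ∈ Gr A i) (hV : ∀ n, ∀ v ∈ S.V n, f v = v) :
    f = AlgHom.id ℚ A :=
  (S.free A (fun n => (S.V n).subtype) fun n v => S.V_le n v.2).unique
    ⟨hf, fun n v => hV n v v.2⟩ ⟨fun _ _ h => h, fun _ _ => rfl⟩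

/-- The space of all generators. -/
def MinimalSullivan.W (S : MinimalSullivan A) : Submodule ℚ A := ⨆ n, S.V n

theorem MinimalSullivan.homog_W (S : MinimalSullivan A) : Homog S.W :=
  Homog.iSup fun n => Homog.of_le_Gr (S.V_le n)

theorem MinimalSullivan.V_le_W (S : MinimalSullivan A) (n : ℕ) : S.V n ≤ S.W := le_iSup S.V n

theorem iSup_pow_mul_iSup_pow (M : Submodule ℚ A) :
    (⨆ k, M ^ k) * (⨆ k, M ^ k) ≤ ⨆ k, M ^ k := by
  rw [Submodule.iSup_mul]
  refine iSup_le fun i => ?_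
  rw [Submodule.mul_iSup]
  refine iSup_le fun j => ?_
  rw [← pow_add]
  exact le_iSup (fun k => M ^ k) (i + j)

theorem toSubmodule_adjoin_eq (M : Submodule ℚ A) :
    Subalgebra.toSubmodule (Algebra.adjoin ℚ (M : Set A)) = ⨆ k, M ^ k := by
  refine le_antisymm (fun x (hx : x ∈ Algebra.adjoin ℚ (M : Set A)) => ?_) (iSup_le fun k => ?_)
  · induction hx using Algebra.adjoin_induction with
    | mem x hx => exact Submodule.mem_iSup_of_mem 1 (by rwa [pow_one])
    | algebraMap c =>
      exact Submodule.mem_iSup_of_mem 0 (by rw [pow_zero]; exact Submodule.algebraMap_mem c)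
    | add x y _ _ hx hy => exact Submodule.add_mem _ hx hy
    | mul x y _ _ hx hy => exact iSup_pow_mul_iSup_pow M (Submodule.mul_mem_mul hx hy)
  · have hM : M ≤ Subalgebra.toSubmodule (Algebra.adjoin ℚ (M : Set A)) := Algebra.subset_adjoin
    induction k with
    | zero => rw [pow_zero]; exact Submodule.one_le.mpr (Subalgebra.one_mem _)
    | succ k ih =>
      rw [pow_succ]
      exact (mul_le_mul' ih hM).trans (Submodule.mul_le.mpr fun _ h _ h' => Subalgebra.mul_mem _ h h')

theorem homog_adjoin {M : Submodule ℚ A} (hM : Homog M) :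
    Homog (Subalgebra.toSubmodule (Algebra.adjoin ℚ (M : Set A))) := by
  rw [toSubmodule_adjoin_eq]
  exact Homog.iSup fun k => hM.pow k

theorem MinimalSullivan.adjoin_eq_top (S : MinimalSullivan A) :
    Algebra.adjoin ℚ (S.W : Set A) = ⊤ := by
  let R := Algebra.adjoin ℚ (S.W : Set A)
  let _ : GCDGA R := subGCDGA R (homog_adjoin S.homog_W) 0 (fun _ _ => R.zero_mem) (fun _ => rfl)
    (fun _ _ _ => Submodule.zero_mem _) (fun a b => by simp)
  obtain ⟨g, ⟨hg, hgV⟩, -⟩ := S.free R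
    (fun n => LinearMap.codRestrict (Subalgebra.toSubmodule R) (S.V n).subtype
      fun v => Algebra.subset_adjoin (S.V_le_W n v.2)) (fun n v => S.V_le n v.2)
  have hid : R.val.comp g = AlgHom.id ℚ A :=
    S.algHom_eq_id (fun i a ha => hg i a ha) fun n v hv => by
      rw [AlgHom.comp_apply, hgV n ⟨v, hv⟩]; rfl
  refine eq_top_iff.mpr fun a _ => ?_
  have := congrArg (fun f : A →ₐ[ℚ] A => f a) hid
  change ((g a : R) : A) = a at this
  rw [← this]
  exact (g a).2

theorem MinimalSullivan.iSup_pow_W (S : MinimalSullivan A) : ⨆ k, S.W ^ k = ⊤ := by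
  rw [← toSubmodule_adjoin_eq, S.adjoin_eq_top, Algebra.top_toSubmodule]

theorem MinimalSullivan.pow_W_le (S : MinimalSullivan A) (k : ℕ) : S.W ^ k ≤ S.lam k := by
  induction k with
  | zero => rw [pow_zero, S.lam_zero]
  | succ k ih =>
    rw [pow_succ]
    exact (mul_le_mul' ih S.lam_one.ge).trans (S.lam_mul k 1)

theorem MinimalSullivan.lam_eq (S : MinimalSullivan A) (k : ℕ) : S.lam k = S.W ^ k := by
  refine le_antisymm (fun x hx => ?_) (S.pow_W_le k)
  let inst := S.lam_internal.chooseDecomposition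
  have h : ∀ y : A, (DirectSum.decompose S.lam y k : A) ∈ S.W ^ k := by
    intro y
    have hy : y ∈ ⨆ k, S.W ^ k := by rw [S.iSup_pow_W]; trivial
    refine Submodule.iSup_induction _ (motive := fun y => (DirectSum.decompose S.lam y k : A) ∈ S.W ^ k)
      hy (fun j z hz => ?_) ?_ fun a b ha hb => ?_
    · by_cases hj : j = k
      · subst hj
        rwa [DirectSum.decompose_of_mem_same S.lam (S.pow_W_le j hz)]
      · rw [DirectSum.decompose_of_mem_ne S.lam (S.pow_W_le j hz) hj]
        exact Submodule.zero_mem _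
    · rw [DirectSum.decompose_zero]; exact Submodule.zero_mem _
    · rw [DirectSum.decompose_add]; exact Submodule.add_mem _ ha hb
  rw [← DirectSum.decompose_of_mem_same S.lam hx]
  exact h x

theorem MinimalSullivan.iSup_lam (S : MinimalSullivan A) (n : ℕ) :
    ⨆ k, ⨆ (_ : n < k), S.lam k = fil S.W (n + 1) := by
  apply le_antisymm
  · refine iSup₂_le fun k hk => ?_
    rw [S.lam_eq]
    exact (le_idl _).trans (fil_anti _ hk)
  · rw [fil, idl, ← S.iSup_pow_W, Submodule.iSup_mul]
    refine iSup_le fun i => ?_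
    rw [← pow_add, ← S.lam_eq]
    exact le_iSup₂_of_le (i + (n + 1)) (by omega) le_rfl

theorem MinimalSullivan.pr_of_mem_W (S : MinimalSullivan A) {n : ℕ} (hn : n < 2) {x : A}
    (hx : x ∈ S.W) : pr A n x = 0 := by
  refine Submodule.iSup_induction _ (motive := fun x => pr A n x = 0) hx (fun m v hv => ?_)
    (map_zero _) fun a b ha hb => by rw [map_add, ha, hb, add_zero]
  by_cases hm : m < 2
  · have : v = 0 := by
      interval_cases m
      · rwa [S.V0, Submodule.mem_bot] at hv
      · rwa [S.V1, Submodule.mem_bot] at hv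
    rw [this, map_zero]
  · exact pr_of_ne (S.V_le m hv) (by omega)

theorem MinimalSullivan.one_sup_idl (S : MinimalSullivan A) : 1 ⊔ idl S.W = ⊤ := by
  rw [eq_top_iff, ← S.iSup_pow_W]
  refine iSup_le fun k => ?_
  cases k with
  | zero => rw [pow_zero]; exact le_sup_left
  | succ k =>
    refine le_sup_of_le_right ?_
    rw [← fil_one]
    exact (le_idl _).trans (fil_anti _ (by omega))

theorem Gr.pr_zero_mul (a b : A) : pr A 0 (a * b) = pr A 0 a * pr A 0 b := by
  refine homog_induction (p := fun a => pr A 0 (a * b) = pr A 0 a * pr A 0 b) (by simp)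
    (fun a a' h h' => by simp only [add_mul, map_add, h, h']) (fun n a ha => ?_) a
  refine homog_induction (p := fun b => pr A 0 (a * b) = pr A 0 a * pr A 0 b) (by simp)
    (fun a a' h h' => by simp only [mul_add, map_add, h, h']) (fun m b hb => ?_) b
  by_cases hn : n = 0
  · subst hn
    by_cases hm : m = 0
    · subst hm
      rw [pr_of_mem (mul_mem_Gr ha hb), pr_of_mem ha, pr_of_mem hb]
    · rw [pr_of_ne (mul_mem_Gr ha hb) (by omega), pr_of_ne hb hm, mul_zero]
  · rw [pr_of_ne (mul_mem_Gr ha hb) (by omega), pr_of_ne ha hn, zero_mul]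

theorem MinimalSullivan.pr_zero_idl (S : MinimalSullivan A) {x : A} (hx : x ∈ idl S.W) :
    pr A 0 x = 0 := by
  induction hx using Submodule.mul_induction_on' with
  | mem_mul_mem a _ v hv => rw [Gr.pr_zero_mul, S.pr_of_mem_W (by omega) hv, mul_zero]
  | add x _ y _ hx hy => rw [map_add, hx, hy, add_zero]

theorem MinimalSullivan.Gr_zero (S : MinimalSullivan A) : Gr A 0 ≤ 1 := by
  intro a ha
  have h : a ∈ (1 : Submodule ℚ A) ⊔ idl S.W := by rw [S.one_sup_idl]; trivial
  obtain ⟨c, hc, x, hx, rfl⟩ := Submodule.mem_sup.mp h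
  have hc' : c ∈ Gr A 0 := (Submodule.one_le.mpr one_mem_Gr) hc
  rw [← pr_of_mem ha, map_add, S.pr_zero_idl hx, add_zero, pr_of_mem hc']
  exact hc

theorem MinimalSullivan.Gr_le_idl (S : MinimalSullivan A) {n : ℕ} (hn : n ≠ 0) :
    Gr A n ≤ idl S.W := by
  intro a ha
  have h : a ∈ (1 : Submodule ℚ A) ⊔ idl S.W := by rw [S.one_sup_idl]; trivial
  obtain ⟨c, hc, x, hx, rfl⟩ := Submodule.mem_sup.mp h
  have hc' : c ∈ Gr A 0 := (Submodule.one_le.mpr one_mem_Gr) hc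
  rw [← pr_of_mem ha, map_add, pr_of_ne hc' (Ne.symm hn), zero_add]
  exact S.homog_W.idl x hx n

theorem MinimalSullivan.Dd_W (S : MinimalSullivan A) : ∀ x ∈ S.W, Dd A x ∈ fil S.W 2 := by
  intro x hx
  refine Submodule.iSup_induction _ (motive := fun x => Dd A x ∈ fil S.W 2) hx (fun n v hv => ?_)
    (by simp) fun a b ha hb => by rw [map_add]; exact Submodule.add_mem _ ha hb
  rw [← S.iSup_lam 1]
  exact S.minimal n v hv

end Generation

section Generators

variable {A : Type} [GCDGA A]

/-- A finite system of homogeneous generators, ordered by degree, with the corresponding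
partial derivatives. -/
structure Gens (A : Type) [GCDGA A] where
  N : ℕ
  v : ℕ → A
  g : ℕ → ℕ
  D : ℕ → A →ₗ[ℚ] A
  v_mem : ∀ i < N, v i ∈ Gr A (g i)
  two_le : ∀ i < N, 2 ≤ g i
  mono : ∀ i j, i ≤ j → j < N → g i ≤ g j
  der : ∀ i < N, IsTwistedDer (g i) (D i)
  D_mem : ∀ i < N, ∀ n, ∀ a ∈ Gr A n, D i a ∈ Gr A (n - g i)
  D_eq_zero : ∀ i < N, ∀ n, ∀ a ∈ Gr A n, n < g i → D i a = 0
  D_self : ∀ i < N, D i (v i) = 1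
  D_ne : ∀ i < N, ∀ j < N, i ≠ j → D i (v j) = 0
  Gr_pos : ∀ n ≠ 0, Gr A n ≤ idl (Submodule.span ℚ (v '' Set.Iio N))
  Dd_v : ∀ i < N, Dd A (v i) ∈ fil (Submodule.span ℚ (v '' Set.Iio N)) 2

theorem span_pr_mem {ι : Type} {v : ι → A} {g : ι → ℕ} (hv : ∀ i, v i ∈ Gr A (g i)) (n : ℕ) {x : A}
    (hx : x ∈ Submodule.span ℚ (Set.range v)) :
    pr A n x ∈ Submodule.span ℚ (v '' {i | g i = n}) := by
  induction hx using Submodule.span_induction with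
  | mem x hx =>
    obtain ⟨i, rfl⟩ := hx
    by_cases h : g i = n
    · subst h
      rw [pr_of_mem (hv i)]
      exact Submodule.subset_span ⟨i, rfl, rfl⟩
    · rw [pr_of_ne (hv i) h]; exact Submodule.zero_mem _
  | zero => rw [map_zero]; exact Submodule.zero_mem _
  | add x y _ _ hx hy => rw [map_add]; exact Submodule.add_mem _ hx hy
  | smul c x _ hx => rw [map_smul]; exact Submodule.smul_mem _ _ hx

theorem MinimalSullivan.exists_basis (S : MinimalSullivan A) [FiniteDimensional ℚ S.W] :
    ∃ (N : ℕ) (v : Fin N → A) (g : Fin N → ℕ), LinearIndependent ℚ v ∧ Monotone g ∧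
      (∀ i, v i ∈ S.V (g i)) ∧ Submodule.span ℚ (Set.range v) = S.W := by
  obtain ⟨b, hb, hspan, hli⟩ := exists_linearIndependent ℚ (⋃ n, (S.V n : Set A))
  rw [Submodule.span_iUnion] at hspan
  simp only [Submodule.span_eq] at hspan
  have hfin : Finite b := by
    have hbW : ∀ x : b, (x : A) ∈ S.W := fun x => by
      rw [MinimalSullivan.W, ← hspan]
      exact Submodule.subset_span x.2
    have : LinearIndependent ℚ (fun x : b => (⟨x, hbW x⟩ : S.W)) :=
      LinearIndependent.of_comp S.W.subtype hli
    exact this.finite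
  have hdeg : ∀ x : b, ∃ n, (x : A) ∈ S.V n := fun x => Set.mem_iUnion.mp (hb x.2)
  choose deg hdeg using hdeg
  obtain ⟨N, ⟨e⟩⟩ := Finite.exists_equiv_fin b
  let σ := Tuple.sort (deg ∘ e.symm)
  refine ⟨N, fun i => (e.symm (σ i) : A), deg ∘ e.symm ∘ σ, ?_,
    Tuple.monotone_sort (deg ∘ e.symm),
    fun i => hdeg _, ?_⟩
  · exact hli.comp (e.symm ∘ σ) (e.symm.injective.comp σ.injective)
  · rw [MinimalSullivan.W, ← hspan]
    congr 1
    ext x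
    constructor
    · rintro ⟨i, rfl⟩
      exact (e.symm (σ i)).2
    · intro hx
      exact ⟨σ.symm (e ⟨x, hx⟩), by simp⟩

theorem MinimalSullivan.exists_derivation (S : MinimalSullivan A) (s : ℕ) (ξ : A →ₗ[ℚ] ℚ) :
    ∃ D : A →ₗ[ℚ] A, IsTwistedDer s D ∧ (∀ n, ∀ a ∈ Gr A n, D a ∈ Gr A (n - s)) ∧
      (∀ n, ∀ a ∈ Gr A n, n < s → D a = 0) ∧
      ∀ n, ∀ v ∈ S.V n, D v = ξ (pr A s v) • (1 : A) := by
  obtain ⟨f, ⟨hf, hfV⟩, -⟩ := S.free (TwDual A s)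
    (fun n => (LinearMap.prod LinearMap.id ((LinearMap.toSpanSingleton ℚ A 1) ∘ₗ ξ ∘ₗ pr A s)) ∘ₗ
      (S.V n).subtype) (fun n v => by
      refine TwDual.mem_gr.mpr ⟨S.V_le n v.2, fun h => ?_, ?_⟩
      · by_contra hs
        refine h ?_
        change ξ (pr A s v) • (1 : A) = 0
        rw [pr_of_ne (S.V_le n v.2) (by omega : n ≠ s), map_zero, zero_smul]
      · by_cases hs : n = s
        · subst hs
          rw [Nat.sub_self]
          exact Submodule.smul_mem _ _ one_mem_Gr
        · change ξ (pr A s v) • (1 : A) ∈ _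
          rw [pr_of_ne (S.V_le n v.2) hs, map_zero, zero_smul]
          exact Submodule.zero_mem _)
  have hf1 : ∀ a, (f a).1 = a := by
    let p : TwDual A s →ₐ[ℚ] A := AlgHom.ofLinearMap (LinearMap.fst ℚ A A) rfl fun _ _ => rfl
    have h : p.comp f = AlgHom.id ℚ A := S.algHom_eq_id
      (fun i a ha => (TwDual.mem_gr.mp (hf i a ha)).1) fun n v hv => by
        rw [AlgHom.comp_apply, hfV n ⟨v, hv⟩]; rfl
    exact fun a => congrArg (fun q : A →ₐ[ℚ] A => q a) h
  refine ⟨LinearMap.snd ℚ A A ∘ₗ f.toLinearMap, fun a b => ?_, fun n a ha => ?_,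
    fun n a ha hn => ?_, fun n v hv => ?_⟩
  · change (f (a * b)).2 = (f a).2 * b + sgn A s a * (f b).2
    rw [map_mul, TwDual.mul_snd, hf1, hf1]
  · exact (TwDual.mem_gr.mp (hf n a ha)).2.2
  · by_contra h
    have := (TwDual.mem_gr.mp (hf n a ha)).2.1 h
    omega
  · change (f v).2 = _
    rw [hfV n ⟨v, hv⟩]; rfl

theorem finrank_span_image {N : ℕ} {v : Fin N → A} (hv : LinearIndependent ℚ v) (p : ℕ → Prop)
    [DecidablePred p] (g : Fin N → ℕ) (g' : ℕ → ℕ) (hg : ∀ i : Fin N, g' i = g i) :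
    Module.finrank ℚ (Submodule.span ℚ (v '' {i | p (g i)})) =
      ((Finset.Ico 0 N).filter fun i => p (g' i)).card := by
  have h := finrank_span_eq_card (hv.comp (Subtype.val : {i // p (g i)} → Fin N)
    Subtype.val_injective)
  rw [Set.range_comp, Subtype.range_val_subtype] at h
  rw [h, Fintype.card_subtype]
  refine Finset.card_bij (fun i _ => (i : ℕ)) (fun i hi => ?_) (fun i _ j _ h => Fin.ext h)
    fun j hj => ?_
  · simpa [hg] using hi
  · simp only [Finset.mem_filter, Finset.mem_Ico] at hj
    exact ⟨⟨j, hj.1.2⟩, by simpa [← hg] using hj.2, rfl⟩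

theorem MinimalSullivan.iSup_V_eq (S : MinimalSullivan A) {N : ℕ} {v : Fin N → A} {g : Fin N → ℕ}
    (hv : ∀ i, v i ∈ S.V (g i)) (hspan : Submodule.span ℚ (Set.range v) = S.W)
    (q : ℕ → ℕ) (p : ℕ → Prop) (hpq : ∀ n, p n ↔ ∃ m, q m = n) :
    ⨆ n, S.V (q n) = Submodule.span ℚ (v '' {i | p (g i)}) := by
  apply le_antisymm
  · refine iSup_le fun n x hx => ?_
    have h := span_pr_mem (fun i => S.V_le _ (hv i)) (q n)
      (by rw [hspan]; exact S.V_le_W _ hx : x ∈ Submodule.span ℚ (Set.range v))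
    rw [pr_of_mem (S.V_le _ hx)] at h
    refine Submodule.span_mono (Set.image_mono fun i hi => ?_) h
    exact (hpq _).mpr ⟨n, hi.symm⟩
  · rw [Submodule.span_le]
    rintro _ ⟨i, hi, rfl⟩
    obtain ⟨m, hm⟩ := (hpq _).mp hi
    exact Submodule.mem_iSup_of_mem m (hm ▸ hv i)

theorem MinimalSullivan.exists_gens (S : MinimalSullivan A) [FiniteDimensional ℚ S.W]
    (hchi : S.chiPi = 0) : ∃ G : Gens A, Submodule.span ℚ (G.v '' Set.Iio G.N) = S.W ∧
      ((Finset.Ico 0 G.N).filter fun i => Even (G.g i)).card =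
        ((Finset.Ico 0 G.N).filter fun i => Odd (G.g i)).card := by
  obtain ⟨N, v, g, hli, hmono, hv, hspan⟩ := S.exists_basis
  have hD : ∀ i : Fin N, ∃ D : A →ₗ[ℚ] A, IsTwistedDer (g i) D ∧
      (∀ n, ∀ a ∈ Gr A n, D a ∈ Gr A (n - g i)) ∧ (∀ n, ∀ a ∈ Gr A n, n < g i → D a = 0) ∧
      ∀ j, D (v j) = if i = j then 1 else 0 := by
    intro i
    obtain ⟨ξ, hξ⟩ := LinearMap.exists_extend hli.repr
    obtain ⟨D, h1, h2, h3, h4⟩ := S.exists_derivation (g i) (Finsupp.lapply i ∘ₗ ξ)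
    refine ⟨D, h1, h2, h3, fun j => ?_⟩
    rw [h4 _ _ (hv j)]
    by_cases hij : g j = g i
    · rw [← hij, pr_of_mem (S.V_le _ (hv j))]
      have hj : ξ (v j) = hli.repr ⟨v j, Submodule.subset_span ⟨j, rfl⟩⟩ :=
        congrArg (fun q : Submodule.span ℚ (Set.range v) →ₗ[ℚ] (Fin N →₀ ℚ) =>
          q ⟨v j, Submodule.subset_span ⟨j, rfl⟩⟩) hξ
      rw [LinearMap.comp_apply, hj, hli.repr_eq_single j _ rfl]
      by_cases h : i = j
      · subst h; simp
      · simp [h]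
    · rw [pr_of_ne (S.V_le _ (hv j)) hij, if_neg (fun h => hij (by rw [h])), map_zero, zero_smul]
  choose D hD1 hD2 hD3 hD4 using hD
  have himg : (fun i => if h : i < N then v ⟨i, h⟩ else 0) '' Set.Iio N = Set.range v := by
    ext x
    constructor
    · rintro ⟨i, hi : i < N, rfl⟩
      exact ⟨⟨i, hi⟩, by simp [hi]⟩
    · rintro ⟨i, rfl⟩
      exact ⟨i, i.2, by simp⟩
  have hg2 : ∀ i, 2 ≤ g i := fun i => by
    by_contra h
    have h1 := S.pr_of_mem_W (by omega : g i < 2) (S.V_le_W _ (hv i))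
    rw [pr_of_mem (S.V_le _ (hv i))] at h1
    exact hli.ne_zero i h1
  refine ⟨{ N := N
            v := fun i => if h : i < N then v ⟨i, h⟩ else 0
            g := fun i => if h : i < N then g ⟨i, h⟩ else 0
            D := fun i => if h : i < N then D ⟨i, h⟩ else 0
            v_mem := ?_
            two_le := ?_
            mono := ?_
            der := ?_
            D_mem := ?_
            D_eq_zero := ?_
            D_self := ?_
            D_ne := ?_
            Gr_pos := ?_
            Dd_v := ?_ }, ?_, ?_⟩
  · intro i hi; simp only [dif_pos hi]; exact S.V_le _ (hv _)
  · intro i hi; simp only [dif_pos hi]; exact hg2 _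
  · intro i j hij hj; simp only [dif_pos hj, dif_pos (hij.trans_lt hj)]; exact hmono hij
  · intro i hi; simp only [dif_pos hi]; exact hD1 _
  · intro i hi; simp only [dif_pos hi]; exact hD2 _
  · intro i hi; simp only [dif_pos hi]; exact hD3 _
  · intro i hi; simp only [dif_pos hi]; rw [hD4, if_pos rfl]
  · intro i hi j hj hij; simp only [dif_pos hi, dif_pos hj]; rw [hD4, if_neg (by simpa using hij)]
  · intro n hn; rw [himg, hspan]; exact S.Gr_le_idl hn
  · intro i hi; rw [himg, hspan]; simp only [dif_pos hi]; exact S.Dd_W _ (S.V_le_W _ (hv _))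
  · exact (congrArg _ himg).trans hspan
  · have he := S.iSup_V_eq hv hspan (fun n => 2 * n) Even fun n => by
      rw [even_iff_exists_two_mul]; exact ⟨fun ⟨m, h⟩ => ⟨m, h.symm⟩, fun ⟨m, h⟩ => ⟨m, h.symm⟩⟩
    have ho := S.iSup_V_eq hv hspan (fun n => 2 * n + 1) Odd fun n =>
      ⟨fun ⟨m, h⟩ => ⟨m, h.symm⟩, fun ⟨m, h⟩ => ⟨m, h.symm⟩⟩
    rw [MinimalSullivan.chiPi, MinimalSullivan.Veven, MinimalSullivan.Vodd, he, ho,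
      finrank_span_image hli Even g (fun i => if h : i < N then g ⟨i, h⟩ else 0) (by simp),
      finrank_span_image hli Odd g (fun i => if h : i < N then g ⟨i, h⟩ else 0) (by simp)] at hchi
    exact_mod_cast sub_eq_zero.mp hchi

end Generators

section PartialDerivatives

variable {A : Type} [GCDGA A]

theorem mul_eq_mul_sgn {s : ℕ} {x : A} (hx : x ∈ Gr A s) (a : A) : a * x = x * sgn A s a := by
  refine homog_induction (p := fun a => a * x = x * sgn A s a) (by simp)
    (fun a b ha hb => by rw [add_mul, ha, hb, map_add, mul_add]) (fun n a ha => ?_) a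
  rw [gr_comm ha hx, sgn_of_mem s ha, mul_smul_comm, mul_comm n s]

theorem sgn_of_even {s : ℕ} (hs : Even s) (a : A) : sgn A s a = a := by
  refine homog_induction (p := fun a => sgn A s a = a) (by simp)
    (fun a b ha hb => by rw [map_add, ha, hb]) (fun n a ha => ?_) a
  rw [sgn_of_mem s ha, (hs.mul_right n).neg_one_pow, one_smul]

theorem pr_mul_left {s : ℕ} {x : A} (hx : x ∈ Gr A s) (n : ℕ) (a : A) :
    pr A (s + n) (x * a) = x * pr A n a := by
  refine homog_induction (p := fun a => pr A (s + n) (x * a) = x * pr A n a) (by simp)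
    (fun a b ha hb => by simp only [mul_add, map_add, ha, hb]) (fun m a ha => ?_) a
  by_cases h : m = n
  · subst h
    rw [pr_of_mem (mul_mem_Gr hx ha), pr_of_mem ha]
  · rw [pr_of_ne (mul_mem_Gr hx ha) (by omega), pr_of_ne ha h, mul_zero]

theorem pr_mul_left_of_lt {s n : ℕ} {x : A} (hx : x ∈ Gr A s) (hn : n < s) (a : A) :
    pr A n (x * a) = 0 := by
  refine homog_induction (p := fun a => pr A n (x * a) = 0) (by simp)
    (fun a b ha hb => by simp only [mul_add, map_add, ha, hb, add_zero]) (fun m a ha => ?_) a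
  exact pr_of_ne (mul_mem_Gr hx ha) (by omega)

theorem pow_mem_Gr {s : ℕ} {x : A} (hx : x ∈ Gr A s) (m : ℕ) : x ^ m ∈ Gr A (m * s) := by
  induction m with
  | zero => rw [pow_zero, zero_mul]; exact one_mem_Gr
  | succ m ih => rw [pow_succ, add_mul, one_mul]; exact mul_mem_Gr ih hx

theorem Homog.mem_of_pr {M : Submodule ℚ A} {x : A} (h : ∀ n, pr A n x ∈ M) : x ∈ M := by
  obtain ⟨s, hs⟩ := sum_pr x
  rw [hs]
  exact Submodule.sum_mem _ fun n _ => h n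

theorem IsTwistedDer.idl {s : ℕ} {D : A →ₗ[ℚ] A} (hD : IsTwistedDer s D) {M : Submodule ℚ A}
    (h : ∀ m ∈ M, D m ∈ RHT.idl M) : ∀ x ∈ RHT.idl M, D x ∈ RHT.idl M := by
  intro x hx
  induction hx using Submodule.mul_induction_on' with
  | mem_mul_mem b _ m hm =>
    rw [hD]
    exact Submodule.add_mem _ (idl_mul_left _ (le_idl _ hm)) (idl_mul_left _ (h m hm))
  | add x _ y _ hx hy => rw [map_add]; exact Submodule.add_mem _ hx hy

theorem IsTwistedDer.pow {s : ℕ} (hs : Even s) {D : A →ₗ[ℚ] A} (hD : IsTwistedDer s D) {x : A}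
    (h1 : D x = 1) (m : ℕ) :
    D (x ^ (m + 1)) = ((m + 1 : ℕ) : ℚ) • x ^ m := by
  induction m with
  | zero => simp [h1]
  | succ m ih =>
    rw [pow_succ, hD, ih, h1, sgn_of_even hs, smul_mul_assoc, ← pow_succ, mul_one]
    push_cast
    module

namespace Gens

variable (G : Gens A)

/-- The ideal generated by the first `i` generators. -/
def J (i : ℕ) : Submodule ℚ A := idl (Submodule.span ℚ (G.v '' Set.Iio i))

variable {G} {i : ℕ}

theorem homog_span (hi : i ≤ G.N) : Homog (Submodule.span ℚ (G.v '' Set.Iio i)) :=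
  Homog.of_le <| by rintro _ ⟨j, hj, rfl⟩; exact ⟨_, G.v_mem j (lt_of_lt_of_le hj hi)⟩

theorem homog_J (hi : i ≤ G.N) : Homog (G.J i) := (homog_span hi).idl

theorem J_mul_left (a : A) {x : A} (hx : x ∈ G.J i) : a * x ∈ G.J i := idl_mul_left a hx

theorem J_mul_right (hi : i ≤ G.N) {x : A} (hx : x ∈ G.J i) (a : A) : x * a ∈ G.J i :=
  (homog_span hi).idl_mul_right hx a

theorem J_mono {i j : ℕ} (h : i ≤ j) : G.J i ≤ G.J j :=
  idl_mono (Submodule.span_mono (Set.image_mono (Set.Iio_subset_Iio h)))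

theorem v_mem_J {j : ℕ} (h : j < i) : G.v j ∈ G.J i := le_idl _ (Submodule.subset_span ⟨j, h, rfl⟩)

theorem J_zero : G.J 0 = ⊥ := by
  simp [J, idl]

theorem Gr_le_J {n : ℕ} (hn : n ≠ 0) : Gr A n ≤ G.J G.N := G.Gr_pos n hn

theorem mem_J_succ (hi : i < G.N) {x : A} (hx : x ∈ G.J (i + 1)) :
    ∃ b, x - G.v i * b ∈ G.J i := by
  induction hx using Submodule.mul_induction_on' with
  | mem_mul_mem a _ m hm =>
    induction hm using Submodule.span_induction with
    | mem m hm =>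
      obtain ⟨j, hj, rfl⟩ := hm
      rcases Nat.lt_succ_iff_lt_or_eq.mp hj with h | rfl
      · exact ⟨0, by rw [mul_zero, sub_zero]; exact J_mul_left _ (v_mem_J h)⟩
      · exact ⟨sgn A (G.g j) a, by rw [mul_eq_mul_sgn (G.v_mem j hi), sub_self]; simp⟩
    | zero => exact ⟨0, by simp⟩
    | add x y _ _ hx hy =>
      obtain ⟨b, hb⟩ := hx
      obtain ⟨c, hc⟩ := hy
      exact ⟨b + c, by convert Submodule.add_mem _ hb hc using 1; rw [mul_add, mul_add]; abel⟩
    | smul q x _ hx =>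
      obtain ⟨b, hb⟩ := hx
      exact ⟨q • b, by
        convert Submodule.smul_mem _ q hb using 1
        rw [smul_sub, mul_smul_comm, mul_smul_comm]⟩
  | add x _ y _ hx hy =>
    obtain ⟨b, hb⟩ := hx
    obtain ⟨c, hc⟩ := hy
    exact ⟨b + c, by convert Submodule.add_mem _ hb hc using 1; rw [mul_add]; abel⟩

theorem v_mul_mem_J (hi : i < G.N) (a : A) : G.v i * a ∈ G.J (i + 1) :=
  J_mul_right hi (v_mem_J (Nat.lt_succ_self i)) a

theorem pr_mem_J_of_fil_two (hi : i < G.N) {x : A}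
    (hx : x ∈ fil (Submodule.span ℚ (G.v '' Set.Iio G.N)) 2) : pr A (G.g i + 1) x ∈ G.J i := by
  rw [fil, idl, pow_two] at hx
  have hlin : ∀ a : A, ∀ w ∈ Submodule.span ℚ (G.v '' Set.Iio G.N),
      ∀ w' ∈ Submodule.span ℚ (G.v '' Set.Iio G.N),
      pr A (G.g i + 1) (a * (w * w')) ∈ G.J i := by
    intro a w hw w' hw'
    induction hw using Submodule.span_induction with
    | mem w hw =>
      induction hw' using Submodule.span_induction with
      | mem w' hw' =>
        obtain ⟨k, hk, rfl⟩ := hw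
        obtain ⟨l, hl, rfl⟩ := hw'
        by_cases h : k < i
        · exact homog_J hi.le _ (J_mul_left _ (J_mul_right hi.le (v_mem_J h) _)) _
        · by_cases h' : l < i
          · exact homog_J hi.le _ (J_mul_left _ (J_mul_left _ (v_mem_J h'))) _
          · have hkl := mul_mem_Gr (G.v_mem k hk) (G.v_mem l hl)
            rw [mul_eq_mul_sgn hkl, pr_mul_left_of_lt hkl]
            · exact Submodule.zero_mem _
            · have h1 := G.mono i k (by omega) hk
              have h2 := G.mono i l (by omega) hl
              have h3 := G.two_le i hi
              omega
      | zero => simp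
      | add x y _ _ hx hy => rw [mul_add, mul_add, map_add]; exact Submodule.add_mem _ hx hy
      | smul q x _ hx =>
        rw [mul_smul_comm, mul_smul_comm, map_smul]; exact Submodule.smul_mem _ _ hx
    | zero => simp
    | add x y _ _ hx hy =>
      rw [add_mul, mul_add, map_add]; exact Submodule.add_mem _ hx hy
    | smul q x _ hx =>
      rw [smul_mul_assoc, mul_smul_comm, map_smul]; exact Submodule.smul_mem _ _ hx
  induction hx using Submodule.mul_induction_on' with
  | mem_mul_mem a _ w hw =>
    induction hw using Submodule.mul_induction_on' with
    | mem_mul_mem w hw w' hw' => exact hlin a w hw w' hw'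
    | add x _ y _ hx hy => rw [mul_add, map_add]; exact Submodule.add_mem _ hx hy
  | add x _ y _ hx hy => rw [map_add]; exact Submodule.add_mem _ hx hy

theorem Dd_v_mem_J (hi : i < G.N) : Dd A (G.v i) ∈ G.J i := by
  rw [← pr_of_mem (Dd_mem (G.v_mem i hi))]
  exact pr_mem_J_of_fil_two hi (G.Dd_v i hi)

theorem Dd_mem_J (hi : i ≤ G.N) {x : A} (hx : x ∈ G.J i) : Dd A x ∈ G.J i := by
  refine isTwistedDer_Dd.idl (fun m hm => ?_) x hx
  induction hm using Submodule.span_induction with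
  | mem m hm =>
    obtain ⟨j, hj, rfl⟩ := hm
    exact J_mono (le_of_lt hj) (Dd_v_mem_J (lt_of_lt_of_le hj hi))
  | zero => simp
  | add x y _ _ hx hy => rw [map_add]; exact Submodule.add_mem _ hx hy
  | smul q x _ hx => rw [map_smul]; exact Submodule.smul_mem _ _ hx

theorem D_mem_J (hi : i < G.N) {x : A} (hx : x ∈ G.J i) : G.D i x ∈ G.J i := by
  refine (G.der i hi).idl (fun m hm => ?_) x hx
  induction hm using Submodule.span_induction with
  | mem m hm =>
    obtain ⟨j, hj, rfl⟩ := hm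
    rw [G.D_ne i hi j (lt_trans hj hi) (ne_of_gt hj)]
    exact Submodule.zero_mem _
  | zero => simp
  | add x y _ _ hx hy => rw [map_add]; exact Submodule.add_mem _ hx hy
  | smul q x _ hx => rw [map_smul]; exact Submodule.smul_mem _ _ hx

theorem mem_J_of_pow_mul (hi : i < G.N) (he : Even (G.g i)) {n : ℕ} :
    ∀ {a : A}, a ∈ Gr A n → ∀ m, G.v i ^ m * a ∈ G.J i → a ∈ G.J i := by
  induction n using Nat.strong_induction_on with
  | _ n ih =>
    intro a ha m
    induction m with
    | zero => intro h; simpa using h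
    | succ m ihm =>
      intro h
      have hD : G.D i a ∈ G.J i := by
        by_cases hn : n < G.g i
        · rw [G.D_eq_zero i hi n a ha hn]; exact Submodule.zero_mem _
        · have h2 := G.two_le i hi
          refine ih (n - G.g i) (by omega) (G.D_mem i hi n a ha) (m + 2) ?_
          have h' := J_mul_left (G.v i) (D_mem_J hi h)
          rw [G.der i hi, (G.der i hi).pow he (G.D_self i hi), sgn_of_even he,
            mul_add, smul_mul_assoc, mul_smul_comm, ← mul_assoc, ← pow_succ', ← mul_assoc,
            ← pow_succ'] at h'
          exact (Submodule.add_mem_iff_right _ (Submodule.smul_mem _ _ h)).mp h'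
      have h' := D_mem_J hi h
      rw [G.der i hi, (G.der i hi).pow he (G.D_self i hi), sgn_of_even he,
        smul_mul_assoc] at h'
      have h3 := (Submodule.add_mem_iff_left _ (J_mul_left _ hD)).mp h'
      refine ihm ((Submodule.smul_mem_iff _ ?_).mp h3)
      exact_mod_cast Nat.succ_ne_zero m

theorem mem_J_of_even_mul (hi : i < G.N) (he : Even (G.g i)) {a : A}
    (h : G.v i * a ∈ G.J i) : a ∈ G.J i := by
  refine Homog.mem_of_pr fun n => mem_J_of_pow_mul hi he (pr_mem n a) 1 ?_
  rw [pow_one, ← pr_mul_left (G.v_mem i hi)]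
  exact homog_J hi.le _ h _

theorem D_odd_mul (hi : i < G.N) (ho : Odd (G.g i)) (a : A) :
    G.D i (G.v i * a) = a - G.v i * G.D i a := by
  rw [G.der i hi, G.D_self i hi, sgn_of_mem _ (G.v_mem i hi), (ho.mul ho).neg_one_pow]
  simp [sub_eq_add_neg]

theorem mem_J_of_odd_mul (hi : i < G.N) (ho : Odd (G.g i)) {a : A}
    (h : G.v i * a ∈ G.J i) : a ∈ G.J (i + 1) := by
  have h' := D_mem_J hi h
  rw [D_odd_mul hi ho] at h'
  rw [← sub_add_cancel a (G.v i * G.D i a)]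
  exact Submodule.add_mem _ (J_mono (Nat.le_succ i) h') (v_mul_mem_J hi _)

theorem sub_mem_J_of_odd (hi : i < G.N) (ho : Odd (G.g i)) {a : A} (h : a ∈ G.J (i + 1)) :
    a - G.v i * G.D i a ∈ G.J i := by
  obtain ⟨b, hb⟩ := mem_J_succ hi h
  have h' := Submodule.sub_mem _ hb (J_mul_left (G.v i) (D_mem_J hi hb))
  convert h' using 1
  rw [map_sub, D_odd_mul hi ho, mul_sub, mul_sub, ← mul_assoc (G.v i) (G.v i),
    odd_mul_self (G.v_mem i hi) ho]
  simp

theorem exists_integral (hi : i < G.N) (he : Even (G.g i)) {F : Submodule ℚ A}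
    (hF : ∀ a, ∀ x ∈ F, a * x ∈ F) (hFD : ∀ x ∈ F, G.D i x ∈ F) {n : ℕ} :
    ∀ {b : A}, b ∈ F → b ∈ Gr A n → ∀ m, ∃ w ∈ F, G.D i (G.v i ^ (m + 1) * w) = G.v i ^ m * b := by
  induction n using Nat.strong_induction_on with
  | _ n ih =>
    intro b hb hbn m
    obtain ⟨w, hw, hw'⟩ : ∃ w ∈ F, G.D i (G.v i ^ (m + 2) * w) = G.v i ^ (m + 1) * G.D i b := by
      by_cases hn : n < G.g i
      · exact ⟨0, F.zero_mem, by rw [G.D_eq_zero i hi n b hbn hn]; simp⟩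
      · have h2 := G.two_le i hi
        exact ih (n - G.g i) (by omega) (hFD b hb) (G.D_mem i hi n b hbn) (m + 1)
    have hm : ((m + 1 : ℕ) : ℚ) ≠ 0 := by exact_mod_cast Nat.succ_ne_zero m
    refine ⟨((m + 1 : ℕ) : ℚ)⁻¹ • (b - G.v i * w),
      F.smul_mem _ (F.sub_mem hb (hF _ _ hw)), ?_⟩
    rw [mul_smul_comm, map_smul, mul_sub, map_sub, ← mul_assoc, ← pow_succ, hw', G.der i hi,
      (G.der i hi).pow he (G.D_self i hi), sgn_of_even he, add_sub_cancel_right,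
      smul_mul_assoc, smul_smul, inv_mul_cancel₀ hm, one_smul]

theorem pr_D (hi : i < G.N) (n : ℕ) (a : A) : pr A n (G.D i a) = G.D i (pr A (n + G.g i) a) := by
  refine homog_induction (p := fun a => pr A n (G.D i a) = G.D i (pr A (n + G.g i) a)) (by simp)
    (fun a b ha hb => by simp only [map_add, ha, hb]) (fun m a ha => ?_) a
  by_cases h : m = n + G.g i
  · rw [← h, pr_of_mem ha]
    have h' := G.D_mem i hi m a ha
    rw [h, Nat.add_sub_cancel] at h'
    exact pr_of_mem h'
  · rw [pr_of_ne ha h, map_zero]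
    by_cases hm : m < G.g i
    · rw [G.D_eq_zero i hi m a ha hm, map_zero]
    · exact pr_of_ne (G.D_mem i hi m a ha) (by omega)

theorem mem_J_of_D_eq_zero_of_mem (hi : i < G.N) (he : Even (G.g i)) {n : ℕ} {a : A}
    (ha : a ∈ Gr A n) (haJ : a ∈ G.J (i + 1)) (hD : G.D i a = 0) : a ∈ G.J i := by
  have h : ∀ m, ∃ c, a - G.v i ^ (m + 1) * c ∈ G.J i := by
    intro m
    induction m with
    | zero => simpa using mem_J_succ hi haJ
    | succ m ih =>
      obtain ⟨c, hc⟩ := ih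
      have h1 := J_mul_left (G.v i) (D_mem_J hi hc)
      rw [map_sub, hD, zero_sub, G.der i hi,
        (G.der i hi).pow he (G.D_self i hi), sgn_of_even he, mul_neg, mul_add,
        smul_mul_assoc, mul_smul_comm, ← mul_assoc, ← pow_succ', ← mul_assoc,
        ← pow_succ'] at h1
      have hm : ((m + 1 : ℕ) : ℚ) ≠ 0 := by exact_mod_cast Nat.succ_ne_zero m
      refine ⟨-(((m + 1 : ℕ) : ℚ)⁻¹ • G.D i c), ?_⟩
      convert Submodule.sub_mem _ hc (Submodule.smul_mem _ ((m + 1 : ℕ) : ℚ)⁻¹ h1) using 1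
      rw [smul_neg, smul_add, smul_smul, inv_mul_cancel₀ hm, one_smul, mul_neg, mul_smul_comm]
      abel
  obtain ⟨c, hc⟩ := h n
  have h2 := homog_J hi.le _ hc n
  rwa [map_sub, pr_of_mem ha, pr_mul_left_of_lt (pow_mem_Gr (G.v_mem i hi) (n + 1)), sub_zero] at h2
  have := G.two_le i hi
  nlinarith

theorem mem_J_of_D_eq_zero (hi : i < G.N) (he : Even (G.g i)) {a : A}
    (haJ : a ∈ G.J (i + 1)) (hD : G.D i a = 0) : a ∈ G.J i := by
  refine Homog.mem_of_pr fun n =>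
    mem_J_of_D_eq_zero_of_mem hi he (pr_mem n a) (homog_J hi _ haJ n) ?_
  by_cases hn : n < G.g i
  · exact G.D_eq_zero i hi n _ (pr_mem n a) hn
  · rw [← Nat.sub_add_cancel (not_lt.mp hn), ← pr_D hi, hD, map_zero]

theorem exists_sub_even_mul_mem_J (hi : i < G.N) (he : Even (G.g i)) {F : Submodule ℚ A}
    (hFh : Homog F) (hF : ∀ a, ∀ x ∈ F, a * x ∈ F) (hFD : ∀ x ∈ F, G.D i x ∈ F) {a : A}
    (ha : a ∈ F) (haJ : a ∈ G.J (i + 1)) : ∃ w ∈ F, a - G.v i * w ∈ G.J i := by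
  have hinf : Homog (F ⊓ G.J (i + 1)) := fun x hx n => ⟨hFh x hx.1 n, homog_J hi x hx.2 n⟩
  refine hinf.induction (p := fun a => ∃ w ∈ F, a - G.v i * w ∈ G.J i) ⟨0, F.zero_mem, by simp⟩
    ?_ ?_ ⟨ha, haJ⟩
  · rintro a b ⟨w, hw, hw'⟩ ⟨u, hu, hu'⟩
    refine ⟨w + u, F.add_mem hw hu, ?_⟩
    convert Submodule.add_mem _ hw' hu' using 1
    rw [mul_add]; abel
  · rintro n a ⟨ha, haJ⟩ han
    obtain ⟨w, hw, hw'⟩ := exists_integral hi he hF hFD (hFD a ha) (G.D_mem i hi n a han) 0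
    rw [zero_add, pow_one, pow_zero, one_mul] at hw'
    refine ⟨w, hw, mem_J_of_D_eq_zero hi he (Submodule.sub_mem _ haJ (v_mul_mem_J hi w)) ?_⟩
    rw [map_sub, hw', sub_self]

end Gens

end PartialDerivatives

section Exactness

variable {A : Type} [GCDGA A]

theorem exists_degree_bound {R : Submodule ℚ A} (hR : R.FG) :
    ∃ K, ∀ n ≥ K, ∀ x ∈ R, pr A n x = 0 := by
  refine Submodule.fg_induction (motive := fun R _ => ∃ K, ∀ n ≥ K, ∀ x ∈ R, pr A n x = 0)
    (fun a => ?_) (fun M N _ _ ⟨K, hK⟩ ⟨L, hL⟩ => ⟨max K L, fun n hn x hx => ?_⟩) R hR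
  · obtain ⟨s, hs⟩ := sum_pr a
    refine ⟨s.sup id + 1, fun n hn x hx => ?_⟩
    obtain ⟨c, rfl⟩ := Submodule.mem_span_singleton.mp hx
    rw [map_smul, hs, map_sum, Finset.sum_eq_zero, smul_zero]
    intro m hm
    have : m ≤ s.sup id := Finset.le_sup (f := id) hm
    exact pr_of_ne (pr_mem m a) (by omega)
  · obtain ⟨y, hy, z, hz, rfl⟩ := Submodule.mem_sup.mp hx
    rw [map_add, hK n (le_trans (le_max_left _ _) hn) y hy,
      hL n (le_trans (le_max_right _ _) hn) z hz, add_zero]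

theorem exists_exact_bound [FiniteDimensional ℚ (CohClasses A)] :
    ∃ K, ∀ n ≥ K, ∀ z ∈ Gr A n, Dd A z = 0 → ∃ w, z = Dd A w := by
  let q : LinearMap.ker (Dd A) →ₗ[ℚ] CohClasses A := Submodule.mkQ _
  obtain ⟨σ, hσ⟩ := q.exists_rightInverse_of_surjective
    (LinearMap.range_eq_top.mpr (Submodule.mkQ_surjective _))
  obtain ⟨K, hK⟩ := exists_degree_bound (A := A)
    (R := LinearMap.range ((LinearMap.ker (Dd A)).subtype ∘ₗ σ))
    ((Module.Finite.iff_fg).mp inferInstance)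
  refine ⟨K + 1, fun n hn z hz hd => ?_⟩
  have h : (⟨z, hd⟩ : LinearMap.ker (Dd A)) - σ (q ⟨z, hd⟩) ∈ LinearMap.ker q := by
    rw [LinearMap.mem_ker, map_sub, sub_eq_zero]
    exact (congrArg (fun f : CohClasses A →ₗ[ℚ] CohClasses A => f (q ⟨z, hd⟩)) hσ).symm
  rw [show LinearMap.ker q = _ from Submodule.ker_mkQ _] at h
  obtain ⟨w, hw⟩ := h
  obtain ⟨m, rfl⟩ : ∃ m, n = m + 1 := ⟨n - 1, by omega⟩
  refine ⟨pr A m w, ?_⟩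
  rw [Dd_pr, hw]
  change z = pr A (m + 1) (z - (σ (q ⟨z, hd⟩) : A))
  have h0 : pr A (m + 1) (σ (q ⟨z, hd⟩) : A) = 0 := hK (m + 1) (by omega) _ ⟨q ⟨z, hd⟩, rfl⟩
  rw [map_sub, h0, sub_zero, pr_of_mem hz]

/-- The span of the homogeneous elements of degree at least `n`. -/
def degGE (A : Type) [GCDGA A] (n : ℕ) : Submodule ℚ A := ⨆ k, Gr A (n + k)

theorem degGE_mul (m n : ℕ) : degGE A m * degGE A n ≤ degGE A (m + n) := by
  rw [degGE, Submodule.iSup_mul]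
  refine iSup_le fun k => ?_
  rw [degGE, Submodule.mul_iSup]
  refine iSup_le fun l => Submodule.mul_le.mpr fun a ha b hb => ?_
  refine Submodule.mem_iSup_of_mem (k + l) ?_
  rw [show m + n + (k + l) = m + k + (n + l) by omega]
  exact mul_mem_Gr ha hb

theorem Gr_le_degGE {m n : ℕ} (h : n ≤ m) : Gr A m ≤ degGE A n := by
  obtain ⟨k, rfl⟩ := Nat.exists_eq_add_of_le h
  exact le_iSup (fun k => Gr A (n + k)) k

theorem pr_of_mem_degGE {n k : ℕ} (hk : k < n) {x : A} (hx : x ∈ degGE A n) : pr A k x = 0 :=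
  Submodule.iSup_induction _ (motive := fun x => pr A k x = 0) hx
    (fun l _ h => pr_of_ne h (by omega)) (map_zero _)
    fun a b ha hb => by rw [map_add, ha, hb, add_zero]

theorem degGE_zero : degGE A 0 = ⊤ :=
  eq_top_iff.mpr fun a _ => homog_induction (p := fun a => a ∈ degGE A 0) (Submodule.zero_mem _)
    (fun _ _ => Submodule.add_mem _) (fun n _ ha => Gr_le_degGE (Nat.zero_le n) ha) a

theorem fil_le_degGE {M : Submodule ℚ A} (hM : M ≤ degGE A 1) (k : ℕ) : fil M k ≤ degGE A k := by
  have h : M ^ k ≤ degGE A k := by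
    induction k with
    | zero => rw [degGE_zero]; exact le_top
    | succ k ih => rw [pow_succ]; exact (mul_le_mul' ih hM).trans (degGE_mul k 1)
  rw [fil, idl, ← degGE_zero]
  exact (mul_le_mul' le_rfl h).trans (by simpa using degGE_mul (A := A) 0 k)

/-- The odd part. -/
def oddPart (A : Type) [GCDGA A] : Submodule ℚ A := ⨆ n, Gr A (2 * n + 1)

theorem homog_oddPart : Homog (oddPart A) := Homog.iSup fun _ => Homog.Gr _

theorem Gr_le_oddPart {n : ℕ} (hn : Odd n) : Gr A n ≤ oddPart A := by
  obtain ⟨m, rfl⟩ := hn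
  exact le_iSup (fun n => Gr A (2 * n + 1)) m

namespace Gens

variable {G : Gens A} {i : ℕ}

theorem span_le_degGE : Submodule.span ℚ (G.v '' Set.Iio G.N) ≤ degGE A 1 := by
  rw [Submodule.span_le]
  rintro _ ⟨j, hj, rfl⟩
  exact Gr_le_degGE (by have := G.two_le j hj; omega) (G.v_mem j hj)

theorem Dd_mem_J_top (a : A) : Dd A a ∈ G.J G.N := by
  refine Homog.mem_of_pr fun n => ?_
  cases n with
  | zero => rw [pr_zero_Dd]; exact Submodule.zero_mem _
  | succ n => exact Gr_le_J (Nat.succ_ne_zero n) (pr_mem _ _)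

theorem Dd_mem_fil_succ {k : ℕ} {x : A} (hx : x ∈ fil (Submodule.span ℚ (G.v '' Set.Iio G.N)) k) :
    Dd A x ∈ fil (Submodule.span ℚ (G.v '' Set.Iio G.N)) (k + 1) := by
  refine isTwistedDer_Dd.fil_shift (homog_span le_rfl) 1 (fun a => ?_) (fun m hm => ?_) k x hx
  · rw [fil_one]; exact Dd_mem_J_top a
  · induction hm using Submodule.span_induction with
    | mem m hm => obtain ⟨j, hj, rfl⟩ := hm; exact G.Dd_v j hj
    | zero => simp
    | add x y _ _ hx hy => rw [map_add]; exact Submodule.add_mem _ hx hy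
    | smul q x _ hx => rw [map_smul]; exact Submodule.smul_mem _ _ hx

theorem exists_Gr_le_fil (G : Gens A) (L : ℕ) :
    ∃ K, ∀ n ≥ K, Gr A n ≤ fil (Submodule.span ℚ (G.v '' Set.Iio G.N)) L := by
  let C := (Finset.range G.N).sup G.g
  have hC : ∀ j < G.N, G.g j ≤ C := fun j hj => Finset.le_sup (Finset.mem_range.mpr hj)
  induction L with
  | zero => exact ⟨0, fun n _ => by rw [fil_zero]; exact le_top⟩
  | succ L ih =>
    obtain ⟨K, hK⟩ := ih
    refine ⟨K + C + 1, fun n hn a ha => ?_⟩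
    have h : ∀ x ∈ idl (Submodule.span ℚ (G.v '' Set.Iio G.N)),
        pr A n x ∈ fil (Submodule.span ℚ (G.v '' Set.Iio G.N)) (L + 1) := by
      intro x hx
      induction hx using Submodule.mul_induction_on' with
      | mem_mul_mem b _ m hm =>
        induction hm using Submodule.span_induction with
        | mem m hm =>
          obtain ⟨j, hj, rfl⟩ := hm
          have hj' := hC j hj
          obtain ⟨k, hk⟩ := Nat.exists_eq_add_of_le (by omega : G.g j ≤ n)
          rw [mul_eq_mul_sgn (G.v_mem j hj), hk, pr_mul_left (G.v_mem j hj), add_comm L]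
          exact (homog_span le_rfl).fil_mul_mem (le_fil_one _ (Submodule.subset_span ⟨j, hj, rfl⟩))
            (hK k (by omega) (pr_mem _ _))
        | zero => simp
        | add x y _ _ hx hy => rw [mul_add, map_add]; exact Submodule.add_mem _ hx hy
        | smul q x _ hx => rw [mul_smul_comm, map_smul]; exact Submodule.smul_mem _ _ hx
      | add x _ y _ hx hy => rw [map_add]; exact Submodule.add_mem _ hx hy
    rw [← pr_of_mem ha]
    exact h a (G.Gr_pos n (by omega) ha)

theorem Dd_v_mul_mem (hi : i < G.N) (a : A) : Dd A (G.v i) * a ∈ G.J i :=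
  J_mul_right hi.le (Dd_v_mem_J hi) a

theorem Dd_even_mul (hi : i < G.N) (he : Even (G.g i)) (a : A) :
    Dd A (G.v i * a) = Dd A (G.v i) * a + G.v i * Dd A a := by
  rw [Dd_mul, sgn_of_mem 1 (G.v_mem i hi), one_mul, he.neg_one_pow, one_smul]

theorem Dd_odd_mul {n : ℕ} {x : A} (hx : x ∈ Gr A n) (ho : Odd n) (a : A) :
    Dd A (x * a) = Dd A x * a - x * Dd A a := by
  rw [Dd_mul, sgn_of_mem 1 hx, one_mul, ho.neg_one_pow]
  simp [sub_eq_add_neg]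

theorem odd_mul_mem_J (hi : i < G.N) (ho : Odd (G.g i)) {a : A} (ha : a ∈ G.J (i + 1)) :
    G.v i * a ∈ G.J i := by
  have h := J_mul_left (G.v i) (sub_mem_J_of_odd hi ho ha)
  rwa [mul_sub, ← mul_assoc, odd_mul_self (G.v_mem i hi) ho, zero_mul, sub_zero] at h

/-- Relative cocycles modulo the first `i` generators are relatively exact in high degrees. -/
def EventuallyExact (G : Gens A) (i : ℕ) : Prop :=
  ∃ K, ∀ n ≥ K, ∀ z ∈ Gr A n, Dd A z ∈ G.J i → ∃ w, z - Dd A w ∈ G.J i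

theorem exists_of_correction (hi : i < G.N) {K : ℕ}
    (hK : ∀ n ≥ K, ∀ z ∈ Gr A n, Dd A z ∈ G.J i → ∃ w, z - Dd A w ∈ G.J i) {n : ℕ} (hn : K ≤ n)
    {z c : A} (hz : z ∈ Gr A n) (hc : c ∈ G.J (i + 1)) (hd : Dd A (z - c) ∈ G.J i) :
    ∃ w, z - Dd A w ∈ G.J (i + 1) := by
  obtain ⟨w, hw⟩ := hK n hn (pr A n (z - c)) (pr_mem _ _)
    (by rw [Dd_pr]; exact homog_J hi.le _ hd _)
  refine ⟨w, ?_⟩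
  have := Submodule.add_mem _ (homog_J hi _ hc n) (J_mono (Nat.le_succ i) hw)
  convert this using 1
  rw [map_sub, pr_of_mem hz]
  abel

theorem EventuallyExact.succ (hi : i < G.N) (h : G.EventuallyExact i) :
    G.EventuallyExact (i + 1) := by
  obtain ⟨K, hK⟩ := h
  have h2 := G.two_le i hi
  rcases Nat.even_or_odd (G.g i) with he | ho
  · refine ⟨K + G.g i, fun n hn z hz hd => ?_⟩
    obtain ⟨b, hb⟩ := mem_J_succ hi hd
    obtain ⟨k, hk⟩ := Nat.exists_eq_add_of_le (by omega : G.g i ≤ n + 1)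
    have hb' := homog_J hi.le _ hb (n + 1)
    rw [map_sub, pr_of_mem (Dd_mem hz), hk, pr_mul_left (G.v_mem i hi)] at hb'
    have hdb : Dd A (pr A k b) ∈ G.J i := by
      have h' := Dd_mem_J hi.le hb'
      rw [map_sub, Dd_Dd, zero_sub, Submodule.neg_mem_iff, Dd_even_mul hi he] at h'
      exact mem_J_of_even_mul hi he ((Submodule.add_mem_iff_right _ (Dd_v_mul_mem hi _)).mp h')
    obtain ⟨w, hw⟩ := hK k (by omega) _ (pr_mem k b) hdb
    refine exists_of_correction hi hK (by omega) hz (v_mul_mem_J hi w) ?_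
    have h' := Submodule.sub_mem _ (Submodule.add_mem _ hb' (J_mul_left (G.v i) hw))
      (Dd_v_mul_mem hi w)
    convert h' using 1
    rw [map_sub, Dd_even_mul hi he, mul_sub]
    abel
  · let L := K + G.g i + 1
    obtain ⟨K', hK'⟩ := G.exists_Gr_le_fil L
    have key : ∀ n, ∀ z ∈ Gr A n, z ∈ fil (Submodule.span ℚ (G.v '' Set.Iio G.N)) L →
        Dd A z ∈ G.J (i + 1) → ∃ w, z - Dd A w ∈ G.J (i + 1) := by
      intro n
      induction n using Nat.strong_induction_on with
      | _ n ih =>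
        intro z hz hzL hd
        by_cases hn : n < L
        · refine ⟨0, ?_⟩
          rw [← pr_of_mem hz, pr_of_mem_degGE hn (fil_le_degGE span_le_degGE L hzL)]
          simp
        · have hz1 := sub_mem_J_of_odd hi ho hd
          have hdz1 : Dd A (G.D i (Dd A z)) ∈ G.J (i + 1) := by
            have h' := Dd_mem_J hi.le hz1
            rw [map_sub, Dd_Dd, zero_sub, Submodule.neg_mem_iff, Dd_odd_mul (G.v_mem i hi) ho,
              sub_eq_add_neg, Submodule.add_mem_iff_right _ (Dd_v_mul_mem hi _),
              Submodule.neg_mem_iff] at h'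
            exact mem_J_of_odd_mul hi ho h'
          obtain ⟨w, hw⟩ := ih (n + 1 - G.g i) (by omega) _ (G.D_mem i hi _ _ (Dd_mem hz))
            ((G.der i hi).fil_pred (homog_span le_rfl) L _ (Dd_mem_fil_succ hzL)) hdz1
          refine exists_of_correction hi hK (by omega) hz (c := - (G.v i * w))
            (Submodule.neg_mem _ (v_mul_mem_J hi w)) ?_
          have h' := Submodule.add_mem _ (Submodule.add_mem _ hz1 (odd_mul_mem_J hi ho hw))
            (Dd_v_mul_mem hi w)
          convert h' using 1
          rw [sub_neg_eq_add, map_add, Dd_odd_mul (G.v_mem i hi) ho, mul_sub]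
          abel
    exact ⟨K', fun n hn z hz => key n z hz (hK' n hn hz)⟩

theorem eventuallyExact [FiniteDimensional ℚ (CohClasses A)] (hi : i ≤ G.N) :
    G.EventuallyExact i := by
  induction i with
  | zero =>
    obtain ⟨K, hK⟩ := exists_exact_bound (A := A)
    refine ⟨K, fun n hn z hz hd => ?_⟩
    rw [J_zero, Submodule.mem_bot] at hd
    obtain ⟨w, hw⟩ := hK n hn z hz hd
    exact ⟨w, by rw [← hw, sub_self]; exact Submodule.zero_mem _⟩
  | succ i ih => exact (ih (by omega)).succ hi

end Gens

end Exactness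

section Formality

variable {A : Type} [GCDGA A]

theorem exists_homog_primitive {P : Submodule ℚ A} (hP : Homog P) {n : ℕ} {x w : A}
    (hx : x ∈ Gr A (n + 1)) (h : x - Dd A w ∈ P) : x - Dd A (pr A n w) ∈ P := by
  have := hP _ h (n + 1)
  rwa [map_sub, pr_of_mem hx, ← Dd_pr] at this

namespace Gens

variable {G : Gens A} {i : ℕ}

theorem D_mem_oddPart (hi : i < G.N) (he : Even (G.g i)) {x : A} (hx : x ∈ oddPart A) :
    G.D i x ∈ oddPart A := by
  refine Submodule.iSup_induction _ (motive := fun x => G.D i x ∈ oddPart A) hx (fun n x hx => ?_)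
    (by simp) fun a b ha hb => by rw [map_add]; exact Submodule.add_mem _ ha hb
  by_cases h : 2 * n + 1 < G.g i
  · rw [G.D_eq_zero i hi _ x hx h]; exact Submodule.zero_mem _
  · exact Gr_le_oddPart (Nat.Odd.sub_even (not_lt.mp h) ⟨n, by omega⟩ he) (G.D_mem i hi _ x hx)

theorem D_mem_fil_oddPart (hi : i < G.N) (he : Even (G.g i)) (k : ℕ) {x : A}
    (hx : x ∈ fil (oddPart A) k) : G.D i x ∈ fil (oddPart A) k :=
  (G.der i hi).fil_shift homog_oddPart 0 (fun _ => by rw [fil_zero]; trivial)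
    (fun _ hm => le_fil_one _ (D_mem_oddPart hi he hm)) k x hx

/-- Relative cocycles modulo the first `i` generators lying in the `k`-th power of the ideal
generated by the odd part bound in the `k+1`-st power. -/
def RelExact (G : Gens A) (i k : ℕ) : Prop :=
  ∀ z ∈ fil (oddPart A) k, Dd A z ∈ G.J i → ∃ w ∈ fil (oddPart A) (k + 1), z - Dd A w ∈ G.J i

theorem Dd_pow_mem_J (hi : i < G.N) (m : ℕ) : Dd A (G.v i ^ m) ∈ G.J i := by
  induction m with
  | zero => rw [pow_zero, Dd_one]; exact Submodule.zero_mem _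
  | succ m ih =>
    rw [pow_succ', Dd_mul]
    exact Submodule.add_mem _ (Dd_v_mul_mem hi _) (J_mul_left _ ih)

theorem exists_pow_sub_mem_J (hi : i < G.N) (he : Even (G.g i)) (hE : G.EventuallyExact i) :
    ∃ m s, Odd s ∧ ∃ Φ ∈ Gr A s, G.v i ^ m - Dd A Φ ∈ G.J i := by
  obtain ⟨K, hK⟩ := hE
  have h2 := G.two_le i hi
  have hle : K + 1 ≤ (K + 1) * G.g i := by nlinarith
  have hdeg : (K + 1) * G.g i - 1 + 1 = (K + 1) * G.g i := by omega
  have hx := pow_mem_Gr (G.v_mem i hi) (K + 1)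
  obtain ⟨w, hw⟩ := hK _ (by omega) _ hx (Dd_pow_mem_J hi _)
  refine ⟨K + 1, (K + 1) * G.g i - 1, ?_, _, pr_mem _ w,
    exists_homog_primitive (homog_J hi.le) (by rwa [hdeg]) hw⟩
  rw [← Nat.not_even_iff_odd]
  have := Nat.even_add_one.mp (hdeg ▸ he.mul_left (K + 1))
  exact this

theorem RelExact.even (hi : i < G.N) (he : Even (G.g i)) (hE : G.EventuallyExact i) {k : ℕ}
    (h : G.RelExact (i + 1) (k + 1)) : G.RelExact i k := by
  intro z hz hdz
  obtain ⟨m, s, hs, Φ, hΦ, hm⟩ := exists_pow_sub_mem_J hi he hE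
  have hstart : ∃ w ∈ fil (oddPart A) (k + 1), G.v i ^ m * z - Dd A w ∈ G.J i := by
    refine ⟨Φ * z, ?_, ?_⟩
    · rw [add_comm]
      exact homog_oddPart.fil_mul_mem (le_fil_one _ (Gr_le_oddPart hs hΦ)) hz
    · convert Submodule.add_mem _ (J_mul_right hi.le hm z) (J_mul_left Φ hdz) using 1
      rw [Dd_odd_mul hΦ hs, sub_mul]
      abel
  have hdown : ∀ j, (∃ w ∈ fil (oddPart A) (k + 1), G.v i ^ j * z - Dd A w ∈ G.J i) →
      ∃ w ∈ fil (oddPart A) (k + 1), z - Dd A w ∈ G.J i := by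
    intro j
    induction j with
    | zero => intro h; simpa using h
    | succ j ih =>
      rintro ⟨w, hw, hwJ⟩
      rw [pow_succ', mul_assoc] at hwJ
      have hdw : Dd A w ∈ G.J (i + 1) := by
        rw [← sub_sub_cancel (G.v i * (G.v i ^ j * z)) (Dd A w)]
        exact Submodule.sub_mem _ (v_mul_mem_J hi _) (J_mono (Nat.le_succ i) hwJ)
      obtain ⟨u, hu, huJ⟩ := h w hw hdw
      obtain ⟨w', hw', hwJ'⟩ := exists_sub_even_mul_mem_J hi he (homog_oddPart.fil (k + 1))
        (fun a x hx => fil_mul_left a hx) (fun x hx => D_mem_fil_oddPart hi he _ hx)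
        (Submodule.sub_mem _ hw (isTwistedDer_Dd.fil_pred homog_oddPart _ u hu)) huJ
      refine ih ⟨w', hw', mem_J_of_even_mul hi he ?_⟩
      convert Submodule.add_mem _ (Submodule.add_mem _ hwJ (Dd_mem_J hi.le hwJ'))
        (Dd_v_mul_mem hi w') using 1
      rw [map_sub, map_sub, Dd_Dd, Dd_even_mul hi he, mul_sub]
      abel
  exact hdown m hstart

theorem RelExact.odd (hi : i < G.N) (ho : Odd (G.g i)) {k : ℕ} (h : G.RelExact (i + 1) k)
    (h' : G.RelExact (i + 1) (k - 1)) : G.RelExact i k := by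
  intro z hz hdz
  obtain ⟨u, hu, huJ⟩ := h z hz (J_mono (Nat.le_succ i) hdz)
  have ha := Submodule.sub_mem _ hz (isTwistedDer_Dd.fil_pred homog_oddPart _ u hu)
  have hD : G.D i (z - Dd A u) ∈ fil (oddPart A) (k - 1) := by
    cases k with
    | zero => rw [fil_zero]; trivial
    | succ k => exact (G.der i hi).fil_pred homog_oddPart k _ ha
  have hJ := sub_mem_J_of_odd hi ho huJ
  have hdD : Dd A (G.D i (z - Dd A u)) ∈ G.J (i + 1) := by
    refine mem_J_of_odd_mul hi ho ?_
    convert Submodule.add_mem _ (Submodule.sub_mem _ (Dd_mem_J hi.le hJ) hdz)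
      (Dd_v_mul_mem hi (G.D i (z - Dd A u))) using 1
    rw [map_sub (Dd A) (z - Dd A u), map_sub (Dd A) z, Dd_Dd, Dd_odd_mul (G.v_mem i hi) ho]
    abel
  obtain ⟨u', hu', huJ'⟩ := h' _ hD hdD
  refine ⟨u - G.v i * u', Submodule.sub_mem _ hu (fil_anti _ (by omega : k + 1 ≤ 1 + (k - 1 + 1))
    (homog_oddPart.fil_mul_mem (le_fil_one _ (Gr_le_oddPart ho (G.v_mem i hi))) hu')), ?_⟩
  convert Submodule.add_mem _ (Submodule.add_mem _ hJ (odd_mul_mem_J hi ho huJ'))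
    (Dd_v_mul_mem hi u') using 1
  rw [map_sub, Dd_odd_mul (G.v_mem i hi) ho, mul_sub]
  abel

theorem relExact (hE : ∀ i ≤ G.N, G.EventuallyExact i) (j : ℕ) : ∀ i k, i + j = G.N →
    ((Finset.Ico i G.N).filter fun l => Odd (G.g l)).card <
      k + ((Finset.Ico i G.N).filter fun l => Even (G.g l)).card → G.RelExact i k := by
  induction j with
  | zero =>
    intro i k hij hk z hz _
    obtain rfl : i = G.N := hij
    obtain ⟨k, rfl⟩ : ∃ l, k = l + 1 := ⟨k - 1, by simp at hk; omega⟩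
    refine ⟨0, Submodule.zero_mem _, ?_⟩
    rw [map_zero, sub_zero]
    have hz' := fil_anti _ (Nat.le_add_left 1 k) hz
    rw [fil_one] at hz'
    refine idl_le (fun a x hx => J_mul_left a hx) (iSup_le fun n => Gr_le_J (by omega)) hz'
  | succ j ih =>
    intro i k hij hk
    have hi : i < G.N := by omega
    rw [← Finset.insert_Ico_add_one_left_eq_Ico hi, Finset.filter_insert, Finset.filter_insert] at hk
    rcases Nat.even_or_odd (G.g i) with he | ho
    · rw [if_neg (Nat.not_odd_iff_even.mpr he), if_pos he,
        Finset.card_insert_of_notMem (by simp)] at hk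
      exact RelExact.even hi he (hE i hi.le) (ih (i + 1) (k + 1) (by omega) (by omega))
    · rw [if_pos ho, if_neg (Nat.not_even_iff_odd.mpr ho),
        Finset.card_insert_of_notMem (by simp)] at hk
      exact RelExact.odd hi ho (ih (i + 1) k (by omega) (by omega))
        (ih (i + 1) (k - 1) (by omega) (by omega))

end Gens

/-- The differential ideal generated by the odd part. -/
def oddIdeal (A : Type) [GCDGA A] : Submodule ℚ A := idl (oddPart A ⊔ (oddPart A).map (Dd A))

theorem homog_oddPart_sup : Homog (oddPart A ⊔ (oddPart A).map (Dd A)) :=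
  homog_oddPart.sup homog_oddPart.mapDd

theorem isDGIdeal_oddIdeal : IsDGIdeal (oddIdeal A) where
  homog := homog_oddPart_sup.idl
  mul_left a _ hx := idl_mul_left a hx
  mul_right a _ hx := homog_oddPart_sup.idl_mul_right hx a
  d_mem := isTwistedDer_Dd.idl fun m hm => by
    obtain ⟨y, hy, _, ⟨z, _, rfl⟩, rfl⟩ := Submodule.mem_sup.mp hm
    rw [map_add, Dd_Dd, add_zero]
    exact le_idl _ (Submodule.mem_sup_right ⟨y, hy, rfl⟩)

theorem exists_add_of_mem_oddIdeal {x : A} (hx : x ∈ oddIdeal A) :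
    ∃ y ∈ fil (oddPart A) 1, ∃ t, x = y + Dd A t := by
  induction hx using Submodule.mul_induction_on' with
  | mem_mul_mem a _ m hm =>
    obtain ⟨y, hy, _, ⟨z, hz, rfl⟩, rfl⟩ := Submodule.mem_sup.mp hm
    refine ⟨a * y - Dd A (sgn A 1 a) * z, Submodule.sub_mem _ (fil_mul_left _ (le_fil_one _ hy))
      (fil_mul_left _ (le_fil_one _ hz)), sgn A 1 a * z, ?_⟩
    rw [Dd_mul, sgn_sgn, mul_add]
    abel
  | add x _ y _ hx hy =>
    obtain ⟨x, hx, t, rfl⟩ := hx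
    obtain ⟨y, hy, u, rfl⟩ := hy
    exact ⟨x + y, Submodule.add_mem _ hx hy, t + u, by rw [map_add]; abel⟩

theorem exists_sub_closed (h : ∀ z ∈ fil (oddPart A) 1, Dd A z = 0 →
    ∃ w ∈ fil (oddPart A) 1, z = Dd A w) (a : A) : ∃ b, Dd A b = 0 ∧ a - b ∈ oddIdeal A := by
  refine homog_induction (p := fun a => ∃ b, Dd A b = 0 ∧ a - b ∈ oddIdeal A)
    ⟨0, map_zero _, by simp⟩ ?_ (fun n a ha => ?_) a
  · rintro a a' ⟨b, hb, hab⟩ ⟨b', hb', hab'⟩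
    refine ⟨b + b', by rw [map_add, hb, hb', add_zero], ?_⟩
    convert Submodule.add_mem _ hab hab' using 1
    abel
  · rcases Nat.even_or_odd n with he | ho
    · obtain ⟨w, hw, hw'⟩ := h _ (le_fil_one _ (Gr_le_oddPart he.add_one (Dd_mem ha))) (Dd_Dd a)
      refine ⟨a - w, by rw [map_sub, hw', sub_self], ?_⟩
      rw [sub_sub_cancel]
      rw [fil_one] at hw
      exact idl_mono le_sup_left hw
    · exact ⟨0, map_zero _, by
        rw [sub_zero]; exact le_idl _ (Submodule.mem_sup_left (Gr_le_oddPart ho ha))⟩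

/-- A surjective quasi-isomorphism onto an evenly graded algebra with zero differential. -/
structure IsEvenFormalization {T K : Type} [GCDGA T] [GCDGA K] (φ : T →ₐ[ℚ] K) : Prop where
  dga : IsDGAHom φ
  surj : Function.Surjective φ
  quasi : QuasiIso φ
  Dd_eq_zero : ∀ x, Dd K x = 0
  odd : ∀ n, Odd n → Gr K n = ⊥

theorem isEvenFormalization_proj (h : ∀ z ∈ fil (oddPart A) 1, Dd A z = 0 →
    ∃ w ∈ fil (oddPart A) 1, z = Dd A w) :
    IsEvenFormalization (isDGIdeal_oddIdeal (A := A)).proj := by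
  have hd : ∀ x, Dd (isDGIdeal_oddIdeal (A := A)).Quo x = 0 := by
    intro x
    obtain ⟨a, rfl⟩ := isDGIdeal_oddIdeal.proj_surjective x
    obtain ⟨b, hb, hab⟩ := exists_sub_closed h a
    rw [← isDGIdeal_oddIdeal.proj_dga.1, isDGIdeal_oddIdeal.proj_eq_zero]
    have := isDGIdeal_oddIdeal.d_mem _ hab
    rwa [map_sub, hb, sub_zero] at this
  refine ⟨isDGIdeal_oddIdeal.proj_dga, isDGIdeal_oddIdeal.proj_surjective, ⟨fun x _ => ?_, ?_⟩, hd, ?_⟩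
  · obtain ⟨a, rfl⟩ := isDGIdeal_oddIdeal.proj_surjective x
    obtain ⟨b, hb, hab⟩ := exists_sub_closed h a
    refine ⟨b, hb, 0, ?_⟩
    rw [map_zero, ← map_sub, isDGIdeal_oddIdeal.proj_eq_zero, ← neg_sub]
    exact Submodule.neg_mem _ hab
  · rintro a ha ⟨c, hc⟩
    rw [hd, isDGIdeal_oddIdeal.proj_eq_zero] at hc
    obtain ⟨y, hy, t, rfl⟩ := exists_add_of_mem_oddIdeal hc
    rw [map_add, Dd_Dd, add_zero] at ha
    obtain ⟨w, _, rfl⟩ := h y hy ha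
    exact ⟨w + t, (map_add _ _ _).symm⟩
  · intro n hn
    rw [eq_bot_iff]
    rintro _ ⟨a, ha, rfl⟩
    exact isDGIdeal_oddIdeal.proj_eq_zero.mpr
      (le_idl _ (Submodule.mem_sup_left (Gr_le_oddPart hn ha)))

theorem exists_isEvenFormalization (S : MinimalSullivan A) (hell : Elliptic A S)
    (hchi : S.chiPi = 0) :
    ∃ (K : Type) (_ : GCDGA K) (φ : A →ₐ[ℚ] K), IsEvenFormalization φ := by
  have hW : FiniteDimensional ℚ S.W := hell.1
  have := hell.2
  obtain ⟨G, _, hG⟩ := S.exists_gens hchi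
  refine ⟨_, _, _, isEvenFormalization_proj fun z hz hdz => ?_⟩
  obtain ⟨w, hw, hzw⟩ := Gens.relExact (G := G) (fun i hi => Gens.eventuallyExact hi) G.N 0 1 (by omega)
    (by omega) z hz (by rw [hdz]; exact Submodule.zero_mem _)
  rw [Gens.J_zero, Submodule.mem_bot, sub_eq_zero] at hzw
  exact ⟨w, fil_anti _ (by omega) hw, hzw⟩

end Formality

/-! ### Even formalizations of tensor products -/

section EvenAlgebra

variable {K : Type} [GCDGA K]

theorem mul_comm_of_odd_eq_bot (hK : ∀ n, Odd n → Gr K n = ⊥) (x y : K) : x * y = y * x := by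
  refine homog_induction (p := fun x => x * y = y * x) (by simp)
    (fun a b ha hb => by rw [add_mul, mul_add, ha, hb]) (fun n a ha => ?_) x
  rcases Nat.even_or_odd n with hn | hn
  · exact even_commute ha hn y
  · rw [hK n hn, Submodule.mem_bot] at ha
    simp [ha]

theorem sgn_of_odd_eq_bot (hK : ∀ n, Odd n → Gr K n = ⊥) (x : K) : sgn K 1 x = x := by
  refine homog_induction (p := fun x => sgn K 1 x = x) (by simp)
    (fun a b ha hb => by rw [map_add, ha, hb]) (fun n a ha => ?_) x
  rcases Nat.even_or_odd n with hn | hn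
  · rw [sgn_of_mem 1 ha, one_mul, hn.neg_one_pow, one_smul]
  · rw [hK n hn, Submodule.mem_bot] at ha
    simp [ha]

end EvenAlgebra

section Contraction

open scoped TensorProduct

variable {T K T' K' : Type} [GCDGA T] [GCDGA K] [GCDGA T'] [GCDGA K']

/-- A contraction of `T` onto `K` with projection `φ`, compatible with the parity. -/
structure Contraction (φ : T →ₐ[ℚ] K) where
  s : K →ₗ[ℚ] T
  h : T →ₗ[ℚ] T
  d_s : ∀ x, Dd T (s x) = 0
  φ_s : ∀ x, φ (s x) = x
  sgn_s : ∀ x, sgn T 1 (s x) = s x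
  sgn_h : ∀ x, sgn T 1 (h x) = - h (sgn T 1 x)
  homotopy : ∀ x, Dd T (h x) + h (Dd T x) = x - s (φ x)

theorem Contraction.isEvenFormalization {φ : T →ₐ[ℚ] K} (c : Contraction φ) (hφ : IsDGAHom φ)
    (hd : ∀ x, Dd K x = 0) (hK : ∀ n, Odd n → Gr K n = ⊥) : IsEvenFormalization φ where
  dga := hφ
  surj x := ⟨c.s x, c.φ_s x⟩
  quasi := ⟨fun b _ => ⟨c.s b, c.d_s b, 0, by rw [c.φ_s, sub_self, map_zero]⟩,
    fun a ha ⟨b, hb⟩ => ⟨c.h a, by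
      have := c.homotopy a
      rw [ha, hb, hd, map_zero, map_zero, add_zero, sub_zero] at this
      exact this.symm⟩⟩
  Dd_eq_zero := hd
  odd := hK

namespace IsEvenFormalization

variable {φ : T →ₐ[ℚ] K}

theorem map_Dd (hφ : IsEvenFormalization φ) (x : T) : φ (Dd T x) = 0 := by
  rw [hφ.dga.1, hφ.Dd_eq_zero]

theorem map_sgn (hφ : IsEvenFormalization φ) (x : T) : φ (sgn T 1 x) = φ x := by
  rw [← hφ.dga.sgn, sgn_of_odd_eq_bot hφ.odd]

theorem exists_exact (hφ : IsEvenFormalization φ) {x : T} (hx : Dd T x = 0) (h : φ x = 0) :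
    ∃ e, x = Dd T e :=
  hφ.quasi.2 x hx ⟨0, by rw [h, map_zero]⟩

theorem exists_closed (hφ : IsEvenFormalization φ) (b : K) : ∃ a, Dd T a = 0 ∧ φ a = b := by
  obtain ⟨a, ha, c, hc⟩ := hφ.quasi.1 b (hφ.Dd_eq_zero b)
  rw [hφ.Dd_eq_zero, sub_eq_zero] at hc
  exact ⟨a, ha, hc⟩

theorem exists_contraction (hφ : IsEvenFormalization φ) : Nonempty (Contraction φ) := by
  obtain ⟨s, hs⟩ := (φ.toLinearMap ∘ₗ (LinearMap.ker (Dd T)).subtype).exists_rightInverse_of_surjective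
    (LinearMap.range_eq_top.mpr fun b => by
      obtain ⟨a, ha, hb⟩ := hφ.exists_closed b
      exact ⟨⟨a, ha⟩, hb⟩)
  have hφs : ∀ x, φ (s x) = x := fun x => LinearMap.congr_fun hs x
  have hds : ∀ x, Dd T (s x) = 0 := fun x => (s x).2
  obtain ⟨g, hg⟩ := (Dd T).rangeRestrict.exists_rightInverse_of_surjective (Dd T).range_rangeRestrict
  obtain ⟨k, hk⟩ := LinearMap.exists_extend g
  have hdk : ∀ x, Dd T (k (Dd T x)) = Dd T x := fun x => by
    have h1 : k (Dd T x) = g ⟨Dd T x, x, rfl⟩ := LinearMap.congr_fun hk ⟨Dd T x, x, rfl⟩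
    rw [h1]
    exact congrArg Subtype.val (LinearMap.congr_fun hg ⟨Dd T x, x, rfl⟩)
  let s' : K →ₗ[ℚ] T := (LinearMap.ker (Dd T)).subtype ∘ₗ s
  let k' : T →ₗ[ℚ] T := k - s' ∘ₗ φ.toLinearMap ∘ₗ k
  have hk'1 : ∀ x, φ (k' x) = 0 := fun x => by
    change φ (k x - s (φ (k x))) = 0
    rw [map_sub, hφs, sub_self]
  have hk'2 : ∀ x, Dd T (k' (Dd T x)) = Dd T x := fun x => by
    change Dd T (k (Dd T x) - s (φ (k (Dd T x)))) = _
    rw [map_sub, hds, sub_zero, hdk]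
  let h : T →ₗ[ℚ] T := k' ∘ₗ (LinearMap.id - s' ∘ₗ φ.toLinearMap - k' ∘ₗ Dd T)
  have hh : ∀ x, Dd T (h x) + h (Dd T x) = x - s (φ x) := fun x => by
    change Dd T (k' (x - s (φ x) - k' (Dd T x))) + k' (Dd T x - s (φ (Dd T x)) - k' (Dd T (Dd T x))) = _
    rw [hφ.map_Dd, Dd_Dd]
    obtain ⟨e, he⟩ := hφ.exists_exact (x := x - s (φ x) - k' (Dd T x))
      (by rw [map_sub, map_sub, hds, hk'2]; simp) (by rw [map_sub, map_sub, hφs, hk'1]; simp)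
    rw [he, hk'2, ← he]
    simp
  refine ⟨⟨(2⁻¹ : ℚ) • (s' + sgn T 1 ∘ₗ s'), (2⁻¹ : ℚ) • (h - sgn T 1 ∘ₗ h ∘ₗ sgn T 1),
    ?_, ?_, ?_, ?_, ?_⟩⟩
  · intro x
    change Dd T ((2⁻¹ : ℚ) • ((s x : T) + sgn T 1 (s x))) = 0
    rw [map_smul, map_add, Dd_sgn, hds]; simp
  · intro x
    change φ ((2⁻¹ : ℚ) • ((s x : T) + sgn T 1 (s x))) = x
    rw [map_smul, map_add, hφ.map_sgn, hφs, ← two_smul ℚ, smul_smul]; norm_num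
  · intro x
    change sgn T 1 ((2⁻¹ : ℚ) • ((s x : T) + sgn T 1 (s x))) = (2⁻¹ : ℚ) • ((s x : T) + sgn T 1 (s x))
    rw [map_smul, map_add, sgn_sgn, add_comm]
  · intro x
    change sgn T 1 ((2⁻¹ : ℚ) • (h x - sgn T 1 (h (sgn T 1 x)))) =
      - ((2⁻¹ : ℚ) • (h (sgn T 1 x) - sgn T 1 (h (sgn T 1 (sgn T 1 x)))))
    rw [map_smul, map_sub, sgn_sgn, sgn_sgn, ← smul_neg, neg_sub]
  · intro x
    change Dd T ((2⁻¹ : ℚ) • (h x - sgn T 1 (h (sgn T 1 x)))) +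
      (2⁻¹ : ℚ) • (h (Dd T x) - sgn T 1 (h (sgn T 1 (Dd T x)))) =
      x - (2⁻¹ : ℚ) • ((s (φ x) : T) + sgn T 1 (s (φ x)))
    have h1 := hh x
    have h2 := congrArg (sgn T 1) (hh (sgn T 1 x))
    rw [Dd_sgn, map_neg, map_add, map_sub, map_neg, sgn_sgn, hφ.map_sgn] at h2
    rw [map_smul, map_sub, Dd_sgn, ← smul_add]
    have h3 : x - (2⁻¹ : ℚ) • ((s (φ x) : T) + sgn T 1 (s (φ x))) =
        (2⁻¹ : ℚ) • ((x - s (φ x)) + (x - sgn T 1 (s (φ x)))) := by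
      module
    rw [h3, ← h1, ← h2]
    congr 1
    abel

end IsEvenFormalization

theorem tm_neg_left (a : T) (b : T') : tm (-a) b = - tm a b := by
  rw [← neg_one_smul ℚ, tm_smul_left, neg_one_smul]

theorem tm_neg_right (a : T) (b : T') : tm a (-b) = - tm a b := by
  rw [← neg_one_smul ℚ, tm_smul_right, neg_one_smul]

theorem Tens.sgn_tm (s : ℕ) (a : T) (b : T') :
    sgn (Tens T T') s (tm a b) = tm (sgn T s a) (sgn T' s b) := by
  rw [← Tens.inl_mul_inr, sgn_mul, Tens.inl_dga.sgn, Tens.inr_dga.sgn, Tens.inl_mul_inr]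

/-- The homotopy of a tensor product of contractions. -/
def Contraction.tensH {φ : T →ₐ[ℚ] K} {ψ : T' →ₐ[ℚ] K'} (c : Contraction φ) (c' : Contraction ψ) :
    Tens T T' →ₗ[ℚ] Tens T T' :=
  Tens.map c.h LinearMap.id + Tens.map (c.s ∘ₗ φ.toLinearMap) c'.h

theorem Contraction.tensH_tm {φ : T →ₐ[ℚ] K} {ψ : T' →ₐ[ℚ] K'} (c : Contraction φ)
    (c' : Contraction ψ) (a : T) (b : T') :
    c.tensH c' (tm a b) = tm (c.h a) b + tm (c.s (φ a)) (c'.h b) := rfl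

/-- The tensor product of two contractions. -/
def Contraction.tens {φ : T →ₐ[ℚ] K} {ψ : T' →ₐ[ℚ] K'} (c : Contraction φ) (c' : Contraction ψ)
    (hφ : IsEvenFormalization φ) {F : Tens T T' →ₐ[ℚ] Tens K K'}
    (hF : ∀ a b, F (tm a b) = tm (φ a) (ψ b)) : Contraction F where
  s := Tens.map c.s c'.s
  h := c.tensH c'
  d_s x := by
    refine Tens.induction (p := fun x => Dd _ (Tens.map c.s c'.s x) = 0) (by simp)
      (fun x y hx hy => by rw [map_add, map_add, hx, hy, add_zero]) (fun i j a _ b _ => ?_) x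
    rw [Tens.map_tm, Tens.Dd_tm, c.d_s, c'.d_s, tm_zero_left, tm_zero_right, add_zero]
  φ_s x := by
    refine Tens.induction (p := fun x => F (Tens.map c.s c'.s x) = x) (by simp)
      (fun x y hx hy => by rw [map_add, map_add, hx, hy]) (fun i j a _ b _ => ?_) x
    rw [Tens.map_tm, hF, c.φ_s, c'.φ_s]
  sgn_s x := by
    refine Tens.induction (p := fun x => sgn _ 1 (Tens.map c.s c'.s x) = Tens.map c.s c'.s x)
      (by simp) (fun x y hx hy => by rw [map_add, map_add, hx, hy]) (fun i j a _ b _ => ?_) x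
    rw [Tens.map_tm, Tens.sgn_tm, c.sgn_s, c'.sgn_s]
  sgn_h x := by
    refine Tens.induction (p := fun x => sgn _ 1 (c.tensH c' x) = - c.tensH c' (sgn _ 1 x))
      (by simp) (fun x y hx hy => by rw [map_add, map_add, hx, hy, map_add, map_add, neg_add])
      (fun i j a _ b _ => ?_) x
    rw [c.tensH_tm, map_add, Tens.sgn_tm, Tens.sgn_tm, Tens.sgn_tm, c.tensH_tm, c.sgn_h, c'.sgn_h,
      c.sgn_s, hφ.map_sgn, tm_neg_left, tm_neg_right, neg_add]
  homotopy x := by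
    refine Tens.induction (p := fun x => Dd _ (c.tensH c' x) + c.tensH c' (Dd _ x) =
      x - Tens.map c.s c'.s (F x)) (by simp)
      (fun x y hx hy => by
        simp only [map_add]
        rw [add_add_add_comm, hx, hy]; abel) (fun i j a _ b _ => ?_) x
    have h1 := congrArg (tm · b) (c.homotopy a)
    have h2 := congrArg (tm (c.s (φ a))) (c'.homotopy b)
    simp only [sub_eq_add_neg, tm_add_left, tm_add_right, tm_neg_left, tm_neg_right] at h1 h2
    simp only [c.tensH_tm, map_add, Tens.Dd_tm, hF, Tens.map_tm, c.sgn_h, c.sgn_s, c.d_s,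
      hφ.map_sgn, hφ.map_Dd, map_zero, tm_zero_left, tm_neg_left, sub_eq_add_neg]
    linear_combination (norm := abel) h1 + h2

end Contraction

/-! ### Nilpotency and polarization in commutative algebras -/

section Polarization

variable {R : Type} [Ring R] [Algebra ℚ R]

theorem eq_zero_of_forall_sum_pow_smul {E : Type*} [AddCommGroup E] [Module ℚ E] {n : ℕ}
    {C : ℕ → E} (h : ∀ t : ℚ, ∑ k ∈ Finset.range n, t ^ k • C k = 0) {k : ℕ} (hk : k < n) :
    C k = 0 := by
  refine (Module.forall_dual_apply_eq_zero_iff ℚ _).mp fun f => ?_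
  have hp : ∑ k ∈ Finset.range n, Polynomial.C (f (C k)) * Polynomial.X ^ k = 0 := by
    refine Polynomial.funext fun t => ?_
    have := congrArg f (h t)
    rw [map_sum, map_zero] at this
    rw [Polynomial.eval_finsetSum, Polynomial.eval_zero, ← this]
    refine Finset.sum_congr rfl fun i _ => ?_
    rw [map_smul, smul_eq_mul, mul_comm (t ^ i)]
    simp
  have := congrArg (Polynomial.coeff · k) hp
  simpa [Polynomial.finsetSum_coeff, Polynomial.coeff_C_mul, Polynomial.coeff_X_pow, hk] using this

theorem pow_eq_bot_of_forall_pow_eq_zero (hR : ∀ x y : R, x * y = y * x) {M : Submodule ℚ R}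
    {c : ℕ} (h : ∀ u ∈ M, u ^ c = 0) : M ^ c = ⊥ := by
  have key : ∀ j n, j + n = c → ∀ u ∈ M, ∀ y ∈ M ^ j, u ^ n * y = 0 := by
    intro j
    induction j with
    | zero =>
      rintro n hn u hu y -
      rw [show n = c by omega, h u hu, zero_mul]
    | succ j ih =>
      intro n hn u hu y hy
      rw [pow_succ] at hy
      induction hy using Submodule.mul_induction_on' with
      | mem_mul_mem y hy v hv =>
        have hz := eq_zero_of_forall_sum_pow_smul (n := n + 2)
          (C := fun k => v ^ k * u ^ (n + 1 - k) * ((n + 1).choose k : R) * y) (fun t => by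
            have := ih (n + 1) (by omega) (t • v + u) (M.add_mem (M.smul_mem t hv) hu) y hy
            rw [(show Commute (t • v) u from hR _ _).add_pow, Finset.sum_mul] at this
            rw [← this]
            refine Finset.sum_congr rfl fun k _ => ?_
            simp only [smul_pow, smul_mul_assoc]) (k := 1) (by omega)
        have hn0 : ((n + 1 : ℕ) : ℚ) ≠ 0 := by positivity
        refine (smul_eq_zero_iff_right hn0).mp (Eq.trans ?_ hz)
        simp only [pow_one, Nat.choose_one_right, Nat.add_sub_cancel]
        rw [Nat.cast_smul_eq_nsmul, nsmul_eq_mul, hR y v, ← mul_assoc (u ^ n), hR (u ^ n) v,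
          ← Nat.cast_comm, mul_assoc, mul_assoc, mul_assoc]
      | add y _ z _ hy hz => rw [mul_add, hy, hz, add_zero]
  refine (Submodule.eq_bot_iff _).mpr fun y hy => ?_
  by_cases hM : M = ⊥
  · rcases Nat.eq_zero_or_pos c with rfl | hc
    · have := h 0 M.zero_mem
      rw [pow_zero] at this
      rw [← one_mul y, this, zero_mul]
    · rw [hM, ← Submodule.zero_eq_bot, zero_pow hc.ne'] at hy
      simpa using hy
  · have := key c 0 (by omega) 0 M.zero_mem y hy
    rwa [pow_zero, one_mul] at this

theorem submodule_mul_comm (hR : ∀ x y : R, x * y = y * x) (M N : Submodule ℚ R) :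
    M * N = N * M := by
  have : ∀ M N : Submodule ℚ R, M * N ≤ N * M := fun M N => Submodule.mul_le.mpr fun m hm n hn => by
    rw [hR]; exact Submodule.mul_mem_mul hn hm
  exact le_antisymm (this _ _) (this _ _)

theorem add_pow_eq_choose_smul {x y : R} (h : x * y = y * x) {a b : ℕ} (hx : x ^ (a + 1) = 0)
    (hy : y ^ (b + 1) = 0) : (x + y) ^ (a + b) = ((a + b).choose a : ℚ) • (x ^ a * y ^ b) := by
  rw [(show Commute x y from h).add_pow, Finset.sum_eq_single a]
  · rw [Nat.add_sub_cancel_left, Nat.cast_smul_eq_nsmul, nsmul_eq_mul, Nat.cast_comm]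
  · intro m _ hm
    rcases lt_or_gt_of_ne hm with hm | hm
    · rw [show a + b - m = b + 1 + (a - m - 1) by omega, pow_add y, hy]; simp
    · rw [show m = a + 1 + (m - a - 1) by omega, pow_add x, hx]; simp
  · intro ha
    exact absurd (Finset.mem_range.mpr (by omega)) ha

end Polarization

section TensorFormalization

open scoped TensorProduct

variable {T K T' K' : Type} [GCDGA T] [GCDGA K] [GCDGA T'] [GCDGA K']

theorem Tens.odd_eq_bot (hK : ∀ n, Odd n → Gr K n = ⊥) (hK' : ∀ n, Odd n → Gr K' n = ⊥) (n : ℕ)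
    (hn : Odd n) : Gr (Tens K K') n = ⊥ := by
  refine (Submodule.eq_bot_iff _).mpr fun x hx => ?_
  refine Tens.gr_induction (p := fun x => x = 0) rfl (fun x y hx hy => by rw [hx, hy, add_zero])
    (fun c x hx => by rw [hx, smul_zero]) (fun i j hij a ha b hb => ?_) hx
  rcases Nat.even_or_odd i with hi | hi
  · rw [hK' j (by rw [← hij] at hn; exact (Nat.odd_add'.mp hn).mpr hi), Submodule.mem_bot] at hb
    rw [hb, tm_zero_right]
  · rw [hK i hi, Submodule.mem_bot] at ha
    rw [ha, tm_zero_left]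

theorem Tens.Gr_zero_le (hT : Gr T 0 ≤ 1) (hT' : Gr T' 0 ≤ 1) : Gr (Tens T T') 0 ≤ 1 := by
  intro x hx
  refine Tens.gr_induction (p := fun x => x ∈ (1 : Submodule ℚ (Tens T T'))) (Submodule.zero_mem _)
    (fun x y hx hy => Submodule.add_mem _ hx hy) (fun c x hx => Submodule.smul_mem _ _ hx)
    (fun i j hij a ha b hb => ?_) hx
  obtain ⟨rfl, rfl⟩ : i = 0 ∧ j = 0 := by omega
  obtain ⟨p, rfl⟩ := Submodule.mem_one.mp (hT ha)
  obtain ⟨q, rfl⟩ := Submodule.mem_one.mp (hT' hb)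
  rw [Algebra.algebraMap_eq_smul_one, Algebra.algebraMap_eq_smul_one, tm_smul_left, tm_smul_right,
    tm_one_one]
  exact Submodule.smul_mem _ _ (Submodule.smul_mem _ _ (Submodule.one_le.mp le_rfl))

theorem tm_ne_zero {a : K} {b : K'} (ha : a ≠ 0) (hb : b ≠ 0) : tm a b ≠ 0 := by
  intro h
  have h0 : a ⊗ₜ[ℚ] b = 0 := (Tens.of K K').map_eq_zero_iff.mp h
  obtain ⟨f, hf⟩ := not_forall.mp ((Module.forall_dual_apply_eq_zero_iff ℚ a).not.mpr ha)
  obtain ⟨g, hg⟩ := not_forall.mp ((Module.forall_dual_apply_eq_zero_iff ℚ b).not.mpr hb)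
  have := congrArg (fun z => TensorProduct.lid ℚ ℚ (TensorProduct.map f g z)) h0
  simp only [TensorProduct.map_tmul, TensorProduct.lid_tmul, smul_eq_mul, map_zero] at this
  exact mul_ne_zero hf hg this

theorem IsEvenFormalization.tens {φ : T →ₐ[ℚ] K} {ψ : T' →ₐ[ℚ] K'} (hφ : IsEvenFormalization φ)
    (hψ : IsEvenFormalization ψ) : ∃ F : Tens T T' →ₐ[ℚ] Tens K K', IsEvenFormalization F ∧
      F.comp (Tens.inl T T') = (Tens.inl K K').comp φ ∧
      F.comp (Tens.inr T T') = (Tens.inr K K').comp ψ := by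
  obtain ⟨F, hF, hl, hr, hFtm⟩ := Tens.exists_lift (Tens.inl_dga.comp hφ.dga) (Tens.inr_dga.comp hψ.dga)
  obtain ⟨c⟩ := hφ.exists_contraction
  obtain ⟨c'⟩ := hψ.exists_contraction
  refine ⟨F, (c.tens c' hφ fun a b => ?_).isEvenFormalization hF (fun x => ?_)
    (Tens.odd_eq_bot hφ.odd hψ.odd), hl, hr⟩
  · rw [hFtm, AlgHom.comp_apply, AlgHom.comp_apply, Tens.inl_mul_inr]
  · refine Tens.induction (p := fun x => Dd (Tens K K') x = 0) (map_zero _)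
      (fun x y hx hy => by rw [map_add, hx, hy, add_zero]) (fun i j a _ b _ => ?_) x
    rw [Tens.Dd_tm, hφ.Dd_eq_zero, hψ.Dd_eq_zero, tm_zero_left, tm_zero_right, add_zero]

theorem Tens.degGE_one_pow_eq_bot (hK : ∀ n, Odd n → Gr K n = ⊥) (hK' : ∀ n, Odd n → Gr K' n = ⊥)
    {m n : ℕ} (hm : degGE K 1 ^ (m + 1) = ⊥) (hn : degGE K' 1 ^ (n + 1) = ⊥) :
    degGE (Tens K K') 1 ^ (m + n + 1) = ⊥ := by
  have hcomm := mul_comm_of_odd_eq_bot (Tens.odd_eq_bot hK hK')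
  have hI : idl ((degGE K 1).map (Tens.inl K K').toLinearMap) ^ (m + 1) = 0 := by
    rw [idl, (show Commute _ _ from submodule_mul_comm hcomm _ _).mul_pow, ← Submodule.map_pow, hm,
      Submodule.map_bot, Submodule.mul_bot, Submodule.zero_eq_bot]
  have hJ : idl ((degGE K' 1).map (Tens.inr K K').toLinearMap) ^ (n + 1) = 0 := by
    rw [idl, (show Commute _ _ from submodule_mul_comm hcomm _ _).mul_pow, ← Submodule.map_pow, hn,
      Submodule.map_bot, Submodule.mul_bot, Submodule.zero_eq_bot]
  rw [eq_bot_iff, ← Submodule.zero_eq_bot,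
    ← (show Commute _ _ from submodule_mul_comm hcomm _ _).add_pow_eq_zero_of_add_le_succ_of_pow_eq_zero
      hI hJ (k := m + n + 1) (by omega)]
  refine pow_le_pow_left' (iSup_le fun k x hx => ?_) _
  refine Tens.gr_induction (p := fun x => x ∈ _ + _) (Submodule.zero_mem _)
    (fun x y hx hy => Submodule.add_mem _ hx hy) (fun c x hx => Submodule.smul_mem _ _ hx)
    (fun i j hij a ha b hb => ?_) hx
  rw [← Tens.inl_mul_inr]
  rcases Nat.eq_zero_or_pos i with rfl | hi
  · exact Submodule.mem_sup_right (idl_mul_left _ (le_idl _ ⟨b, Gr_le_degGE (by omega) hb, rfl⟩))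
  · rw [hcomm]
    exact Submodule.mem_sup_left (idl_mul_left _ (le_idl _ ⟨a, Gr_le_degGE hi ha, rfl⟩))

end TensorFormalization

/-! ### Formalizations of tensor powers -/

section Powers

variable {A : Type} [GCDGA A]

theorem TensorPower.exists_equiv {r : ℕ} {T T' : Type} [GCDGA T] [GCDGA T']
    (TP : TensorPower A r T) (TP' : TensorPower A r T') : ∃ (g : T' →ₐ[ℚ] T) (g' : T →ₐ[ℚ] T'),
      IsDGAHom g ∧ IsDGAHom g' ∧ g.comp g' = AlgHom.id ℚ T ∧ g'.comp g = AlgHom.id ℚ T' ∧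
      ∀ j, g.comp (TP'.ι j) = TP.ι j := by
  obtain ⟨g, ⟨hg, hgι⟩, -⟩ := TP'.coprod T TP.ι TP.ι_dga
  obtain ⟨g', ⟨hg', hgι'⟩, -⟩ := TP.coprod T' TP'.ι TP'.ι_dga
  refine ⟨g, g', hg, hg', ?_, ?_, hgι⟩
  · exact (TP.coprod T TP.ι TP.ι_dga).unique
      ⟨hg.comp hg', fun j => by rw [AlgHom.comp_assoc, hgι', hgι]⟩ ⟨isDGAHom_id T, fun _ => rfl⟩
  · exact (TP'.coprod T' TP'.ι TP'.ι_dga).unique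
      ⟨hg'.comp hg, fun j => by rw [AlgHom.comp_assoc, hgι, hgι']⟩ ⟨isDGAHom_id T', fun _ => rfl⟩

/-- A formalization `Φ` of the `r`-fold tensor power whose target has nilpotency `r * c`, in which
all linear combinations of the copies of `u` with nonzero coefficients have maximal height. -/
structure IsPowerFormalization {r : ℕ} {T K : Type} [GCDGA T] [GCDGA K] (TP : TensorPower A r T)
    (c : ℕ) (u : A) (Φ : T →ₐ[ℚ] K) : Prop where
  form : IsEvenFormalization Φ
  gr_zero : Gr T 0 ≤ 1
  nilp : degGE K 1 ^ (r * c + 1) = ⊥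
  pow_ne_zero : ∀ α : Fin r → ℚ, (∀ j, α j ≠ 0) → Φ (∑ j, α j • TP.ι j u) ^ (r * c) ≠ 0

theorem IsPowerFormalization.transport {r : ℕ} {T K T' : Type} [GCDGA T] [GCDGA K] [GCDGA T']
    {TP : TensorPower A r T} {c : ℕ} {u : A} {Φ : T →ₐ[ℚ] K} (h : IsPowerFormalization TP c u Φ)
    (TP' : TensorPower A r T') : ∃ Φ' : T' →ₐ[ℚ] K, IsPowerFormalization TP' c u Φ' := by
  obtain ⟨g, g', hg, hg', hgg', hg'g, hι⟩ := TP.exists_equiv TP'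
  have h1 : ∀ x, g (g' x) = x := fun x => DFunLike.congr_fun hgg' x
  have h2 : ∀ x, g' (g x) = x := fun x => DFunLike.congr_fun hg'g x
  refine ⟨Φ.comp g, ⟨h.form.dga.comp hg, h.form.surj.comp fun x => ⟨g' x, h1 x⟩, ⟨?_, ?_⟩,
    h.form.Dd_eq_zero, h.form.odd⟩, ?_, h.nilp, fun α hα => ?_⟩
  · intro b hb
    obtain ⟨a, ha, hab⟩ := h.form.quasi.1 b hb
    exact ⟨g' a, by rw [← hg'.1, ha, map_zero], by rwa [AlgHom.comp_apply, h1]⟩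
  · intro a ha hc
    obtain ⟨e, he⟩ := h.form.quasi.2 (g a) (by rw [← hg.1, ha, map_zero]) hc
    exact ⟨g' e, by rw [← hg'.1, ← he, h2]⟩
  · intro x hx
    obtain ⟨q, hq⟩ := Submodule.mem_one.mp (h.gr_zero (hg.2 0 x hx))
    refine Submodule.mem_one.mpr ⟨q, ?_⟩
    rw [← h2 x, ← hq, AlgHom.commutes]
  · have := h.pow_ne_zero α hα
    simp only [← hι] at this
    simpa using this

theorem TensorPower.mu_dga {r : ℕ} {T : Type} [GCDGA T] (TP : TensorPower A r T) :
    IsDGAHom TP.mu :=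
  (TP.coprod A (fun _ => AlgHom.id ℚ A) (fun _ => isDGAHom_id A)).choose_spec.1.1

theorem TensorPower.mu_ι {r : ℕ} {T : Type} [GCDGA T] (TP : TensorPower A r T) (j : Fin r) (a : A) :
    TP.mu (TP.ι j a) = a :=
  DFunLike.congr_fun
    ((TP.coprod A (fun _ => AlgHom.id ℚ A) (fun _ => isDGAHom_id A)).choose_spec.1.2 j) a

theorem pow_mem_degGE_pow {K : Type} [GCDGA K] {x : K} (hx : x ∈ degGE K 1) (n : ℕ) :
    x ^ n ∈ degGE K 1 ^ n := Submodule.pow_mem_pow _ hx n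

theorem IsDGAHom.mem_degGE {T K : Type} [GCDGA T] [GCDGA K] {f : T →ₐ[ℚ] K} (hf : IsDGAHom f)
    {n : ℕ} {x : T} (hx : x ∈ degGE T n) : f x ∈ degGE K n := by
  have : degGE T n ≤ (degGE K n).comap f.toLinearMap :=
    iSup_le fun k y hy => le_iSup (fun k => Gr K (n + k)) k (hf.2 _ y hy)
  exact this hx

theorem exists_isPowerFormalization {H : Type} [GCDGA H] {φ : A →ₐ[ℚ] H}
    (hφ : IsEvenFormalization φ) (hA : Gr A 0 ≤ 1) {c : ℕ} (hnil : degGE H 1 ^ (c + 1) = ⊥) {u : A}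
    (hu : u ∈ degGE A 1) (huc : φ u ^ c ≠ 0) (r : ℕ) :
    ∃ (T : Type) (_ : GCDGA T) (TP : TensorPower A (r + 1) T) (K : Type) (_ : GCDGA K)
      (Φ : T →ₐ[ℚ] K), IsPowerFormalization TP c u Φ := by
  induction r with
  | zero =>
    refine ⟨A, _, TensorPower.one A, H, _, φ, hφ, hA, by rwa [zero_add, one_mul], fun α hα => ?_⟩
    have h : φ (∑ j, α j • u) ^ ((0 + 1) * c) ≠ 0 := by
      rw [show (0 + 1) * c = c by omega, Fin.sum_univ_one, map_smul, smul_pow]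
      exact smul_ne_zero (_root_.pow_ne_zero _ (hα 0)) huc
    exact h
  | succ r ih =>
    obtain ⟨T, _, TP, K, _, Φ, h⟩ := ih
    obtain ⟨F, hF, hl, hr⟩ := hφ.tens h.form
    have hr1 : (r + 1 + 1) * c = c + (r + 1) * c := by ring
    refine ⟨Tens A T, _, TP.succ, Tens H K, _, F, hF, Tens.Gr_zero_le hA h.gr_zero, ?_,
      fun α hα => ?_⟩
    · rw [hr1]
      exact Tens.degGE_one_pow_eq_bot hφ.odd h.form.odd hnil h.nilp
    · have hw : ∑ j, α j.succ • TP.ι j u ∈ degGE T 1 :=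
        Submodule.sum_mem _ fun j _ => Submodule.smul_mem _ _ ((TP.ι_dga j).mem_degGE hu)
      set w := ∑ j, α j.succ • TP.ι j u with hwdef
      have hsum : F (∑ j, α j • TP.succ.ι j u) =
          Tens.inl H K (α 0 • φ u) + Tens.inr H K (Φ w) := by
        have h1 : ∀ a, F (Tens.inl A T a) = Tens.inl H K (φ a) := DFunLike.congr_fun hl
        have h2 : ∀ a, F (Tens.inr A T a) = Tens.inr H K (Φ a) := DFunLike.congr_fun hr
        rw [Fin.sum_univ_succ, map_add, ← h2, map_smul, map_smul, ← h1, hwdef, map_sum, map_sum,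
          map_sum]
        simp only [map_smul]
        rfl
      have hx : φ u ^ (c + 1) = 0 := by
        have := pow_mem_degGE_pow (hφ.dga.mem_degGE hu) (c + 1)
        rwa [hnil, Submodule.mem_bot] at this
      have hy : Φ w ^ ((r + 1) * c + 1) = 0 := by
        have := pow_mem_degGE_pow (h.form.dga.mem_degGE hw) ((r + 1) * c + 1)
        rwa [h.nilp, Submodule.mem_bot] at this
      rw [hsum, hr1, add_pow_eq_choose_smul
        (mul_comm_of_odd_eq_bot (Tens.odd_eq_bot hφ.odd h.form.odd) _ _)
        (by rw [← map_pow, smul_pow, hx, smul_zero, map_zero]) (by rw [← map_pow, hy, map_zero]),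
        ← map_pow, ← map_pow, Tens.inl_mul_inr, smul_pow, tm_smul_left]
      refine smul_ne_zero ?_ (smul_ne_zero (_root_.pow_ne_zero _ (hα 0))
        (tm_ne_zero huc (h.pow_ne_zero _ fun j => hα j.succ)))
      exact_mod_cast (Nat.choose_pos (by omega)).ne'

end Powers

/-! ### Homotopy retractions from formalizations -/

section Retraction

variable {T Q K : Type} [GCDGA T] [GCDGA Q] [GCDGA K]

theorem HtpyRetraction.cohomologyInjective {ρ : T →ₐ[ℚ] Q} (R : HtpyRetraction ρ) :
    CohomologyInjective ρ := by
  intro a ha hc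
  have h1 : ∀ x, R.q (R.j x) = ρ x := DFunLike.congr_fun R.hqj
  obtain ⟨e, he⟩ := R.q_quasi.2 (R.j a) (by rw [← R.j_dga.1, ha, map_zero]) (by rwa [h1])
  refine ⟨R.τ e, ?_⟩
  rw [← R.τ_dga.1, ← he]
  exact (DFunLike.congr_fun R.hτj a).symm

theorem prod_pr (n : ℕ) (x : T × Q) : pr (T × Q) n x = (pr T n x.1, pr Q n x.2) :=
  Prod.ext (IsDGAHom.pr (f := AlgHom.fst ℚ T Q) (fun _ _ h => h.1) n x).symm
    (IsDGAHom.pr (f := AlgHom.snd ℚ T Q) (fun _ _ h => h.2) n x).symm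

/-- The pairs `(t, q)` such that `q` has a lift with the same image as `t` under `φ`. -/
def liftPairs (ρ : T →ₐ[ℚ] Q) (φ : T →ₐ[ℚ] K) : Subalgebra ℚ (T × Q) where
  carrier := {x | ∃ t, ρ t = x.2 ∧ φ t = φ x.1}
  mul_mem' := fun ⟨t, h1, h2⟩ ⟨t', h1', h2'⟩ =>
    ⟨t * t', by rw [map_mul, h1, h1']; rfl, by rw [map_mul, h2, h2', ← map_mul]; rfl⟩
  add_mem' := fun ⟨t, h1, h2⟩ ⟨t', h1', h2'⟩ =>
    ⟨t + t', by rw [map_add, h1, h1']; rfl, by rw [map_add, h2, h2', ← map_add]; rfl⟩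
  algebraMap_mem' q := ⟨algebraMap ℚ T q, ρ.commutes q, rfl⟩

theorem IsEvenFormalization.exists_htpyRetraction {φ : T →ₐ[ℚ] K} (hφ : IsEvenFormalization φ)
    {ρ : T →ₐ[ℚ] Q} (hρ : IsDGAHom ρ) (hsurj : Function.Surjective ρ)
    (hker : ∀ t, ρ t = 0 → φ t = 0) : Nonempty (HtpyRetraction ρ) := by
  let _ : GCDGA (liftPairs ρ φ) := subGCDGA (liftPairs ρ φ)
    (fun x ⟨t, h1, h2⟩ n => ⟨pr T n t, by rw [← IsDGAHom.pr hρ.2, h1, prod_pr],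
      by rw [← IsDGAHom.pr hφ.dga.2, h2, prod_pr, IsDGAHom.pr hφ.dga.2]⟩) (Dd (T × Q))
    (fun x ⟨t, h1, _⟩ => ⟨Dd T t, by rw [hρ.1, h1]; rfl, by
      change _ = φ (Dd T x.1)
      rw [hφ.map_Dd, hφ.map_Dd]⟩)
    Dd_Dd (fun _ _ => Dd_mem) isTwistedDer_Dd
  have hDd : ∀ x : liftPairs ρ φ, (Dd _ x : T × Q) = (Dd T x.1.1, Dd Q x.1.2) := fun _ => rfl
  refine ⟨⟨liftPairs ρ φ, ((AlgHom.id ℚ T).prod ρ).codRestrict _ fun t => ⟨t, rfl, rfl⟩,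
    (AlgHom.snd ℚ T Q).comp (liftPairs ρ φ).val, (AlgHom.fst ℚ T Q).comp (liftPairs ρ φ).val,
    ⟨fun t => Subtype.ext (Prod.ext rfl (hρ.1 t)), fun i t ht => ⟨ht, hρ.2 i t ht⟩⟩,
    ⟨fun _ => rfl, fun _ _ h => h.2⟩, ⟨fun _ => rfl, fun _ _ h => h.1⟩, fun q => ?_, ⟨?_, ?_⟩,
    rfl, rfl⟩⟩
  · obtain ⟨t, rfl⟩ := hsurj q
    exact ⟨⟨(t, ρ t), t, rfl, rfl⟩, rfl⟩
  · intro q hq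
    obtain ⟨t, rfl⟩ := hsurj q
    obtain ⟨t', ht', h⟩ := hφ.exists_closed (φ t)
    refine ⟨⟨(t', ρ t), t, rfl, h.symm⟩, Subtype.ext (Prod.ext ht' hq), 0, ?_⟩
    rw [map_zero]
    exact sub_self (ρ t)
  · rintro ⟨⟨t, q⟩, t0, h1, h2⟩ hx ⟨c, hc⟩
    have ht : Dd T t = 0 := congrArg (fun x : liftPairs ρ φ => x.1.1) hx
    obtain ⟨c, rfl⟩ := hsurj c
    change q = Dd Q (ρ c) at hc
    change ρ t0 = q at h1
    change φ t0 = φ t at h2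
    have h3 := hker (t0 - Dd T c) (by rw [map_sub, h1, hc, hρ.1, sub_self])
    rw [map_sub, hφ.map_Dd, sub_zero, h2] at h3
    obtain ⟨e, he⟩ := hφ.exists_exact ht h3
    obtain ⟨e', he', h4⟩ := hφ.exists_closed (φ c - φ e)
    refine ⟨⟨(e + e', ρ c), c, rfl, ?_⟩, Subtype.ext (Prod.ext ?_ hc)⟩
    · rw [map_add, h4]; abel
    · change t = Dd T (e + e')
      rw [map_add, he', add_zero, he]

end Retraction

/-! ### Cuplength, category and topological complexity -/

section Ground

/-- The ground field, concentrated in degree zero. -/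
@[reducible]
def groundGCDGA : GCDGA ℚ where
  grading n := if n = 0 then ⊤ else ⊥
  gradedAlgebra := gradedAlgebraOfProj _ trivial
    (fun i j a ha b hb => by
      split_ifs at * <;> simp_all)
    (fun n => if n = 0 then LinearMap.id else 0)
    (fun n x hx => by split_ifs at * <;> simp_all)
    (fun n m h x hx => by split_ifs at * <;> simp_all)
    fun x => Submodule.mem_iSup_of_mem 0 trivial
  grading_comm i j a b ha hb := by
    split_ifs at * <;> simp_all [mul_comm]
  d := 0
  d_sq _ := rfl
  d_grading _ _ _ := Submodule.zero_mem _
  d_leibniz _ _ _ _ := by simp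

theorem MinimalSullivan.nontrivial {A : Type} [GCDGA A] (S : MinimalSullivan A) : Nontrivial A := by
  let _ : GCDGA ℚ := groundGCDGA
  obtain ⟨g, -, -⟩ := S.free ℚ (fun _ => 0) fun _ _ => Submodule.zero_mem _
  exact g.toRingHom.domain_nontrivial

end Ground

section Ideals

variable {A : Type} [GCDGA A]

theorem Homog.isDGIdeal_fil {M : Submodule ℚ A} (hM : Homog M) (h : ∀ x ∈ M, Dd A x ∈ RHT.fil M 1)
    (k : ℕ) : IsDGIdeal (RHT.fil M k) where
  homog := hM.fil k
  mul_left a _ hx := fil_mul_left a hx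
  mul_right a _ hx := hM.fil_mul_right hx a
  d_mem := isTwistedDer_Dd.fil_shift hM 0 (fun _ => by rw [fil_zero]; trivial) h k

theorem map_fil_eq_zero {K : Type} [GCDGA K] {f : A →ₐ[ℚ] K} (hf : IsDGAHom f) {M : Submodule ℚ A}
    (hM : M ≤ degGE A 1) {n : ℕ} (hn : degGE K 1 ^ n = ⊥) {x : A} (hx : x ∈ fil M n) : f x = 0 := by
  have h : fil M n ≤ LinearMap.ker f.toLinearMap := by
    refine idl_le (fun a x hx => ?_) fun y hy => ?_
    · change f (a * x) = 0
      rw [map_mul, show f x = 0 from hx, mul_zero]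
    · have h1 : f y ∈ (M.map f.toLinearMap) ^ n := by
        rw [← Submodule.map_pow]
        exact ⟨y, hy, rfl⟩
      have h2 : M.map f.toLinearMap ≤ degGE K 1 := by
        rintro _ ⟨z, hz, rfl⟩
        exact hf.mem_degGE (hM hz)
      have h3 := pow_le_pow_left' h2 n h1
      rwa [hn, Submodule.mem_bot] at h3
  exact h hx

theorem mem_degGE_one_of_pr {x : A} (h : pr A 0 x = 0) : x ∈ degGE A 1 := by
  obtain ⟨s, hs⟩ := sum_pr x
  rw [hs]
  refine Submodule.sum_mem _ fun n _ => ?_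
  rcases Nat.eq_zero_or_pos n with rfl | hn
  · rw [h]; exact Submodule.zero_mem _
  · exact Gr_le_degGE hn (pr_mem n x)

theorem iSup_pos_Gr : ⨆ k, ⨆ (_ : 0 < k), Gr A k = degGE A 1 :=
  le_antisymm (iSup₂_le fun _ hk => Gr_le_degGE hk)
    (iSup_le fun k => le_iSup₂_of_le (1 + k) (by omega) le_rfl)

theorem MinimalSullivan.W_le_degGE (S : MinimalSullivan A) : S.W ≤ degGE A 1 := by
  refine iSup_le fun n => ?_
  rcases Nat.eq_zero_or_pos n with rfl | hn
  · rw [S.V0]; exact bot_le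
  · exact (S.V_le n).trans (Gr_le_degGE hn)

end Ideals

section Cuplength

variable {A H : Type} [GCDGA A] [GCDGA H] {φ : A →ₐ[ℚ] H}

theorem IsEvenFormalization.exists_closed_degGE (hφ : IsEvenFormalization φ) {b : H}
    (hb : b ∈ degGE H 1) :
    ∃ a ∈ degGE A 1, Dd A a = 0 ∧ φ a = b := by
  obtain ⟨a, ha, rfl⟩ := hφ.exists_closed b
  refine ⟨a - pr A 0 a, mem_degGE_one_of_pr ?_, ?_, ?_⟩
  · rw [map_sub, pr_of_mem (pr_mem 0 a), sub_self]
  · rw [map_sub, Dd_pr, ha, map_zero, sub_zero]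
  · rw [map_sub, ← IsDGAHom.pr hφ.dga.2, pr_of_mem_degGE one_pos hb, sub_zero]

theorem IsEvenFormalization.not_exact (hφ : IsEvenFormalization φ) {a : A} (h : φ a ≠ 0)
    (b : A) : a ≠ Dd A b := fun hb =>
  h (by rw [hb, hφ.map_Dd])

theorem list_ofFn_prod_mem_pow (hφ : IsEvenFormalization φ) {p : ℕ} {a : Fin p → A}
    (ha : ∀ i, a i ∈ degGE A 1) :
    φ (List.ofFn a).prod ∈ degGE H 1 ^ p := by
  rw [map_list_prod, List.map_ofFn, Submodule.pow_eq_span_pow_set]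
  exact Submodule.subset_span (Set.mem_pow.mpr
    ⟨fun i => ⟨φ (a i), hφ.dga.mem_degGE (ha i)⟩, rfl⟩)

theorem nonempty_clWitness_iff (hφ : IsEvenFormalization φ) (p : ℕ) :
    Nonempty (ClWitness A p) ↔ degGE H 1 ^ p ≠ ⊥ := by
  constructor
  · rintro ⟨w⟩ h
    have h1 := list_ofFn_prod_mem_pow hφ fun i => iSup_pos_Gr.le (w.pos i)
    rw [h, Submodule.mem_bot] at h1
    obtain ⟨e, he⟩ := hφ.exists_exact (Dd_list_prod fun x hx => by
      obtain ⟨i, rfl⟩ := (List.mem_ofFn' _ _).mp hx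
      exact w.closed i) h1
    exact w.prod_ne e he
  · intro h
    rw [Submodule.pow_eq_span_pow_set, Ne, Submodule.span_eq_bot] at h
    push Not at h
    obtain ⟨x, hx, hx0⟩ := h
    obtain ⟨b, rfl⟩ := Set.mem_pow.mp hx
    choose a ha hda hab using fun i => hφ.exists_closed_degGE (b i).2
    refine ⟨⟨a, fun i => iSup_pos_Gr.ge (ha i), hda, hφ.not_exact ?_⟩⟩
    rw [map_list_prod, List.map_ofFn]
    convert hx0 using 4
    exact hab _

theorem IsEvenFormalization.nontrivial (hφ : IsEvenFormalization φ) [Nontrivial A] : Nontrivial H := by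
  refine ⟨⟨1, 0, fun h => ?_⟩⟩
  obtain ⟨e, he⟩ := hφ.exists_exact Dd_one (by rw [map_one, h])
  have := congrArg (pr A 0) he
  rw [pr_zero_Dd, pr_of_mem one_mem_Gr] at this
  exact one_ne_zero this

theorem IsEvenFormalization.exists_pow_degGE_eq_bot (hφ : IsEvenFormalization φ)
    [FiniteDimensional ℚ (CohClasses A)] :
    ∃ N, degGE H 1 ^ N = ⊥ := by
  obtain ⟨N, hN⟩ := exists_exact_bound (A := A)
  refine ⟨N, eq_bot_iff.mpr ?_⟩
  refine ((le_idl _).trans (fil_le_degGE le_rfl N)).trans (iSup_le fun k b hb => ?_)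
  obtain ⟨a, ha, rfl⟩ := hφ.exists_closed b
  obtain ⟨w, hw⟩ := hN (N + k) (by omega) _ (pr_mem (N + k) a) (by rw [Dd_pr, ha, map_zero])
  rw [Submodule.mem_bot, ← pr_of_mem hb, IsDGAHom.pr hφ.dga.2, hw, hφ.map_Dd]

theorem isGreatest_clQ (hφ : IsEvenFormalization φ) [Nontrivial A]
    [FiniteDimensional ℚ (CohClasses A)] :
    IsGreatest {p | Nonempty (ClWitness A p)} (clQ A) := by
  have := hφ.nontrivial
  obtain ⟨N, hN⟩ := hφ.exists_pow_degGE_eq_bot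
  have hbound : ∀ {p}, Nonempty (ClWitness A p) → p ≤ N := fun {p} hp => by
    by_contra! h
    exact (nonempty_clWitness_iff hφ p).mp hp (pow_eq_zero_of_le h.le hN)
  refine ⟨Nat.sSup_mem ⟨0, ?_⟩ ?_, ?_⟩
  · refine (nonempty_clWitness_iff hφ 0).mpr ?_
    rw [pow_zero]
    exact one_ne_zero
  · exact ⟨N, fun _ => hbound⟩
  · exact fun p hp => le_csSup ⟨N, fun _ => hbound⟩ hp

end Cuplength

section Category

variable {A H : Type} [GCDGA A] [GCDGA H] {φ : A →ₐ[ℚ] H}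

theorem MinimalSullivan.isLeast_cat (S : MinimalSullivan A) (hφ : IsEvenFormalization φ) {c : ℕ}
    (hnil : degGE H 1 ^ (c + 1) = ⊥) {u : A} (hu : u ∈ degGE A 1) (hdu : Dd A u = 0)
    (huc : φ u ^ c ≠ 0) : IsLeast {n | Nonempty (CatWitness A S n)} c := by
  have hu' : u ∈ fil S.W 1 := by
    rw [fil_one]
    exact iSup_le (fun k => S.Gr_le_idl (by omega)) hu
  have hpow : ∀ n, u ^ n ∈ fil S.W n := fun n => by
    induction n with
    | zero => rw [fil_zero]; trivial
    | succ n ih => rw [pow_succ]; exact S.homog_W.fil_mul_mem ih hu'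
  constructor
  · have hP : IsDGIdeal (fil S.W (c + 1)) :=
      S.homog_W.isDGIdeal_fil (fun x hx => fil_anti _ one_le_two (S.Dd_W x hx)) _
    refine ⟨⟨hP.Quo, hP.proj, hP.proj_dga, hP.proj_surjective, ?_, ?_⟩⟩
    · rw [S.iSup_lam]
      ext x
      exact hP.proj_eq_zero
    · exact hφ.exists_htpyRetraction hP.proj_dga hP.proj_surjective fun t ht =>
        map_fil_eq_zero hφ.dga S.W_le_degGE hnil (hP.proj_eq_zero.mp ht)
  · rintro n ⟨w⟩
    let _ := w.instQ
    by_contra! h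
    obtain ⟨R⟩ := w.retr
    have hker : w.π (u ^ c) = 0 := by
      have : u ^ c ∈ LinearMap.ker w.π.toLinearMap := by
        rw [w.π_ker, S.iSup_lam]
        exact fil_anti _ h (hpow c)
      exact this
    obtain ⟨e, he⟩ := R.cohomologyInjective _ (Dd_pow_of_closed hdu c) ⟨0, by rw [hker, map_zero]⟩
    exact hφ.not_exact (by rwa [map_pow]) e he

end Category

section ZeroDivisors

variable {A : Type} [GCDGA A] {r : ℕ} {T : Type} [GCDGA T] (TP : TensorPower A r T)

theorem TensorPower.mem_kerMu {x : T} : x ∈ TP.kerMu ↔ TP.mu x = 0 := Iff.rfl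

theorem TensorPower.mem_degGE_of_pr_mu [Nontrivial A] (hT : Gr T 0 ≤ 1) {x : T}
    (hx : pr A 0 (TP.mu x) = 0) : x ∈ degGE T 1 := by
  refine mem_degGE_one_of_pr ?_
  obtain ⟨q, hq⟩ := Submodule.mem_one.mp (hT (pr_mem 0 x))
  rw [IsDGAHom.pr TP.mu_dga.2, ← hq, AlgHom.commutes] at hx
  rw [← hq, (map_eq_zero (algebraMap ℚ A)).mp hx, map_zero]

theorem TensorPower.homog_kerMu : Homog TP.kerMu := fun x hx n => by
  rw [TP.mem_kerMu] at hx ⊢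
  rw [← IsDGAHom.pr TP.mu_dga.2, hx, map_zero]

theorem TensorPower.kerMu_le_degGE [Nontrivial A] (hT : Gr T 0 ≤ 1) : TP.kerMu ≤ degGE T 1 :=
  fun x hx => TP.mem_degGE_of_pr_mu hT (by rw [TP.mem_kerMu.mp hx, map_zero])

theorem TensorPower.kerMu_pow_succ (n : ℕ) : TP.kerMu ^ (n + 1) = fil TP.kerMu (n + 1) := by
  refine le_antisymm (le_idl _) ?_
  rw [fil, idl, pow_succ', ← mul_assoc]
  refine mul_le_mul_left (Submodule.mul_le.mpr fun a _ b hb => ?_) _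
  rw [TP.mem_kerMu, map_mul, TP.mem_kerMu.mp hb, mul_zero]

theorem TensorPower.isDGIdeal_kerMu_pow (n : ℕ) : IsDGIdeal (TP.kerMu ^ (n + 1)) := by
  rw [TP.kerMu_pow_succ]
  refine TP.homog_kerMu.isDGIdeal_fil (fun x hx => le_fil_one _ ?_) _
  rw [TP.mem_kerMu] at hx ⊢
  rw [TP.mu_dga.1, hx, map_zero]

variable {TP} {c : ℕ} {u : A} {K : Type} [GCDGA K] {Φ : T →ₐ[ℚ] K}

theorem IsPowerFormalization.exists_zeroDivisor {TP : TensorPower A (r + 1) T}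
    (h : IsPowerFormalization TP c u Φ) (hr : r ≠ 0) (hdu : Dd A u = 0) :
    ∃ z, TP.mu z = 0 ∧ Dd T z = 0 ∧ Φ (z ^ ((r + 1) * c)) ≠ 0 := by
  refine ⟨∑ j, (Fin.cons (-(r : ℚ)) 1 : Fin (r + 1) → ℚ) j • TP.ι j u, ?_, ?_, ?_⟩
  · simp [map_sum, TP.mu_ι, Fin.sum_univ_succ, Nat.cast_smul_eq_nsmul ℚ]
  · simp only [map_sum, map_smul, ← (TP.ι_dga _).1, hdu, map_zero, smul_zero, Finset.sum_const_zero]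
  · rw [map_pow]
    refine h.pow_ne_zero _ (Fin.cases ?_ fun j => ?_)
    · simpa using hr
    · simp

theorem IsPowerFormalization.isLeast_TC [Nontrivial A] {TP : TensorPower A (r + 1) T}
    (h : IsPowerFormalization TP c u Φ) (hr : r ≠ 0) (hdu : Dd A u = 0) :
    IsLeast {n | Nonempty (TCWitness A (r + 1) n)} ((r + 1) * c) := by
  constructor
  · have hP := TP.isDGIdeal_kerMu_pow ((r + 1) * c)
    refine ⟨⟨T, TP, hP.Quo, hP.proj, hP.proj_dga, hP.proj_surjective, ?_, ?_⟩⟩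
    · ext x
      exact hP.proj_eq_zero
    · refine h.form.exists_htpyRetraction hP.proj_dga hP.proj_surjective fun t ht =>
        map_fil_eq_zero h.form.dga (TP.kerMu_le_degGE h.gr_zero) h.nilp ?_
      rw [← TP.kerMu_pow_succ]
      exact hP.proj_eq_zero.mp ht
  · rintro n ⟨w⟩
    let _ := w.instT
    let _ := w.instQ
    obtain ⟨R⟩ := w.retr
    obtain ⟨Ψ, hΨ⟩ := h.transport w.TP
    obtain ⟨z, hz, hdz, hne⟩ := hΨ.exists_zeroDivisor hr hdu
    by_contra! hn
    have hker : w.ρ (z ^ (n + 1)) = 0 := by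
      have : z ^ (n + 1) ∈ LinearMap.ker w.ρ.toLinearMap := by
        rw [w.ρ_ker]
        exact Submodule.pow_mem_pow _ hz _
      exact this
    obtain ⟨e, he⟩ := R.cohomologyInjective _ (Dd_pow_of_closed hdz _) ⟨0, by rw [hker, map_zero]⟩
    refine hΨ.form.not_exact (fun h0 => hne ?_) e he
    rw [map_pow] at h0 ⊢
    exact pow_eq_zero_of_le hn h0

theorem IsPowerFormalization.isGreatest_zcl [Nontrivial A] {TP : TensorPower A (r + 1) T}
    (h : IsPowerFormalization TP c u Φ) (hr : r ≠ 0) (hdu : Dd A u = 0) :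
    IsGreatest {p | Nonempty (ZclWitness A (r + 1) p)} ((r + 1) * c) := by
  constructor
  · obtain ⟨z, hz, hdz, hne⟩ := h.exists_zeroDivisor hr hdu
    refine ⟨⟨T, TP, fun _ => z, fun _ => hdz, fun _ => ⟨0, by rw [hz, map_zero]⟩,
      h.form.not_exact ?_⟩⟩
    rwa [List.ofFn_const, List.prod_replicate]
  · rintro p ⟨w⟩
    let _ := w.instT
    obtain ⟨Ψ, hΨ⟩ := h.transport w.TP
    by_contra! hp
    have h1 := list_ofFn_prod_mem_pow hΨ.form fun i => w.TP.mem_degGE_of_pr_mu hΨ.gr_zero (by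
      obtain ⟨b, hb⟩ := w.zero_div i
      rw [hb, pr_zero_Dd])
    have h2 : degGE K 1 ^ p = ⊥ := pow_eq_zero_of_le hp hΨ.nilp
    rw [h2, Submodule.mem_bot] at h1
    obtain ⟨e, he⟩ := hΨ.form.exists_exact (Dd_list_prod fun x hx => by
      obtain ⟨i, rfl⟩ := (List.mem_ofFn' _ _).mp hx
      exact w.closed i) h1
    exact w.prod_ne e he

end ZeroDivisors

/-- For an `F₀`-model (an elliptic minimal Sullivan model with
homotopy characteristic `χ_π = 0`) and any `r ≥ 2`, one has
`TC_r(ΛV) = r ⬝ cat(ΛV)`, or equivalently `zcl_r(ΛV) = r ⬝ cl_ℚ(ΛV)`. -/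
theorem TC_eq_r_mul_cat_of_F0 (A : Type) [GCDGA A] (S : MinimalSullivan A)
    (hell : Elliptic A S) (hchi : S.chiPi = 0) (r : ℕ) (hr : 2 ≤ r) :
    TC A r = r * cat A S ∧ zcl A r = r * clQ A := by
  have := S.nontrivial
  have := hell.2
  obtain ⟨H, _, φ, hφ⟩ := exists_isEvenFormalization S hell hchi
  have hcl := isGreatest_clQ hφ
  have hnil : degGE H 1 ^ (clQ A + 1) = ⊥ := by
    by_contra h
    exact (Nat.lt_succ_self _).not_ge (hcl.2 ((nonempty_clWitness_iff hφ _).mpr h))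
  have hne := (nonempty_clWitness_iff hφ _).mp hcl.1
  obtain ⟨u, hu, hdu, huc⟩ : ∃ u ∈ degGE A 1, Dd A u = 0 ∧ φ u ^ clQ A ≠ 0 := by
    by_contra! h
    refine hne (pow_eq_bot_of_forall_pow_eq_zero (mul_comm_of_odd_eq_bot hφ.odd) fun b hb => ?_)
    obtain ⟨a, ha, hda, rfl⟩ := hφ.exists_closed_degGE hb
    exact h a ha hda
  obtain ⟨r, rfl⟩ := Nat.exists_eq_succ_of_ne_zero (by omega : r ≠ 0)
  obtain ⟨T, _, TP, K, _, Φ, hΦ⟩ := exists_isPowerFormalization hφ S.Gr_zero hnil hu huc r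
  have hr0 : r ≠ 0 := by omega
  have hcat : cat A S = clQ A := (S.isLeast_cat hφ hnil hu hdu huc).csInf_eq
  exact ⟨by rw [hcat]; exact (hΦ.isLeast_TC hr0 hdu).csInf_eq, (hΦ.isGreatest_zcl hr0 hdu).csSup_eq⟩

end RHT
end
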